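/- Let f : T² → T² be a homeomorphism of exact order p ≥ 1 (f^p = id and f^k ≠ id for 0 < k < p) that is homotopic to the identity map. Then there exist an integer q coprime to p and a homeomorphism h : T² → T² such that f = h ∘ t_{q/p} ∘ h⁻¹, where t_{q/p} : T² → T² is the translation t_{q/p}(x,y) = (x + q/p mod 1, y). -/

import Mathlib

/-- The 2-torus `(ℝ/ℤ) × (ℝ/ℤ)`. -/
abbrev Torus2 : Type := AddCircle (1 : ℝ) × AddCircle (1 : ℝ)

/-- The translation `(x, y) ↦ (x + q/p, y)` of the 2-torus. -/
noncomputable def torusTranslation (q : ℤ) (p : ℕ) : Torus2 → Torus2 :=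
  fun z => (z.1 + (((q : ℝ) / (p : ℝ) : ℝ) : AddCircle (1 : ℝ)), z.2)

open Set Filter Topology Metric ComplexConjugate

/-- `u` has a continuous logarithm on `s`. -/
def HasLogOn {X : Type*} [TopologicalSpace X] (u : X → ℂ) (s : Set X) : Prop :=
  ∃ φ : X → ℂ, ContinuousOn φ s ∧ ∀ x ∈ s, u x = Complex.exp (φ x)

namespace HasLogOn

variable {X Y : Type*} [TopologicalSpace X] [TopologicalSpace Y] {u v : X → ℂ} {s t : Set X}

lemma ne_zero (h : HasLogOn u s) {x : X} (hx : x ∈ s) : u x ≠ 0 := by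
  obtain ⟨φ, -, h⟩ := h
  rw [h x hx]
  exact Complex.exp_ne_zero _

lemma mono (h : HasLogOn u s) (hts : t ⊆ s) : HasLogOn u t := by
  obtain ⟨φ, hφ, h⟩ := h
  exact ⟨φ, hφ.mono hts, fun x hx => h x (hts hx)⟩

lemma congr (h : HasLogOn u s) (huv : ∀ x ∈ s, v x = u x) : HasLogOn v s := by
  obtain ⟨φ, hφ, h⟩ := h
  exact ⟨φ, hφ, fun x hx => (huv x hx).trans (h x hx)⟩

lemma comp (h : HasLogOn u s) {g : Y → X} {r : Set Y} (hg : ContinuousOn g r)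
    (hm : MapsTo g r s) : HasLogOn (fun y => u (g y)) r := by
  obtain ⟨φ, hφ, h⟩ := h
  exact ⟨fun y => φ (g y), hφ.comp hg hm, fun y hy => h _ (hm hy)⟩

lemma mul (hu : HasLogOn u s) (hv : HasLogOn v s) : HasLogOn (fun x => u x * v x) s := by
  obtain ⟨φ, hφ, hu⟩ := hu
  obtain ⟨ψ, hψ, hv⟩ := hv
  exact ⟨fun x => φ x + ψ x, hφ.add hψ, fun x hx => by
    simp only [hu x hx, hv x hx, Complex.exp_add]⟩

lemma inv (hu : HasLogOn u s) : HasLogOn (fun x => (u x)⁻¹) s := by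
  obtain ⟨φ, hφ, hu⟩ := hu
  exact ⟨fun x => - φ x, hφ.neg, fun x hx => by simp only [hu x hx, Complex.exp_neg]⟩

lemma div (hu : HasLogOn u s) (hv : HasLogOn v s) : HasLogOn (fun x => u x / v x) s := by
  simpa only [div_eq_mul_inv] using hu.mul hv.inv

lemma zpow (hu : HasLogOn u s) (n : ℤ) : HasLogOn (fun x => u x ^ n) s := by
  obtain ⟨φ, hφ, hu⟩ := hu
  exact ⟨fun x => n * φ x, continuousOn_const.mul hφ,
    fun x hx => by simp only [hu x hx, Complex.exp_int_mul]⟩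

lemma const {c : ℂ} (hc : c ≠ 0) : HasLogOn (fun _ : X => c) s :=
  ⟨fun _ => Complex.log c, continuousOn_const, fun _ _ => (Complex.exp_log hc).symm⟩

lemma prod {ι : Type*} (I : Finset ι) {w : ι → X → ℂ} (h : ∀ i ∈ I, HasLogOn (w i) s) :
    HasLogOn (fun x => ∏ i ∈ I, w i x) s := by
  classical
  induction I using Finset.induction_on with
  | empty => simpa using const (s := s) one_ne_zero
  | insert a I ha ih =>
    simp only [Finset.prod_insert ha]
    exact (h a (Finset.mem_insert_self _ _)).mul
      (ih fun i hi => h i (Finset.mem_insert_of_mem hi))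

lemma of_slitPlane (hu : ContinuousOn u s) (h : ∀ x ∈ s, u x ∈ Complex.slitPlane) :
    HasLogOn u s :=
  ⟨fun x => Complex.log (u x), hu.clog h,
    fun x hx => (Complex.exp_log (Complex.slitPlane_ne_zero (h x hx))).symm⟩

lemma of_norm_sub_one_lt (hu : ContinuousOn u s) (h : ∀ x ∈ s, ‖u x - 1‖ < 1) :
    HasLogOn u s := by
  refine of_slitPlane hu fun x hx => ?_
  have := Complex.mem_slitPlane_of_norm_lt_one (h x hx)
  simpa using this

lemma of_normedSpace {E : Type*} [NormedAddCommGroup E] [NormedSpace ℝ E] {u : E → ℂ}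
    (hu : Continuous u) (h0 : ∀ x, u x ≠ 0) : HasLogOn u univ := by
  obtain ⟨F, ⟨-, hF⟩, -⟩ := Complex.isCoveringMapOn_exp.existsUnique_continuousMap_lifts
    ⟨u, hu⟩ (a₀ := (0 : E)) (e₀ := Complex.log (u 0)) (Complex.exp_log (h0 0)) (fun x => h0 x)
  exact ⟨F, F.continuous.continuousOn, fun x _ => (congrFun hF x).symm⟩

lemma of_retract {E : Type*} [NormedAddCommGroup E] [NormedSpace ℝ E]
    (hu : ContinuousOn u s) (h0 : ∀ x ∈ s, u x ≠ 0) {g : E → X} (hg : Continuous g)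
    (hgs : ∀ y, g y ∈ s) {g' : X → E} (hg' : ContinuousOn g' s) (hgg : ∀ x ∈ s, g (g' x) = x) :
    HasLogOn u s := by
  have h := of_normedSpace (hu.comp_continuous hg hgs) (fun y => h0 _ (hgs y))
  refine (h.comp hg' (mapsTo_univ _ _)).congr fun x hx => ?_
  simp [hgg x hx]

lemma of_ball {u : ℂ → ℂ} {c : ℂ} {r : ℝ} (hr : 0 < r) (hu : ContinuousOn u (ball c r))
    (h0 : ∀ x ∈ ball c r, u x ≠ 0) : HasLogOn u (ball c r) := by
  have ht := OpenPartialHomeomorph.univBall_target c hr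
  refine of_retract hu h0 (OpenPartialHomeomorph.continuous_univBall c r) (fun y => ?_)
    (g' := (OpenPartialHomeomorph.univBall c r).symm) ?_ (fun x hx => ?_)
  · rw [← ht]
    exact (OpenPartialHomeomorph.univBall c r).map_source (by simp)
  · rw [← ht]
    exact (OpenPartialHomeomorph.univBall c r).continuousOn_symm
  · exact (OpenPartialHomeomorph.univBall c r).right_inv (by rwa [ht])

end HasLogOn

lemma exists_int_of_exp_eq {z w : ℂ} (h : Complex.exp z = Complex.exp w) :
    ∃ n : ℤ, z = w + n * (2 * Real.pi * Complex.I) := Complex.exp_eq_exp_iff_exists_int.1 h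

/-- Two continuous logarithms of the same function on a preconnected set differ by a constant. -/
lemma exp_eqOn_sub_const {X : Type*} [TopologicalSpace X] {s : Set X} (hs : IsPreconnected s)
    {φ ψ : X → ℂ} (hφ : ContinuousOn φ s) (hψ : ContinuousOn ψ s)
    (h : ∀ x ∈ s, Complex.exp (φ x) = Complex.exp (ψ x)) {x y : X} (hx : x ∈ s) (hy : y ∈ s) :
    φ x - ψ x = φ y - ψ y := by
  have hlat : ∀ z ∈ s, ∃ n : ℤ, φ z - ψ z = n * (2 * Real.pi * Complex.I) := fun z hz => by
    obtain ⟨n, hn⟩ := exists_int_of_exp_eq (h z hz)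
    exact ⟨n, by rw [hn]; ring⟩
  choose! n hn using hlat
  have hc : ContinuousOn (fun z => ((n z : ℤ) : ℝ)) s := by
    have h1 : ContinuousOn (fun z => ((φ z - ψ z) / (2 * Real.pi * Complex.I)).re) s :=
      Complex.continuous_re.comp_continuousOn ((hφ.sub hψ).div_const _)
    refine h1.congr fun z hz => ?_
    beta_reduce
    rw [hn z hz, mul_div_cancel_right₀ _ Complex.two_pi_I_ne_zero]
    simp
  have hc' : ContinuousOn n s := Int.isClosedEmbedding_coe_real.isEmbedding.continuousOn_iff.2 hc
  rw [hn x hx, hn y hy, hs.constant hc' hx hy]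

/-- Degree of the power map: `z ^ n` has a logarithm on a circle only for `n = 0`. -/
lemma eq_zero_of_hasLogOn_zpow {r : ℝ} (hr : 0 < r) {n : ℤ}
    (h : HasLogOn (fun z : ℂ => z ^ n) (sphere 0 r)) : n = 0 := by
  have hm : MapsTo (fun θ : ℝ => (r : ℂ) * Complex.exp (θ * Complex.I)) univ (sphere 0 r) := by
    intro θ _
    simp [Complex.norm_exp_ofReal_mul_I, abs_of_pos hr]
  have hcont : Continuous (fun θ : ℝ => (r : ℂ) * Complex.exp (θ * Complex.I)) := by fun_prop
  obtain ⟨φ, hφ, h⟩ := h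
  have hψ := hφ.comp hcont.continuousOn hm
  have hr' : (r : ℂ) ≠ 0 := by exact_mod_cast hr.ne'
  have key := exp_eqOn_sub_const (s := (univ : Set ℝ)) isPreconnected_univ hψ
    (ψ := fun θ : ℝ => n * (Complex.log r + θ * Complex.I)) (by fun_prop) (fun θ _ => by
      simp only [Function.comp]
      rw [← h _ (hm (mem_univ θ)), Complex.exp_int_mul, Complex.exp_add, Complex.exp_log hr'])
    (mem_univ 0) (mem_univ (2 * Real.pi))
  have h1 : (r : ℂ) * Complex.exp (((2 * Real.pi : ℝ) : ℂ) * Complex.I) =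
      (r : ℂ) * Complex.exp (((0 : ℝ) : ℂ) * Complex.I) := by
    push_cast
    rw [Complex.exp_two_pi_mul_I]
    simp
  simp only [Function.comp, h1] at key
  have h2 : (n : ℂ) * (2 * Real.pi * Complex.I) = 0 := by
    have := sub_right_injective key
    push_cast at this
    linear_combination -this
  rcases mul_eq_zero.1 h2 with h3 | h3
  · exact_mod_cast h3
  · exact absurd h3 Complex.two_pi_I_ne_zero

/-- Induction principle for locally constant integer valued functions on a compact set of reals:
they are generated by constants and by jumps at gaps of the set. -/
lemma IsCompact.int_step_induction {M : Set ℝ} (hM : IsCompact M) {n : ℝ → ℤ}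
    (hn : ContinuousOn n M) (P : (ℝ → ℤ) → Prop) (hconst : ∀ k : ℤ, P fun _ => k)
    (hstep : ∀ (q : ℝ → ℤ) (c : ℝ) (k : ℤ), P q → c ∉ M → (∃ x ∈ M, x < c) → (∃ y ∈ M, c < y) →
      P fun s => q s + if c < s then k else 0)
    (hcongr : ∀ q q' : ℝ → ℤ, (∀ s ∈ M, q s = q' s) → P q → P q') : P n := by
  obtain ⟨δ, hδ, hδn⟩ := Metric.uniformContinuousOn_iff.1
    (hM.uniformContinuousOn_of_continuous hn) 1 one_pos
  replace hδn : ∀ x ∈ M, ∀ y ∈ M, |x - y| < δ → n x = n y := fun x hx y hy h => by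
    have := hδn x hx y hy (by rwa [Real.dist_eq])
    rw [Int.dist_eq] at this
    have h2 : |n x - n y| < 1 := by exact_mod_cast this
    have := Int.abs_lt_one_iff.1 h2
    linarith
  obtain ⟨α, hα⟩ := hM.bddBelow
  obtain ⟨β, hβ⟩ := hM.bddAbove
  have hcover : ∀ N : ℕ, ∃ q, P q ∧ (∀ s ∈ M, s ≤ α - δ + N * (δ / 2) → q s = n s) ∧
      (∀ s₀, IsGreatest (M ∩ Iic (α - δ + N * (δ / 2))) s₀ →
        ∀ s ∈ M, α - δ + N * (δ / 2) < s → q s = n s₀) := by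
    intro N
    induction N with
    | zero =>
      refine ⟨fun _ => 0, hconst 0, fun s hs h => ?_, fun s₀ hs₀ => ?_⟩
      · have := hα hs
        simp only [Nat.cast_zero, zero_mul, add_zero] at h
        linarith
      · have := hα hs₀.1.1
        have h := hs₀.1.2
        simp only [Nat.cast_zero, zero_mul, add_zero, mem_Iic] at h
        linarith
    | succ N ih =>
      obtain ⟨q, hq, h1, h2⟩ := ih
      set x := α - δ + N * (δ / 2) with hx
      have hx' : α - δ + ((N + 1 : ℕ) : ℝ) * (δ / 2) = x + δ / 2 := by push_cast; rw [hx]; ring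
      rw [hx']
      by_cases hne : (M ∩ Ioc x (x + δ / 2)).Nonempty
      · obtain ⟨s₁, hs₁M, hs₁⟩ := hne
        have hk : ∀ s ∈ M, x < s → s ≤ x + δ / 2 → n s = n s₁ := fun s hs h h' =>
          hδn s hs s₁ hs₁M (by rw [abs_lt]; constructor <;> linarith [hs₁.1, hs₁.2])
        have hgr : ∀ s₀, IsGreatest (M ∩ Iic (x + δ / 2)) s₀ → n s₀ = n s₁ := fun s₀ hs₀ =>
          hk s₀ hs₀.1.1 (lt_of_lt_of_le hs₁.1 (hs₀.2 ⟨hs₁M, hs₁.2⟩)) hs₀.1.2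
        by_cases hne' : (M ∩ Iic x).Nonempty
        · obtain ⟨s₀, hs₀⟩ := (hM.inter_right isClosed_Iic).exists_isGreatest hne'
          by_cases heq : n s₀ = n s₁
          · refine ⟨q, hq, fun s hs h => ?_, fun s' hs' s hs h => ?_⟩
            · by_cases hsx : s ≤ x
              · exact h1 s hs hsx
              · rw [h2 s₀ hs₀ s hs (not_le.1 hsx), heq, hk s hs (not_le.1 hsx) h]
            · rw [h2 s₀ hs₀ s hs (by linarith), heq, hgr s' hs']
          · have hgap : ∀ s ∈ M, x < s → s₀ + δ / 2 < s := fun s hs h => by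
              by_contra hcon
              have hs0x : s₀ ≤ x := hs₀.1.2
              refine heq ?_
              rw [← hk s hs h (by linarith)]
              exact hδn _ hs₀.1.1 _ hs (by rw [abs_lt]; constructor <;> linarith)
            have hlow : ∀ s ∈ M, s ≤ x → s < s₀ + δ / 2 := fun s hs h => by
              have := hs₀.2 ⟨hs, h⟩
              linarith
            refine ⟨_, hstep q (s₀ + δ / 2) (n s₁ - n s₀) hq ?_ ⟨s₀, hs₀.1.1, by linarith⟩
              ⟨s₁, hs₁M, hgap s₁ hs₁M hs₁.1⟩, fun s hs h => ?_, fun s' hs' s hs h => ?_⟩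
            · intro hmem
              by_cases h : s₀ + δ / 2 ≤ x
              · exact lt_irrefl _ (hlow _ hmem h)
              · exact lt_irrefl _ (hgap _ hmem (not_le.1 h))
            · by_cases hsx : s ≤ x
              · simp only [if_neg (not_lt.2 (hlow s hs hsx).le), add_zero, h1 s hs hsx]
              · have hsx := not_le.1 hsx
                simp only [if_pos (hgap s hs hsx), h2 s₀ hs₀ s hs hsx, hk s hs hsx h]
                ring
            · have hsx : x < s := by linarith
              simp only [if_pos (hgap s hs hsx), h2 s₀ hs₀ s hs hsx, hgr s' hs']
              ring
        · refine ⟨_, hconst (n s₁), fun s hs h => ?_, fun s' hs' s hs h => (hgr s' hs').symm⟩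
          have hsx : x < s := by
            by_contra hcon
            exact hne' ⟨s, hs, not_lt.1 hcon⟩
          exact (hk s hs hsx h).symm
      · have hE : ∀ s ∈ M, s ≤ x + δ / 2 → s ≤ x := fun s hs h => by
          by_contra hcon
          exact hne ⟨s, hs, not_le.1 hcon, h⟩
        refine ⟨q, hq, fun s hs h => h1 s hs (hE s hs h), fun s₀ hs₀ s hs h => ?_⟩
        refine h2 s₀ ⟨⟨hs₀.1.1, hE _ hs₀.1.1 hs₀.1.2⟩, fun y hy => hs₀.2 ⟨hy.1, ?_⟩⟩ s hs
          (by linarith)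
        have : y ≤ x := hy.2
        simp only [mem_Iic]
        linarith
  obtain ⟨N, hN⟩ := exists_nat_gt ((β - α + δ) / (δ / 2))
  obtain ⟨q, hq, h1, -⟩ := hcover N
  refine hcongr q n (fun s hs => h1 s hs ?_) hq
  rw [div_lt_iff₀ (by positivity)] at hN
  linarith [hβ hs]

/-- Finite products of integer powers of the functions `z - c`, with `c` in `C`. -/
inductive LinProd (C : Set ℂ) : (ℂ → ℂ) → Prop
  | one : LinProd C fun _ => 1
  | mul (c : ℂ) (n : ℤ) (w : ℂ → ℂ) : c ∈ C → LinProd C w → LinProd C fun z => (z - c) ^ n * w z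

namespace LinProd

variable {C D : Set ℂ} {v w : ℂ → ℂ}

lemma mono (hw : LinProd C w) (h : C ⊆ D) : LinProd D w := by
  induction hw with
  | one => exact .one
  | mul c n w hc _ ih => exact .mul c n w (h hc) ih

lemma mul' (hv : LinProd C v) (hw : LinProd C w) : LinProd C fun z => v z * w z := by
  induction hv with
  | one => simpa using hw
  | mul c n v hc _ ih => simpa only [mul_assoc] using LinProd.mul c n _ hc ih

lemma ne_zero (hw : LinProd C w) {z : ℂ} (hz : z ∉ C) : w z ≠ 0 := by
  induction hw with
  | one => exact one_ne_zero
  | mul c n w hc _ ih =>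
    refine mul_ne_zero (zpow_ne_zero _ (sub_ne_zero.2 ?_)) ih
    rintro rfl
    exact hz hc

lemma single {c : ℂ} (hc : c ∈ C) (n : ℤ) : LinProd C fun z => (z - c) ^ n := by
  simpa using LinProd.mul c n _ hc .one

/-- Up to a function with a logarithm, the factors with logarithms may be dropped. -/
lemma exists_eq_mul_hasLogOn (hw : LinProd C w) {s : Set ℂ}
    (h : ∀ c ∈ C, c ∈ D ∨ HasLogOn (fun z => z - c) s) :
    ∃ w', LinProd D w' ∧ ∃ r : ℂ → ℂ, HasLogOn r s ∧ ∀ z, w z = w' z * r z := by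
  induction hw with
  | one => exact ⟨_, .one, _, HasLogOn.const one_ne_zero, fun z => by simp⟩
  | mul c n w hc _ ih =>
    obtain ⟨w', hw', r, hr, hwr⟩ := ih
    rcases h c hc with hD | hL
    · exact ⟨_, .mul c n w' hD hw', r, hr, fun z => by simp only [hwr z, mul_assoc]⟩
    · exact ⟨w', hw', _, (hL.zpow n).mul hr, fun z => by simp only [hwr z]; ring⟩

lemma hasLogOn (hw : LinProd C w) {s : Set ℂ} (h : ∀ c ∈ C, HasLogOn (fun z => z - c) s) :
    HasLogOn w s := by
  induction hw with
  | one => exact HasLogOn.const one_ne_zero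
  | mul c n w hc _ ih => exact ((h c hc).zpow n).mul ih

end LinProd

/-- The half plane `Re (a z) ≤ t`. -/
def halfPlane (a : ℂ) (t : ℝ) : Set ℂ := {z | (a * z).re ≤ t}

lemma isClosed_halfPlane (a : ℂ) (t : ℝ) : IsClosed (halfPlane a t) :=
  isClosed_le (by fun_prop) continuous_const

lemma mem_halfPlane_neg {a : ℂ} {t : ℝ} {z : ℂ} : z ∈ halfPlane (-a) (-t) ↔ t ≤ (a * z).re := by
  simp only [halfPlane, mem_ofPred_eq, neg_mul, Complex.neg_re, neg_le_neg_iff]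

lemma hasLogOn_sub_of_halfPlane {a : ℂ} (ha : a ≠ 0) {t : ℝ} {c : ℂ}
    (hc : c ∈ halfPlane a t) {s : Set ℂ} (hs : s ⊆ halfPlane (-a) (-t)) (hcs : c ∉ s) :
    HasLogOn (fun z => z - c) s := by
  have h : HasLogOn (fun z => a * (z - c)) s := by
    refine HasLogOn.of_slitPlane (by fun_prop) fun z hz => ?_
    have h0 : a * (z - c) ≠ 0 := mul_ne_zero ha (sub_ne_zero.2 fun h => hcs (h ▸ hz))
    have h1 : 0 ≤ (a * (z - c)).re := by
      have h2 := mem_halfPlane_neg.1 (hs hz)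
      have h3 : (a * c).re ≤ t := hc
      rw [mul_sub, Complex.sub_re]
      linarith
    rw [Complex.mem_slitPlane_iff]
    rcases h1.lt_or_eq with h1 | h1
    · exact Or.inl h1
    · refine Or.inr fun h2 => h0 (Complex.ext ?_ ?_)
      · simp [h1.symm]
      · simp [h2]
  refine (h.mul (HasLogOn.const (inv_ne_zero ha))).congr fun z _ => ?_
  field_simp

/-- The integer valued function `n` on `A ∩ B` is the discrepancy between two logarithms, on `A`
and on `B`, of a product of linear factors. -/
def IsLogJump (C A B : Set ℂ) (n : ℂ → ℤ) : Prop :=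
  ∃ w ψ₁ ψ₂ : ℂ → ℂ, LinProd C w ∧ ContinuousOn ψ₁ A ∧ ContinuousOn ψ₂ B ∧
    (∀ z ∈ A, w z = Complex.exp (ψ₁ z)) ∧ (∀ z ∈ B, w z = Complex.exp (ψ₂ z)) ∧
    ∀ z ∈ A ∩ B, ψ₁ z - ψ₂ z = n z * (2 * Real.pi * Complex.I)

namespace IsLogJump

variable {C A B : Set ℂ} {n m : ℂ → ℤ}

lemma const (k : ℤ) : IsLogJump C A B fun _ => k :=
  ⟨fun _ => 1, fun _ => k * (2 * Real.pi * Complex.I), fun _ => 0, .one, continuousOn_const,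
    continuousOn_const, fun _ _ => (Complex.exp_int_mul_two_pi_mul_I k).symm, by simp, by simp⟩

lemma add (hn : IsLogJump C A B n) (hm : IsLogJump C A B m) :
    IsLogJump C A B fun z => n z + m z := by
  obtain ⟨w, ψ₁, ψ₂, hw, h1, h2, e1, e2, h⟩ := hn
  obtain ⟨w', ψ₁', ψ₂', hw', h1', h2', e1', e2', h'⟩ := hm
  refine ⟨_, fun z => ψ₁ z + ψ₁' z, fun z => ψ₂ z + ψ₂' z, hw.mul' hw', h1.add h1', h2.add h2',
    fun z hz => by simp only [e1 z hz, e1' z hz, Complex.exp_add],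
    fun z hz => by simp only [e2 z hz, e2' z hz, Complex.exp_add], fun z hz => ?_⟩
  push_cast
  linear_combination h z hz + h' z hz

lemma congr (hn : IsLogJump C A B n) (h : ∀ z ∈ A ∩ B, n z = m z) : IsLogJump C A B m := by
  obtain ⟨w, ψ₁, ψ₂, hw, h1, h2, e1, e2, h'⟩ := hn
  exact ⟨w, ψ₁, ψ₂, hw, h1, h2, e1, e2, fun z hz => by rw [← h z hz, h' z hz]⟩

lemma log_sub_log_neg {y : ℝ} (hy : y ≠ 0) :
    Complex.log (-(y * Complex.I)) - Real.pi * Complex.I - Complex.log (y * Complex.I) =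
      ((if 0 < y then (-1 : ℤ) else 0 : ℤ) : ℂ) * (2 * Real.pi * Complex.I) := by
  have e1 : -((y : ℂ) * Complex.I) = (y : ℂ) * (-Complex.I) := by ring
  have e2 : (y : ℂ) * (-Complex.I) = ((-y : ℝ) : ℂ) * Complex.I := by push_cast; ring
  have e3 : (y : ℂ) * Complex.I = ((-y : ℝ) : ℂ) * (-Complex.I) := by push_cast; ring
  rcases lt_or_gt_of_ne hy with h | h
  · rw [if_neg h.le.not_gt, e1, e2, e3, Complex.log_ofReal_mul (by linarith) Complex.I_ne_zero,
      Complex.log_ofReal_mul (by linarith) (neg_ne_zero.2 Complex.I_ne_zero), Complex.log_I,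
      Complex.log_neg_I]
    push_cast
    ring
  · rw [if_pos h, e1, Complex.log_ofReal_mul h Complex.I_ne_zero,
      Complex.log_ofReal_mul h (neg_ne_zero.2 Complex.I_ne_zero), Complex.log_I,
      Complex.log_neg_I]
    push_cast
    ring

lemma ite_im_lt {a : ℂ} (ha : a ≠ 0) {t : ℝ} {c : ℂ} (hC : c ∈ C) (hc : (a * c).re = t) (k : ℤ)
    (hA : A ⊆ halfPlane a t) (hB : B ⊆ halfPlane (-a) (-t)) (hcA : c ∉ A) (hcB : c ∉ B) :
    IsLogJump C A B fun z => if (a * c).im < (a * z).im then k else 0 := by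
  have hslit : ∀ ζ : ℂ, ζ ≠ 0 → 0 ≤ ζ.re → ζ ∈ Complex.slitPlane := fun ζ h0 h1 => by
    rw [Complex.mem_slitPlane_iff]
    rcases h1.lt_or_eq with h1 | h1
    · exact Or.inl h1
    · exact Or.inr fun h2 => h0 (Complex.ext (by simp [h1.symm]) (by simp [h2]))
  have hne : ∀ z, z ≠ c → a * (z - c) ≠ 0 := fun z hz => mul_ne_zero ha (sub_ne_zero.2 hz)
  have hsA : ∀ z ∈ A, -(a * (z - c)) ∈ Complex.slitPlane := fun z hz => by
    refine hslit _ (neg_ne_zero.2 (hne z fun h => hcA (h ▸ hz))) ?_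
    have h2 : (a * z).re ≤ t := hA hz
    rw [Complex.neg_re, mul_sub, Complex.sub_re]
    linarith
  have hsB : ∀ z ∈ B, a * (z - c) ∈ Complex.slitPlane := fun z hz => by
    refine hslit _ (hne z fun h => hcB (h ▸ hz)) ?_
    have h2 := mem_halfPlane_neg.1 (hB hz)
    rw [mul_sub, Complex.sub_re]
    linarith
  refine ⟨fun z => (z - c) ^ (-k),
    fun z => ((-k : ℤ) : ℂ) *
      (Complex.log (-(a * (z - c))) - Real.pi * Complex.I - Complex.log a),
    fun z => ((-k : ℤ) : ℂ) * (Complex.log (a * (z - c)) - Complex.log a), .single hC _,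
    ?_, ?_, fun z hz => ?_, fun z hz => ?_, fun z hz => ?_⟩
  · refine continuousOn_const.mul (((ContinuousOn.clog (by fun_prop) hsA).sub
      continuousOn_const).sub continuousOn_const)
  · exact continuousOn_const.mul ((ContinuousOn.clog (by fun_prop) hsB).sub continuousOn_const)
  · have hz' := hne z fun h => hcA (h ▸ hz)
    rw [Complex.exp_int_mul, Complex.exp_sub, Complex.exp_sub, Complex.exp_log ha,
      Complex.exp_log (neg_ne_zero.2 hz'), Complex.exp_pi_mul_I]
    field_simp
  · have hz' := hne z fun h => hcB (h ▸ hz)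
    rw [Complex.exp_int_mul, Complex.exp_sub, Complex.exp_log ha, Complex.exp_log hz']
    field_simp
  · have hz' := hne z fun h => hcB (h ▸ hz.2)
    have hre : (a * (z - c)).re = 0 := by
      have h1 : (a * z).re ≤ t := hA hz.1
      have h2 := mem_halfPlane_neg.1 (hB hz.2)
      rw [mul_sub, Complex.sub_re]
      linarith
    have hform : a * (z - c) = ((a * (z - c)).im : ℂ) * Complex.I := by
      apply Complex.ext <;> simp [hre]
    have hy : (a * (z - c)).im ≠ 0 := fun h => hz' (by rw [hform, h]; simp)
    have key := log_sub_log_neg hy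
    rw [← hform] at key
    have him : (0 < (a * (z - c)).im) ↔ ((a * c).im < (a * z).im) := by
      rw [mul_sub, Complex.sub_im, sub_pos]
    simp only [him] at key
    beta_reduce
    split_ifs at key ⊢ with h
    · push_cast at key ⊢
      linear_combination (-(k : ℂ)) * key
    · push_cast at key ⊢
      linear_combination (-(k : ℂ)) * key

end IsLogJump

/-- On `K ∩ S`, the function `u` has a logarithm up to linear factors not vanishing on `K`. -/
def HasLinLogOn (u : ℂ → ℂ) (K S : Set ℂ) : Prop :=
  ∃ w, LinProd Kᶜ w ∧ HasLogOn (fun z => u z / w z) (K ∩ S)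

lemma HasLogOn.exists_isLogJump {a : ℂ} (ha : a ≠ 0) {t : ℝ} {K S : Set ℂ} (hK : IsCompact K)
    (hS : IsClosed S) (hSc : Convex ℝ S) {φ₁ φ₂ : ℂ → ℂ}
    (h1 : ContinuousOn φ₁ (K ∩ (S ∩ halfPlane a t)))
    (h2 : ContinuousOn φ₂ (K ∩ (S ∩ halfPlane (-a) (-t))))
    (h : ∀ z ∈ K ∩ (S ∩ halfPlane a t), z ∈ K ∩ (S ∩ halfPlane (-a) (-t)) →
      Complex.exp (φ₁ z) = Complex.exp (φ₂ z)) :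
    ∃ n : ℂ → ℤ, IsLogJump Kᶜ (K ∩ (S ∩ halfPlane a t)) (K ∩ (S ∩ halfPlane (-a) (-t))) n ∧
      ∀ z ∈ (K ∩ (S ∩ halfPlane a t)) ∩ (K ∩ (S ∩ halfPlane (-a) (-t))),
        φ₁ z - φ₂ z = n z * (2 * Real.pi * Complex.I) := by
  set A := K ∩ (S ∩ halfPlane a t) with hA
  set B := K ∩ (S ∩ halfPlane (-a) (-t)) with hB
  have hAc : IsCompact A := hK.inter_right (hS.inter (isClosed_halfPlane _ _))
  have hBc : IsClosed B := hK.isClosed.inter (hS.inter (isClosed_halfPlane _ _))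
  have hlat : ∀ z ∈ A ∩ B, ∃ n : ℤ, φ₁ z - φ₂ z = n * (2 * Real.pi * Complex.I) :=
    fun z hz => by
      obtain ⟨n, hn⟩ := exists_int_of_exp_eq (h z hz.1 hz.2)
      exact ⟨n, by rw [hn]; ring⟩
  choose! n hn using hlat
  have hnc : ContinuousOn n (A ∩ B) := by
    refine Int.isClosedEmbedding_coe_real.isEmbedding.continuousOn_iff.2 ?_
    have h1 : ContinuousOn (fun z => ((φ₁ z - φ₂ z) / (2 * Real.pi * Complex.I)).re) (A ∩ B) :=
      Complex.continuous_re.comp_continuousOn (((h1.mono inter_subset_left).sub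
        (h2.mono inter_subset_right)).div_const _)
    refine h1.congr fun z hz => ?_
    beta_reduce
    rw [hn z hz, mul_div_cancel_right₀ _ Complex.two_pi_I_ne_zero]
    simp
  refine ⟨n, ?_, hn⟩
  set M : Set ℝ := (fun z => (a * z).im) '' (A ∩ B) with hM
  have hMc : IsCompact M := (hAc.inter_right hBc).image (by fun_prop)
  set ι : ℝ → ℂ := fun s => a⁻¹ * (t + s * Complex.I) with hι
  have hιc : Continuous ι := by fun_prop
  have haι : ∀ s, a * ι s = t + s * Complex.I := fun s => by
    rw [hι]
    field_simp
  have hre : ∀ z ∈ A ∩ B, (a * z).re = t := fun z hz =>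
    le_antisymm hz.1.2.2 (mem_halfPlane_neg.1 hz.2.2.2)
  have hιz : ∀ z ∈ A ∩ B, ι ((a * z).im) = z := fun z hz => by
    have : (t : ℂ) + (a * z).im * Complex.I = a * z := by
      rw [← hre z hz]
      exact Complex.re_add_im _
    rw [hι]
    simp only [this]
    field_simp
  have hιM : MapsTo ι M (A ∩ B) := by
    rintro _ ⟨z, hz, rfl⟩
    beta_reduce
    rwa [hιz z hz]
  have key := hMc.int_step_induction (n := fun s => n (ι s)) (hnc.comp hιc.continuousOn hιM)
    (fun q => IsLogJump Kᶜ A B fun z => q (a * z).im) (fun k => IsLogJump.const k) ?_ ?_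
  · exact key.congr fun z hz => by simp only [hιz z hz]
  · intro q c k hq hc ⟨x, hx, hxc⟩ ⟨y, hy, hcy⟩
    have hmem : ι c ∈ S := by
      have hxS : ι x ∈ S := (hιM hx).1.2.1
      have hyS : ι y ∈ S := (hιM hy).1.2.1
      have hyx : (0 : ℝ) < y - x := by linarith
      have := hSc hxS hyS (a := (y - c) / (y - x)) (b := (c - x) / (y - x))
        (by apply div_nonneg <;> linarith) (by apply div_nonneg <;> linarith)
        (by field_simp; ring)
      convert this using 1
      simp only [hι, Complex.real_smul]
      have : (y : ℂ) - x ≠ 0 := by exact_mod_cast hyx.ne'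
      push_cast
      field_simp
      ring
    have h1 : (a * ι c).re = t := by rw [haι]; simp
    have h2 : (a * ι c).im = c := by rw [haι]; simp
    have hcAB : ι c ∉ K := fun hK => hc ⟨ι c, ⟨⟨hK, hmem, h1.le⟩, hK, hmem,
      mem_halfPlane_neg.2 h1.ge⟩, h2⟩
    have := IsLogJump.ite_im_lt (A := A) (B := B) (C := Kᶜ) ha hcAB h1 k (fun z hz => hz.2.2)
      (fun z hz => hz.2.2) (fun h => hcAB h.1) (fun h => hcAB h.1)
    rw [h2] at this
    exact hq.add this
  · intro q q' hqq hq
    exact hq.congr fun z hz => hqq _ ⟨z, hz, rfl⟩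

lemma HasLinLogOn.glue {a : ℂ} (ha : a ≠ 0) {t : ℝ} {K S : Set ℂ} (hK : IsCompact K)
    (hS : IsClosed S) (hSc : Convex ℝ S) {u : ℂ → ℂ}
    (h1 : HasLinLogOn u K (S ∩ halfPlane a t))
    (h2 : HasLinLogOn u K (S ∩ halfPlane (-a) (-t))) : HasLinLogOn u K S := by
  have hred : ∀ (b : ℂ) (r : ℝ), b ≠ 0 → HasLinLogOn u K (S ∩ halfPlane b r) →
      ∃ w, LinProd (Kᶜ ∩ halfPlane b r) w ∧
        HasLogOn (fun z => u z / w z) (K ∩ (S ∩ halfPlane b r)) := by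
    rintro b r hb ⟨w, hw, hlog⟩
    obtain ⟨w', hw', q, hq, hwq⟩ := hw.exists_eq_mul_hasLogOn (D := Kᶜ ∩ halfPlane b r)
      (s := K ∩ (S ∩ halfPlane b r)) fun c hc => by
        by_cases hcH : c ∈ halfPlane b r
        · exact Or.inl ⟨hc, hcH⟩
        · refine Or.inr (hasLogOn_sub_of_halfPlane (neg_ne_zero.2 hb) (t := -r)
            (mem_halfPlane_neg.2 (not_le.1 hcH).le) ?_ fun h => hc h.1)
          simp only [neg_neg]
          exact fun z hz => hz.2.2
    refine ⟨w', hw', (hlog.mul hq).congr fun z hz => ?_⟩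
    have := hq.ne_zero hz
    have h0 : w' z ≠ 0 := hw'.ne_zero fun h => h.1 hz.1
    rw [hwq z]
    field_simp
  obtain ⟨w₁, hw₁, hl₁⟩ := hred a t ha h1
  obtain ⟨w₂, hw₂, hl₂⟩ := hred (-a) (-t) (neg_ne_zero.2 ha) h2
  have hl₁₂ : HasLogOn w₂ (K ∩ (S ∩ halfPlane a t)) := hw₂.hasLogOn fun c hc => by
    refine hasLogOn_sub_of_halfPlane (neg_ne_zero.2 ha) hc.2 ?_ fun h => hc.1 h.1
    simp only [neg_neg]
    exact fun z hz => hz.2.2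
  have hl₂₁ : HasLogOn w₁ (K ∩ (S ∩ halfPlane (-a) (-t))) := hw₁.hasLogOn fun c hc =>
    hasLogOn_sub_of_halfPlane ha hc.2 (fun z hz => hz.2.2) fun h => hc.1 h.1
  obtain ⟨φ₁, hφ₁, e₁⟩ := hl₁.div hl₁₂
  obtain ⟨φ₂, hφ₂, e₂⟩ := hl₂.div hl₂₁
  obtain ⟨n, ⟨w, ψ₁, ψ₂, hw, hψ₁, hψ₂, f₁, f₂, hψ⟩, hn⟩ :=
    HasLogOn.exists_isLogJump ha hK hS hSc hφ₁ hφ₂ fun z hz hz' => by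
      rw [← e₁ z hz, ← e₂ z hz']
      exact div_right_comm _ _ _
  set A := K ∩ (S ∩ halfPlane a t)
  set B := K ∩ (S ∩ halfPlane (-a) (-t))
  have hAB : K ∩ S = A ∪ B := by
    ext z
    constructor
    · intro hz
      rcases le_total ((a * z).re) t with h | h
      · exact Or.inl ⟨hz.1, hz.2, h⟩
      · exact Or.inr ⟨hz.1, hz.2, mem_halfPlane_neg.2 h⟩
    · rintro (hz | hz)
      · exact ⟨hz.1, hz.2.1⟩
      · exact ⟨hz.1, hz.2.1⟩
  have hAc : IsClosed A := hK.isClosed.inter (hS.inter (isClosed_halfPlane _ _))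
  have hBc : IsClosed B := hK.isClosed.inter (hS.inter (isClosed_halfPlane _ _))
  classical
  refine ⟨fun z => (w₁ z * w₂ z) * w z,
    ((hw₁.mono inter_subset_left).mul' (hw₂.mono inter_subset_left)).mul' hw,
    fun z => if z ∈ A then φ₁ z - ψ₁ z else φ₂ z - ψ₂ z, ?_, ?_⟩
  · rw [hAB]
    have hB : ∀ z ∈ B, (if z ∈ A then φ₁ z - ψ₁ z else φ₂ z - ψ₂ z) = φ₂ z - ψ₂ z := by
      intro z hz
      split_ifs with h
      · linear_combination hn z ⟨h, hz⟩ - hψ z ⟨h, hz⟩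
      · rfl
    refine ContinuousOn.union_of_isClosed ?_ ?_ hAc hBc
    · exact (hφ₁.sub hψ₁).congr fun z hz => if_pos hz
    · exact (hφ₂.sub hψ₂).congr hB
  · rw [hAB]
    intro z hz
    beta_reduce
    by_cases h : z ∈ A
    · rw [if_pos h, Complex.exp_sub, ← f₁ z h, ← e₁ z h]
      field_simp
    · have h' := hz.resolve_left h
      rw [if_neg h, Complex.exp_sub, ← f₂ z h', ← e₂ z h']
      field_simp

lemma convex_reProdIm_Icc (a b c d : ℝ) : Convex ℝ (Icc a b ×ℂ Icc c d) := by
  intro x hx y hy α β hα hβ hαβ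
  simp only [Complex.mem_reProdIm] at *
  have h1 := convex_Icc a b hx.1 hy.1 hα hβ hαβ
  have h2 := convex_Icc c d hx.2 hy.2 hα hβ hαβ
  simp only [smul_eq_mul] at h1 h2
  simpa using And.intro h1 h2

lemma isClosed_reProdIm_Icc (a b c d : ℝ) : IsClosed (Icc a b ×ℂ Icc c d) :=
  isClosed_Icc.reProdIm isClosed_Icc

/-- A nonvanishing continuous function on a compact plane set is, up to an exponential factor,
a product of integer powers of functions `z - c` with `c` outside the set. -/
theorem IsCompact.hasLinLogOn {K : Set ℂ} (hK : IsCompact K) {u : ℂ → ℂ} (hu : ContinuousOn u K)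
    (h0 : ∀ z ∈ K, u z ≠ 0) : ∃ w, LinProd Kᶜ w ∧ HasLogOn (fun z => u z / w z) K := by
  rcases K.eq_empty_or_nonempty with rfl | hne
  · exact ⟨_, .one, fun _ => 0, by simp, by simp⟩
  obtain ⟨z₀, hz₀, hmin⟩ := hK.exists_isMinOn hne hu.norm
  have hm : 0 < ‖u z₀‖ := norm_pos_iff.2 (h0 z₀ hz₀)
  obtain ⟨δ, hδ, hδu⟩ := Metric.uniformContinuousOn_iff.1
    (hK.uniformContinuousOn_of_continuous hu) _ hm
  have hsmall : ∀ x y : ℝ, HasLinLogOn u K (Icc x (x + δ / 3) ×ℂ Icc y (y + δ / 3)) := by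
    intro x y
    refine ⟨_, .one, ?_⟩
    rcases (K ∩ (Icc x (x + δ / 3) ×ℂ Icc y (y + δ / 3))).eq_empty_or_nonempty with h | ⟨p, hp⟩
    · rw [h]
      exact ⟨fun _ => 0, by simp, by simp⟩
    have hp0 := h0 p hp.1
    have hlog : HasLogOn (fun z => u z / u p)
        (K ∩ (Icc x (x + δ / 3) ×ℂ Icc y (y + δ / 3))) := by
      refine HasLogOn.of_norm_sub_one_lt ((hu.mono inter_subset_left).div_const _) fun z hz => ?_
      have hd : dist z p < δ := by
        obtain ⟨⟨a1, a2⟩, a3, a4⟩ := hz.2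
        obtain ⟨⟨b1, b2⟩, b3, b4⟩ := hp.2
        rw [dist_eq_norm]
        refine (Complex.norm_le_abs_re_add_abs_im _).trans_lt ?_
        have e1 : |(z - p).re| ≤ δ / 3 := by
          rw [Complex.sub_re, abs_le]; constructor <;> linarith
        have e2 : |(z - p).im| ≤ δ / 3 := by
          rw [Complex.sub_im, abs_le]; constructor <;> linarith
        linarith
      have h1 := hδu z hz.1 p hp.1 hd
      rw [dist_eq_norm] at h1
      rw [div_sub_one hp0, norm_div, div_lt_one (norm_pos_iff.2 hp0)]
      exact h1.trans_le (hmin hp.1)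
    refine (hlog.mul (HasLogOn.const hp0)).congr fun z _ => ?_
    field_simp
  have hcol : ∀ (x y : ℝ) (N : ℕ),
      HasLinLogOn u K (Icc x (x + δ / 3) ×ℂ Icc y (y + (N + 1) * (δ / 3))) := by
    intro x y N
    induction N with
    | zero => simpa using hsmall x y
    | succ N ih =>
      refine HasLinLogOn.glue (a := -Complex.I) (by simp) (t := y + (N + 1) * (δ / 3)) hK
        (isClosed_reProdIm_Icc _ _ _ _) (convex_reProdIm_Icc _ _ _ _) ?_ ?_
      · convert ih using 1
        ext z
        simp only [halfPlane, mem_inter_iff, Complex.mem_reProdIm, mem_Icc, mem_ofPred_eq]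
        push_cast
        simp only [neg_mul, Complex.neg_re, Complex.mul_re, Complex.I_re, Complex.I_im]
        constructor
        · rintro ⟨⟨h1, h2, h3⟩, h4⟩
          exact ⟨h1, h2, by linarith⟩
        · rintro ⟨h1, h2, h3⟩
          exact ⟨⟨h1, h2, by linarith⟩, by linarith⟩
      · convert hsmall x (y + (N + 1) * (δ / 3)) using 1
        ext z
        rw [mem_inter_iff, mem_halfPlane_neg]
        simp only [Complex.mem_reProdIm, mem_Icc]
        push_cast
        simp only [neg_mul, Complex.neg_re, Complex.mul_re, Complex.I_re, Complex.I_im]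
        have : 0 ≤ (N : ℝ) * δ := by positivity
        constructor
        · rintro ⟨⟨h1, h2, h3⟩, h4⟩
          exact ⟨h1, by linarith, by linarith⟩
        · rintro ⟨h1, h2, h3⟩
          exact ⟨⟨h1, by linarith, by linarith⟩, by linarith⟩
  have hrow : ∀ (x y : ℝ) (L N : ℕ),
      HasLinLogOn u K (Icc x (x + (N + 1) * (δ / 3)) ×ℂ Icc y (y + (L + 1) * (δ / 3))) := by
    intro x y L N
    induction N with
    | zero => simpa using hcol x y L
    | succ N ih =>
      refine HasLinLogOn.glue (a := 1) (by simp) (t := x + (N + 1) * (δ / 3)) hK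
        (isClosed_reProdIm_Icc _ _ _ _) (convex_reProdIm_Icc _ _ _ _) ?_ ?_
      · convert ih using 1
        ext z
        simp only [halfPlane, mem_inter_iff, Complex.mem_reProdIm, mem_Icc, mem_ofPred_eq, one_mul]
        push_cast
        constructor
        · rintro ⟨⟨⟨h1, h2⟩, h3⟩, h4⟩
          exact ⟨⟨h1, by linarith⟩, h3⟩
        · rintro ⟨⟨h1, h2⟩, h3⟩
          exact ⟨⟨⟨h1, by linarith⟩, h3⟩, by linarith⟩
      · convert hcol (x + (N + 1) * (δ / 3)) y L using 1
        ext z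
        rw [mem_inter_iff, mem_halfPlane_neg]
        simp only [Complex.mem_reProdIm, mem_Icc, one_mul]
        push_cast
        have : 0 ≤ (N : ℝ) * δ := by positivity
        constructor
        · rintro ⟨⟨⟨h1, h2⟩, h3⟩, h4⟩
          exact ⟨⟨by linarith, by linarith⟩, h3⟩
        · rintro ⟨⟨h1, h2⟩, h3⟩
          exact ⟨⟨⟨by linarith, by linarith⟩, h3⟩, by linarith⟩
  obtain ⟨R, hR⟩ := hK.isBounded.subset_closedBall 0
  obtain ⟨N, hN⟩ := exists_nat_gt (2 * R / (δ / 3))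
  rw [div_lt_iff₀ (by positivity)] at hN
  obtain ⟨w, hw, hlog⟩ := hrow (-R) (-R) N N
  refine ⟨w, hw, hlog.mono fun z hz => ⟨hz, ?_⟩⟩
  have hzR : ‖z‖ ≤ R := by simpa using hR hz
  have h1 := abs_le.1 ((Complex.abs_re_le_norm z).trans hzR)
  have h2 := abs_le.1 ((Complex.abs_im_le_norm z).trans hzR)
  refine ⟨⟨h1.1, ?_⟩, h2.1, ?_⟩
  · linarith [h1.2]
  · linarith [h2.2]

/-- `A` is a continuous nowhere vanishing `G`-invariant function on the set `C`, which contains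
a neighbourhood of infinity, and `A` has winding number `d` at infinity. -/
structure InvariantWinding (G : ℂ → ℂ) (C : Set ℂ) (A : ℂ → ℂ) (d : ℤ) : Prop where
  continuousOn : ContinuousOn A C
  ne_zero : ∀ z ∈ C, A z ≠ 0
  invariant : ∀ z ∈ C, A (G z) = A z
  exists_hasLogOn : ∃ R > 0, {z : ℂ | R ≤ ‖z‖} ⊆ C ∧ HasLogOn (fun z => A z / z ^ d) {z | R ≤ ‖z‖}

namespace InvariantWinding

variable {G : ℂ → ℂ} {C : Set ℂ} {A A' : ℂ → ℂ} {d d' : ℤ}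

lemma mul (h : InvariantWinding G C A d) (h' : InvariantWinding G C A' d') :
    InvariantWinding G C (fun z => A z * A' z) (d + d') := by
  obtain ⟨R, hR, hRC, hl⟩ := h.exists_hasLogOn
  obtain ⟨R', hR', hRC', hl'⟩ := h'.exists_hasLogOn
  refine ⟨h.continuousOn.mul h'.continuousOn, fun z hz => mul_ne_zero (h.ne_zero z hz)
    (h'.ne_zero z hz), fun z hz => by rw [h.invariant z hz, h'.invariant z hz],
    max R R', lt_max_of_lt_left hR,
    fun z hz => hRC (show R ≤ ‖z‖ from le_trans (le_max_left _ _) hz), ?_⟩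
  have hs : {z : ℂ | max R R' ≤ ‖z‖} ⊆ {z | R ≤ ‖z‖} := fun z hz =>
    show R ≤ ‖z‖ from le_trans (le_max_left _ _) hz
  have hs' : {z : ℂ | max R R' ≤ ‖z‖} ⊆ {z | R' ≤ ‖z‖} := fun z hz =>
    show R' ≤ ‖z‖ from le_trans (le_max_right _ _) hz
  refine ((hl.mono hs).mul (hl'.mono hs')).congr fun z hz => ?_
  have hz0 : z ≠ 0 := norm_pos_iff.1 (hR.trans_le (le_trans (le_max_left _ _) hz))
  rw [zpow_add₀ hz0]
  field_simp

lemma zpow (h : InvariantWinding G C A d) (n : ℤ) :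
    InvariantWinding G C (fun z => A z ^ n) (d * n) := by
  obtain ⟨R, hR, hRC, hl⟩ := h.exists_hasLogOn
  refine ⟨h.continuousOn.zpow₀ n fun z hz => Or.inl (h.ne_zero z hz),
    fun z hz => zpow_ne_zero _ (h.ne_zero z hz), fun z hz => by rw [h.invariant z hz],
    R, hR, hRC, (hl.zpow n).congr fun z hz => ?_⟩
  rw [div_zpow, zpow_mul]

lemma one {R : ℝ} (hR : 0 < R) (hRC : {z : ℂ | R ≤ ‖z‖} ⊆ C) :
    InvariantWinding G C (fun _ => 1) 0 :=
  ⟨continuousOn_const, fun _ _ => one_ne_zero, fun _ _ => rfl, R, hR, hRC, by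
    simpa using HasLogOn.const one_ne_zero⟩

end InvariantWinding

lemma norm_iterate_sub_self_le {G : ℂ → ℂ} {M : ℝ} (hM : ∀ z, ‖G z - z‖ ≤ M) (k : ℕ) (z : ℂ) :
    ‖G^[k] z - z‖ ≤ k * M := by
  induction k with
  | zero => simp
  | succ k ih =>
    rw [Function.iterate_succ_apply']
    calc ‖G (G^[k] z) - z‖ = ‖(G (G^[k] z) - G^[k] z) + (G^[k] z - z)‖ := by ring_nf
      _ ≤ M + k * M := (norm_add_le _ _).trans (add_le_add (hM _) ih)
      _ = _ := by push_cast; ring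

lemma hasLogOn_iterate_sub_div {G : ℂ → ℂ} (hG : Continuous G) {M : ℝ} (hM : ∀ z, ‖G z - z‖ ≤ M)
    {k ℓ : ℕ} (hk : k ≤ ℓ) (c : ℂ) :
    HasLogOn (fun z => (G^[k] z - c) / z) {z | ℓ * M + ‖c‖ + 1 ≤ ‖z‖} := by
  have hM0 : 0 ≤ M := (norm_nonneg _).trans (hM 0)
  have hpos : ∀ z : ℂ, ℓ * M + ‖c‖ + 1 ≤ ‖z‖ → 0 < ‖z‖ := fun z hz => by
    have : 0 ≤ (ℓ : ℝ) * M := by positivity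
    linarith [norm_nonneg c]
  refine .of_norm_sub_one_lt ?_ fun z hz => ?_
  · exact (((hG.iterate k).sub continuous_const).continuousOn).div continuousOn_id
      fun z hz => norm_pos_iff.1 (hpos z hz)
  · have hz0 := norm_pos_iff.1 (hpos z hz)
    have : (G^[k] z - c) / z - 1 = ((G^[k] z - z) - c) / z := by field_simp; ring
    rw [this, norm_div, div_lt_one (hpos z hz)]
    have h1 := norm_iterate_sub_self_le hM k z
    have h2 := norm_sub_le (G^[k] z - z) c
    have h3 : (k : ℝ) * M ≤ ℓ * M := by gcongr
    have h4 : (ℓ : ℝ) * M + ‖c‖ + 1 ≤ ‖z‖ := hz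
    linarith

/-- The product of `z - c` over an orbit of a periodic map. -/
def orbitProd (G : ℂ → ℂ) (ℓ : ℕ) (c z : ℂ) : ℂ := ∏ k ∈ Finset.range ℓ, (G^[k] z - c)

lemma orbitProd_map {G : ℂ → ℂ} {ℓ : ℕ} (hℓ : ∀ z, G^[ℓ] z = z) (c z : ℂ) :
    orbitProd G ℓ c (G z) = orbitProd G ℓ c z := by
  unfold orbitProd
  have h := Finset.prod_range_succ (fun k => G^[k] z - c) ℓ
  rw [Finset.prod_range_succ'] at h
  rcases eq_or_ne (z - c) 0 with h0 | h0
  · cases ℓ with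
    | zero => simp
    | succ n =>
      rw [Finset.prod_range_succ, Finset.prod_range_succ' (fun k => G^[k] z - c)]
      simp only [← Function.iterate_succ_apply]
      rw [hℓ]
      simp
  · simp only [Function.iterate_zero, id, hℓ] at h
    simp only [← Function.iterate_succ_apply]
    exact mul_right_cancel₀ h0 h

lemma invariantWinding_orbitProd {G : ℂ → ℂ} (hG : Continuous G) {M : ℝ}
    (hM : ∀ z, ‖G z - z‖ ≤ M) {ℓ : ℕ} (hℓ : ∀ z, G^[ℓ] z = z) {C : Set ℂ}
    (hC : MapsTo G C C) {R : ℝ} (hR : 0 < R) (hRC : {z : ℂ | R ≤ ‖z‖} ⊆ C) {c : ℂ} (hc : c ∉ C) :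
    InvariantWinding G C (orbitProd G ℓ c) ℓ := by
  refine ⟨Continuous.continuousOn ?_, fun z hz => ?_, fun z _ => orbitProd_map hℓ c z,
    max R (ℓ * M + ‖c‖ + 1), lt_max_of_lt_left hR,
    fun z hz => hRC (show R ≤ ‖z‖ from le_trans (le_max_left _ _) hz), ?_⟩
  · exact continuous_finsetProd _ fun k _ => (hG.iterate k).sub continuous_const
  · refine Finset.prod_ne_zero_iff.2 fun k _ => sub_ne_zero.2 ?_
    rintro rfl
    exact hc (hC.iterate k hz)
  · have := HasLogOn.prod (Finset.range ℓ) (s := {z : ℂ | max R (ℓ * M + ‖c‖ + 1) ≤ ‖z‖})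
      (w := fun k z => (G^[k] z - c) / z) fun k hk =>
        (hasLogOn_iterate_sub_div hG hM (Finset.mem_range.1 hk).le c).mono
          fun z hz => show ℓ * M + ‖c‖ + 1 ≤ ‖z‖ from le_trans (le_max_right _ _) hz
    refine this.congr fun z hz => ?_
    simp [orbitProd, Finset.prod_div_distrib]

/-- `ball c r` meets each `G`-orbit of length `ℓ` at most once. -/
def IsFreeBall (G : ℂ → ℂ) (ℓ : ℕ) (c : ℂ) (r : ℝ) : Prop :=
  ∀ z ∈ ball c r, ∀ k, 0 < k → k < ℓ → G^[k] z ∉ ball c r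

lemma IsFreeBall.iterate_eq {G : ℂ → ℂ} {ℓ : ℕ} (hℓ0 : 0 < ℓ) (hℓ : ∀ z, G^[ℓ] z = z) {c : ℂ}
    {r : ℝ} (h : IsFreeBall G ℓ c r) {z : ℂ} {j k : ℕ} (hj : G^[j] z ∈ ball c r)
    (hk : G^[k] z ∈ ball c r) : G^[j] z = G^[k] z := by
  wlog hjk : j ≤ k generalizing j k
  · exact (this hk hj (by omega)).symm
  obtain ⟨m, rfl⟩ := Nat.exists_eq_add_of_le hjk
  have hp : Function.IsPeriodicPt G ℓ (G^[j] z) := hℓ _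
  rw [add_comm, Function.iterate_add_apply, ← hp.iterate_mod_apply] at hk ⊢
  rcases Nat.eq_zero_or_pos (m % ℓ) with h0 | h0
  · simp [h0]
  · exact absurd hk (h _ hj _ h0 (Nat.mod_lt _ hℓ0))

lemma LinProd.exists_invariantWinding {G : ℂ → ℂ} (hG : Continuous G) {M : ℝ}
    (hM : ∀ z, ‖G z - z‖ ≤ M) {ℓ : ℕ} (hℓ0 : 0 < ℓ) (hℓ : ∀ z, G^[ℓ] z = z) {C : Set ℂ}
    (hC : MapsTo G C C) {R : ℝ} (hR : 0 < R) (hRC : {z : ℂ | R ≤ ‖z‖} ⊆ C) {c₀ : ℂ} {r₀ r₁ : ℝ}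
    (hr₀ : 0 < r₀) (hr : r₀ < r₁) (hfree : IsFreeBall G ℓ c₀ r₁) {w : ℂ → ℂ}
    (hw : LinProd (closedBall c₀ r₀ \ C) w) :
    ∃ W m, InvariantWinding G C W (ℓ * m) ∧
      HasLogOn (fun z => w z / W z) (C ∩ closedBall c₀ r₀) := by
  induction hw with
  | one =>
    refine ⟨_, 0, by rw [mul_zero]; exact .one hR hRC, ?_⟩
    simpa using HasLogOn.const one_ne_zero
  | mul c n w hc _ ih =>
    obtain ⟨W, m, hW, hl⟩ := ih
    have hN := (invariantWinding_orbitProd hG hM hℓ hC hR hRC hc.2)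
    refine ⟨_, n + m, by rw [mul_add]; exact (hN.zpow n).mul hW, ?_⟩
    have hlog : HasLogOn (fun z => ∏ k ∈ Finset.range (ℓ - 1), (G^[k + 1] z - c))
        (ball c₀ r₁) := by
      refine .of_ball (hr₀.trans hr) (Continuous.continuousOn ?_) fun z hz => ?_
      · exact continuous_finsetProd _ fun k _ => (hG.iterate _).sub continuous_const
      · refine Finset.prod_ne_zero_iff.2 fun k hk => sub_ne_zero.2 ?_
        rintro rfl
        exact hfree z hz (k + 1) k.succ_pos (by have := Finset.mem_range.1 hk; omega)
          (closedBall_subset_ball hr hc.1)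
    have hsub : C ∩ closedBall c₀ r₀ ⊆ ball c₀ r₁ := fun z hz => closedBall_subset_ball hr hz.2
    refine (((hlog.mono hsub).zpow n).inv.mul hl).congr fun z hz => ?_
    have hfac : orbitProd G ℓ c z = (∏ k ∈ Finset.range (ℓ - 1), (G^[k + 1] z - c)) * (z - c) := by
      have := Finset.prod_range_succ' (fun k => G^[k] z - c) (ℓ - 1)
      rw [Nat.sub_add_cancel hℓ0] at this
      exact this
    have hzc : z - c ≠ 0 := sub_ne_zero.2 fun h => hc.2 (h ▸ hz.1)
    have hP := hlog.ne_zero (hsub hz)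
    have hWz := hW.ne_zero z hz.1
    beta_reduce at hP ⊢
    have h1 := zpow_ne_zero n hzc
    have h2 := zpow_ne_zero n hP
    rw [hfac, mul_zpow]
    field_simp

lemma InvariantWinding.exists_extension {G : ℂ → ℂ} (hG : Continuous G) {M : ℝ}
    (hM : ∀ z, ‖G z - z‖ ≤ M) {ℓ : ℕ} (hℓ0 : 0 < ℓ) (hℓ : ∀ z, G^[ℓ] z = z) {C : Set ℂ}
    (hCc : IsClosed C) (hC : MapsTo G C C) {c₀ : ℂ} {r₀ r₁ : ℝ}
    (hr₀ : 0 < r₀) (hr : r₀ < r₁) (hfree : IsFreeBall G ℓ c₀ r₁) {A : ℂ → ℂ} {d : ℤ}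
    (hA : InvariantWinding G C A d) :
    ∃ C' A' m, IsClosed C' ∧ MapsTo G C' C' ∧ C ⊆ C' ∧ (∀ z k, G^[k] z ∈ ball c₀ r₀ → z ∈ C') ∧
      InvariantWinding G C' A' (d + ℓ * m) := by
  obtain ⟨R, hR, hRC, hl⟩ := hA.exists_hasLogOn
  have hKc : IsCompact (C ∩ closedBall c₀ r₀) := (isCompact_closedBall c₀ r₀).inter_left hCc
  obtain ⟨w, hw, hwlog⟩ := hKc.hasLinLogOn (hA.continuousOn.mono inter_subset_left)
    fun z hz => hA.ne_zero z hz.1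
  obtain ⟨w', hw', q, hq, hwq⟩ := hw.exists_eq_mul_hasLogOn (D := closedBall c₀ r₀ \ C)
    (s := closedBall c₀ r₀) fun c hc => by
      by_cases hcb : c ∈ closedBall c₀ r₀
      · exact Or.inl ⟨hcb, fun h => hc ⟨h, hcb⟩⟩
      · have hcd : r₀ < dist c c₀ := by simpa using hcb
        refine Or.inr ((HasLogOn.of_ball (c := c₀) (hr₀.trans hcd) (by fun_prop)
          fun x hx => sub_ne_zero.2 ?_).mono (closedBall_subset_ball hcd))
        rintro rfl
        exact lt_irrefl _ (mem_ball.1 hx)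
  obtain ⟨W, m, hW, hWlog⟩ := hw'.exists_invariantWinding hG hM hℓ0 hℓ hC hR hRC hr₀ hr hfree
  have hB := hA.mul (hW.zpow (-1))
  set B : ℂ → ℂ := fun z => A z * W z ^ (-1 : ℤ) with hBdef
  have hBlog : HasLogOn B (C ∩ closedBall c₀ r₀) := by
    refine ((hwlog.mul hWlog).mul (hq.mono inter_subset_right)).congr fun z hz => ?_
    have h1 := hW.ne_zero z hz.1
    have h2 : w z ≠ 0 := hw.ne_zero (fun h => h hz)
    have h3 : w' z * q z ≠ 0 := hwq z ▸ h2
    have h4 := left_ne_zero_of_mul h3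
    have h5 := right_ne_zero_of_mul h3
    simp only [hBdef, hwq z, zpow_neg_one]
    field_simp
  obtain ⟨φ, hφ, hBφ⟩ := hBlog
  obtain ⟨ψ, hψ⟩ := ContinuousMap.exists_restrict_eq hKc.isClosed ⟨_, hφ.domRestrict⟩
  have hψ' : ∀ z ∈ C ∩ closedBall c₀ r₀, ψ z = φ z := fun z hz =>
    congrArg (fun F => F ⟨z, hz⟩) hψ
  classical
  set S : ℕ → Set ℂ := fun k => G^[k] ⁻¹' closedBall c₀ r₀ with hS
  have hSc : ∀ k, IsClosed (S k) := fun k => isClosed_closedBall.preimage (hG.iterate k)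
  set A' : ℂ → ℂ := fun z => if z ∈ C then B z else
    if h : ∃ k, G^[k] z ∈ closedBall c₀ r₀ then Complex.exp (ψ (G^[h.choose] z)) else 0 with hA'
  have hBit : ∀ k, ∀ z ∈ C, B (G^[k] z) = B z := fun k z hz => by
    induction k with
    | zero => rfl
    | succ k ih => rw [Function.iterate_succ_apply', hB.invariant _ (hC.iterate k hz), ih]
  have hA'C : ∀ z ∈ C, A' z = B z := fun z hz => if_pos hz
  have hA'S : ∀ k, ∀ z ∈ S k, A' z = Complex.exp (ψ (G^[k] z)) := fun k z hz => by
    by_cases hzC : z ∈ C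
    · rw [hA'C z hzC, ← hBit k z hzC, hBφ _ ⟨hC.iterate k hzC, hz⟩, hψ' _ ⟨hC.iterate k hzC, hz⟩]
    · have h : ∃ k, G^[k] z ∈ closedBall c₀ r₀ := ⟨k, hz⟩
      simp only [hA', if_neg hzC, dif_pos h]
      rw [hfree.iterate_eq hℓ0 hℓ (closedBall_subset_ball hr h.choose_spec)
        (closedBall_subset_ball hr hz)]
  have hSmod : ∀ k, ∀ z ∈ S k, z ∈ S (k % ℓ) := fun k z hz => by
    have hp : Function.IsPeriodicPt G ℓ z := hℓ _
    simpa only [hS, mem_preimage, hp.iterate_mod_apply] using hz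
  have hSsucc : ∀ k, ∀ z ∈ S k, ∃ j, z ∈ S (j + 1) := fun k z hz => by
    refine ⟨k + ℓ - 1, ?_⟩
    rw [Nat.sub_add_cancel (by omega)]
    simpa only [hS, mem_preimage, Function.iterate_add_apply, hℓ] using hz
  refine ⟨C ∪ ⋃ k ∈ Iio ℓ, S k, A', -m, ?_, ?_, subset_union_left, ?_, ?_⟩
  · exact hCc.union ((finite_Iio ℓ).isClosed_biUnion fun k _ => hSc k)
  · rintro z (hz | hz)
    · exact Or.inl (hC hz)
    · obtain ⟨k, hk, hz⟩ := mem_iUnion₂.1 hz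
      obtain ⟨j, hj⟩ := hSsucc k z hz
      exact Or.inr (mem_iUnion₂.2 ⟨j % ℓ, Nat.mod_lt _ hℓ0, hSmod j _ hj⟩)
  · intro z k hz
    exact Or.inr (mem_iUnion₂.2 ⟨k % ℓ, Nat.mod_lt _ hℓ0, hSmod k _ (ball_subset_closedBall hz)⟩)
  · refine ⟨?_, ?_, ?_, ?_⟩
    · refine (hB.continuousOn.congr hA'C).union_of_isClosed ?_ hCc
        ((finite_Iio ℓ).isClosed_biUnion fun k _ => hSc k)
      have : LocallyFinite fun k : Iio ℓ => S k := locallyFinite_of_finite _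
      rw [biUnion_eq_iUnion]
      refine this.continuousOn_iUnion (fun k => hSc k) fun k => ?_
      exact ((Complex.continuous_exp.comp (ψ.continuous.comp (hG.iterate _))).continuousOn).congr
        (hA'S k)
    · rintro z (hz | hz)
      · rw [hA'C z hz]
        exact hB.ne_zero z hz
      · obtain ⟨k, -, hz⟩ := mem_iUnion₂.1 hz
        rw [hA'S k z hz]
        exact Complex.exp_ne_zero _
    · rintro z (hz | hz)
      · rw [hA'C z hz, hA'C _ (hC hz), hB.invariant z hz]
      · obtain ⟨k, hk, hz⟩ := mem_iUnion₂.1 hz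
        obtain ⟨j, hj⟩ := hSsucc k z hz
        rw [hA'S _ z hj, hA'S j (G z) hj, Function.iterate_succ_apply]
    · obtain ⟨R', hR', hRC', hl'⟩ := hB.exists_hasLogOn
      refine ⟨R', hR', hRC'.trans subset_union_left, hl'.congr fun z hz => ?_⟩
      rw [hA'C z (hRC' hz)]
      congr 2
      ring

lemma InvariantWinding.dvd {G : ℂ → ℂ} (hG : Continuous G) {M : ℝ}
    (hM : ∀ z, ‖G z - z‖ ≤ M) {ℓ : ℕ} (hℓ0 : 0 < ℓ) (hℓ : ∀ z, G^[ℓ] z = z)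
    (t : Finset ℂ) {ρ σ : ℂ → ℝ} (hρ : ∀ c ∈ t, 0 < ρ c ∧ ρ c < σ c ∧ IsFreeBall G ℓ c (σ c))
    {C : Set ℂ} (hCc : IsClosed C) (hC : MapsTo G C C) {A : ℂ → ℂ} {d : ℤ}
    (hA : InvariantWinding G C A d)
    (hcov : ∀ z, z ∈ C ∨ ∃ c ∈ t, ∃ k, G^[k] z ∈ ball c (ρ c)) : (ℓ : ℤ) ∣ d := by
  classical
  induction t using Finset.induction_on generalizing C A d with
  | empty =>
    have hCu : C = univ := eq_univ_of_forall fun z => by simpa using hcov z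
    subst hCu
    obtain ⟨R, hR, -, hl⟩ := hA.exists_hasLogOn
    have h1 := HasLogOn.of_normedSpace (continuousOn_univ.1 hA.continuousOn)
      fun z => hA.ne_zero z trivial
    have hs : sphere (0 : ℂ) R ⊆ {z | R ≤ ‖z‖} := fun z hz => by
      have : ‖z‖ = R := by simpa using hz
      exact this.ge
    have := eq_zero_of_hasLogOn_zpow hR (n := d)
      (((h1.mono (subset_univ _)).div (hl.mono hs)).congr fun z hz => by
        have := hA.ne_zero z trivial
        simp only [div_div_cancel₀ this])
    simp [this]
  | insert c t hct ih =>
    obtain ⟨h1, h2, h3⟩ := hρ c (Finset.mem_insert_self _ _)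
    obtain ⟨C', A', m, hC'c, hC', hCC', hb, hA'⟩ :=
      hA.exists_extension hG hM hℓ0 hℓ hCc hC h1 h2 h3
    have := ih (fun c hc => hρ c (Finset.mem_insert_of_mem hc)) hC'c hC' hA' fun z => by
      rcases hcov z with h | ⟨b, hb', k, hk⟩
      · exact Or.inl (hCC' h)
      · rcases Finset.mem_insert.1 hb' with rfl | hb'
        · exact Or.inl (hb z k hk)
        · exact Or.inr ⟨b, hb', k, hk⟩
    exact (dvd_add_left (dvd_mul_right _ _)).1 this

/-- Newman's theorem for the plane: a map of prime period and bounded displacement is trivial. -/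
theorem eq_id_of_iterate_prime {G : ℂ → ℂ} (hG : Continuous G) {M : ℝ}
    (hM : ∀ z, ‖G z - z‖ ≤ M) {ℓ : ℕ} (hp : ℓ.Prime) (hℓ : ∀ z, G^[ℓ] z = z) (y : ℂ) :
    G y = y := by
  by_contra hy
  have hℓ0 := hp.pos
  have hℓC : (ℓ : ℂ) ≠ 0 := by exact_mod_cast hℓ0.ne'
  have hM0 : 0 ≤ M := (norm_nonneg _).trans (hM 0)
  set A : ℂ → ℂ := fun z => (∑ k ∈ Finset.range ℓ, G^[k] z) / ℓ - y with hAdef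
  have hAc : Continuous A := ((continuous_finsetSum _ fun k _ => hG.iterate k).div_const _).sub
    continuous_const
  have hAinv : ∀ z, A (G z) = A z := fun z => by
    have h := Finset.sum_range_succ (fun k => G^[k] z) ℓ
    rw [Finset.sum_range_succ'] at h
    simp only [Function.iterate_zero, id, hℓ] at h
    simp only [hAdef, ← Function.iterate_succ_apply]
    rw [add_right_cancel h]
  have hAz : ∀ z, ‖A z - z‖ ≤ ℓ * M + ‖y‖ := fun z => by
    have : A z - z = (∑ k ∈ Finset.range ℓ, (G^[k] z - z)) / ℓ - y := by
      simp only [hAdef, Finset.sum_sub_distrib, Finset.sum_const, Finset.card_range, nsmul_eq_mul]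
      field_simp
      ring
    rw [this]
    refine (norm_sub_le _ _).trans (add_le_add_left ?_ _)
    rw [norm_div, Complex.norm_natCast, div_le_iff₀ (by exact_mod_cast hℓ0)]
    refine (norm_sum_le _ _).trans ((Finset.sum_le_card_nsmul _ _ (ℓ * M) fun k hk => ?_).trans ?_)
    · refine (norm_iterate_sub_self_le hM k z).trans ?_
      have := (Finset.mem_range.1 hk).le
      gcongr
    · rw [Finset.card_range, nsmul_eq_mul]
      exact (mul_comm _ _).le
  set L : ℝ := ℓ * M + ‖y‖ with hL
  have hL0 : 0 ≤ L := by positivity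
  have hfix : ∀ z, A z = 0 → G z ≠ z := fun z hz h => by
    have : ∀ k, G^[k] z = z := fun k => Function.iterate_fixed h k
    have : A z = z - y := by
      simp only [hAdef, this, Finset.sum_const, Finset.card_range, nsmul_eq_mul]
      field_simp
    rw [this, sub_eq_zero] at hz
    exact hy (hz ▸ h)
  have hfree : ∀ z, A z = 0 → ∃ σ > 0, IsFreeBall G ℓ z σ := fun z hz => by
    have hne : ∀ k, 0 < k → k < ℓ → G^[k] z ≠ z := fun k hk hkℓ h => by
      have h1 : Function.IsPeriodicPt G k z := h
      have h2 : Function.IsPeriodicPt G ℓ z := hℓ z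
      have h3 := h2.gcd h1
      rw [Nat.Coprime.gcd_eq_one (Nat.coprime_of_lt_prime hk.ne' hkℓ hp)] at h3
      exact hfix z hz h3
    have hev : ∀ k, 0 < k → k < ℓ → ∃ σ > 0, ∀ x ∈ ball z σ, G^[k] x ∉ ball z σ := by
      intro k hk hkℓ
      obtain ⟨U, V, hU, hV, hzU, hzV, hUV⟩ := t2_separation (hne k hk hkℓ)
      have := ((hG.iterate k).continuousAt.preimage_mem_nhds (hU.mem_nhds hzU))
      obtain ⟨σ, hσ, hσs⟩ := Metric.mem_nhds_iff.1 (inter_mem this (hV.mem_nhds hzV))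
      exact ⟨σ, hσ, fun x hx hx' => hUV.le_bot ⟨(hσs hx).1, (hσs hx').2⟩⟩
    choose! σ hσ hσs using hev
    obtain ⟨τ, hτ, hτσ⟩ : ∃ τ > 0, ∀ k ∈ Finset.Ioo 0 ℓ, τ ≤ σ k := by
      rcases (Finset.Ioo 0 ℓ).eq_empty_or_nonempty with h | h
      · exact ⟨1, one_pos, by simp [h]⟩
      · obtain ⟨k, hk, hmin⟩ := Finset.exists_min_image _ σ h
        have := Finset.mem_Ioo.1 hk
        exact ⟨σ k, hσ k this.1 this.2, hmin⟩
    refine ⟨τ, hτ, fun x hx k hk hkℓ hx' => ?_⟩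
    have := hτσ k (Finset.mem_Ioo.2 ⟨hk, hkℓ⟩)
    exact hσs k hk hkℓ x (ball_subset_ball this hx) (ball_subset_ball this hx')
  choose! σ hσ hσf using hfree
  have hKc : IsCompact {z | A z = 0} := by
    refine (isCompact_closedBall (0 : ℂ) L).of_isClosed_subset (isClosed_eq hAc continuous_const)
      fun z hz => ?_
    have h := hAz z
    rw [show A z = 0 from hz, zero_sub, norm_neg] at h
    simpa using h
  obtain ⟨t, htK, ht⟩ := hKc.elim_nhds_subcover (fun z => ball z (σ z / 2))
    fun z hz => ball_mem_nhds z (half_pos (hσ z hz))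
  obtain ⟨R₁, hR₁⟩ : ∃ R₁, ∀ c ∈ t, ∀ z ∈ ball c (σ c / 2), ‖z‖ ≤ R₁ := by
    have hb : Bornology.IsBounded (⋃ c ∈ t, ball c (σ c / 2)) :=
      (Bornology.isBounded_biUnion_finset t).2 fun c _ => isBounded_ball
    obtain ⟨R₁, h⟩ := hb.exists_norm_le
    exact ⟨R₁, fun c hc z hz => h z (mem_iUnion₂.2 ⟨c, hc, hz⟩)⟩
  set C : Set ℂ := {z | ∀ c ∈ t, ∀ k ∈ Finset.range ℓ, G^[k] z ∉ ball c (σ c / 2)} with hCdef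
  have hmem : ∀ z ∈ C, ∀ c ∈ t, ∀ k, G^[k] z ∉ ball c (σ c / 2) := fun z hz c hc k => by
    have hp : Function.IsPeriodicPt G ℓ z := hℓ _
    rw [← hp.iterate_mod_apply]
    exact hz c hc _ (Finset.mem_range.2 (Nat.mod_lt _ hℓ0))
  have hCc : IsClosed C := by
    have : C = ⋂ c ∈ t, ⋂ k ∈ Finset.range ℓ, G^[k] ⁻¹' (ball c (σ c / 2))ᶜ := by
      ext z
      simp [hCdef]
    rw [this]
    exact isClosed_biInter fun c _ => isClosed_biInter fun k _ =>
      isOpen_ball.isClosed_compl.preimage (hG.iterate k)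
  have hC : MapsTo G C C := fun z hz c hc k _ => by
    rw [← Function.iterate_succ_apply]
    exact hmem z hz c hc _
  set R : ℝ := max (R₁ + ℓ * M + 1) (L + 1) with hR
  have hA : InvariantWinding G C A 1 := by
    refine ⟨hAc.continuousOn, fun z hz h0 => ?_, fun z _ => hAinv z, R,
      lt_max_of_lt_right (by linarith), fun z hz c hc k hk hb => ?_, ?_⟩
    · obtain ⟨c, hc, hcz⟩ := mem_iUnion₂.1 (ht h0)
      exact hmem z hz c hc 0 hcz
    · have h1 := hR₁ c hc _ hb
      have h2 := norm_iterate_sub_self_le hM k z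
      have h3 := norm_sub_norm_le z (G^[k] z)
      rw [norm_sub_rev] at h3
      have h4 : R₁ + ℓ * M + 1 ≤ ‖z‖ := le_trans (le_max_left _ _) hz
      have h5 : (k : ℝ) * M ≤ ℓ * M := by
        have := (Finset.mem_range.1 hk).le
        gcongr
      linarith
    · have hpos : ∀ z : ℂ, R ≤ ‖z‖ → L < ‖z‖ := fun z hz => by
        have : L + 1 ≤ ‖z‖ := le_trans (le_max_right _ _) hz
        linarith
      have hz0 : ∀ z : ℂ, R ≤ ‖z‖ → z ≠ 0 := fun z hz => norm_pos_iff.1 (hL0.trans_lt (hpos z hz))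
      simp only [zpow_one]
      refine .of_norm_sub_one_lt (hAc.continuousOn.div continuousOn_id hz0) fun z hz => ?_
      have hz1 := hz0 z hz
      have : A z / z - 1 = (A z - z) / z := by field_simp
      rw [this, norm_div, div_lt_one (norm_pos_iff.2 hz1)]
      exact (hAz z).trans_lt (hpos z hz)
  have hdvd := hA.dvd hG hM hℓ0 hℓ t (ρ := fun c => σ c / 2) (σ := σ)
    (fun c hc => ⟨half_pos (hσ c (htK c hc)), half_lt_self (hσ c (htK c hc)), hσf c (htK c hc)⟩)
    hCc hC fun z => by
      by_contra! h
      exact h.1 fun c hc k _ => h.2 c hc k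
  have := Int.natCast_dvd_natCast.1 (by simpa using hdvd : (ℓ : ℤ) ∣ ((1 : ℕ) : ℤ))
  exact hp.one_lt.ne' (Nat.dvd_one.1 this)

/-- Every nowhere vanishing continuous function on `Ω` has a continuous logarithm. -/
def HasAllLogs (Ω : Set ℂ) : Prop :=
  ∀ u : ℂ → ℂ, ContinuousOn u Ω → (∀ z ∈ Ω, u z ≠ 0) → HasLogOn u Ω

lemma HasAllLogs.image {s t : Set ℂ} (h : HasAllLogs s) {f g : ℂ → ℂ} (hf : ContinuousOn f s)
    (hg : ContinuousOn g t) (hst : MapsTo f s t) (hts : MapsTo g t s)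
    (hfg : ∀ z ∈ t, f (g z) = z) : HasAllLogs t := fun u hu hu0 =>
  ((h (fun z => u (f z)) (hu.comp hf hst) fun z hz => hu0 _ (hst hz)).comp hg hts).congr
    fun z hz => by simp only [hfg z hz]

lemma hasAllLogs_ball (c : ℂ) {r : ℝ} (hr : 0 < r) : HasAllLogs (ball c r) :=
  fun _ hu h0 => .of_ball hr hu h0

lemma hasLogOn_of_forall_infDist {Ω : Set ℂ} (hΩ : IsOpen Ω) (hΩc : IsConnected Ω)
    (hne : Ωᶜ.Nonempty) {u : ℂ → ℂ}
    (h : ∀ ε > 0, HasLogOn u {z | ε ≤ infDist z Ωᶜ}) : HasLogOn u Ω := by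
  obtain ⟨x₀, hx₀⟩ := hΩc.nonempty
  choose! φ hφ hφu using h
  set ε : ℕ → ℝ := fun n => 1 / (n + 1) with hε
  have hε0 : ∀ n, 0 < ε n := fun n => Nat.one_div_pos_of_nat
  set U : ℕ → Set ℂ := fun n => {z | ε n < infDist z Ωᶜ} with hU
  have hUo : ∀ n, IsOpen (U n) := fun n => isOpen_lt continuous_const (continuous_infDist_pt _)
  set C : ℕ → Set ℂ := fun n => connectedComponentIn (U n) x₀ with hC
  have hCU : ∀ n, C n ⊆ U n := fun n => connectedComponentIn_subset _ _
  have hCK : ∀ n, C n ⊆ {z | ε n ≤ infDist z Ωᶜ} := fun n z hz =>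
    show ε n ≤ infDist z Ωᶜ from le_of_lt (hCU n hz)
  have hmono : ∀ m n, m ≤ n → C m ⊆ C n := fun m n hmn =>
    connectedComponentIn_mono _ fun z hz =>
    show ε n < infDist z Ωᶜ from (Nat.one_div_le_one_div hmn).trans_lt hz
  have hx₀C : ∀ n z, z ∈ C n → x₀ ∈ C n := fun n z hz =>
    mem_connectedComponentIn (connectedComponentIn_nonempty_iff.1 ⟨z, hz⟩)
  have hcov : ∀ z ∈ Ω, ∃ n, z ∈ C n := fun z hz => by
    have hpath : IsPathConnected Ω := (hΩ.isConnected_iff_isPathConnected).1 hΩc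
    obtain ⟨γ, hγ⟩ := hpath.joinedIn x₀ hx₀ z hz
    have hcomp : IsCompact (range γ) := isCompact_range γ.continuous
    obtain ⟨y, hy, hmin⟩ := hcomp.exists_isMinOn (range_nonempty γ)
      (continuous_infDist_pt Ωᶜ).continuousOn
    have hyΩ : y ∈ Ω := by
      obtain ⟨t, rfl⟩ := hy
      exact hγ t
    have hpos : 0 < infDist y Ωᶜ := (hΩ.isClosed_compl.notMem_iff_infDist_pos hne).1 (by simpa)
    obtain ⟨n, hn⟩ := exists_nat_one_div_lt hpos
    refine ⟨n, ?_⟩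
    have hsub : range γ ⊆ U n := fun x hx => hn.trans_le (hmin hx)
    exact (isPreconnected_range γ.continuous).subset_connectedComponentIn ⟨0, γ.source⟩ hsub
      ⟨1, γ.target⟩
  set ψ : ℕ → ℂ → ℂ := fun n z => φ (ε n) z - φ (ε n) x₀ + Complex.log (u x₀) with hψ
  have hψu : ∀ n, ∀ z ∈ C n, u z = Complex.exp (ψ n z) := fun n z hz => by
    have h0 := hφu _ (hε0 n) x₀ (hCK n (hx₀C n z hz))
    have h1 : u x₀ ≠ 0 := h0 ▸ Complex.exp_ne_zero _
    simp only [hψ]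
    rw [Complex.exp_add, Complex.exp_log h1, Complex.exp_sub, ← h0,
      ← hφu _ (hε0 n) z (hCK n hz), div_mul_cancel₀ _ h1]
  have hψc : ∀ n, ContinuousOn (ψ n) (C n) := fun n =>
    (((hφ _ (hε0 n)).mono (hCK n)).sub continuousOn_const).add continuousOn_const
  have hψeq : ∀ m n, m ≤ n → ∀ z ∈ C m, ψ m z = ψ n z := fun m n hmn z hz => by
    have := exp_eqOn_sub_const (isPreconnected_connectedComponentIn) (hψc m)
      ((hψc n).mono (hmono m n hmn))
      (fun y hy => (hψu m y hy).symm.trans (hψu n y (hmono m n hmn hy))) hz (hx₀C m z hz)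
    simp only [hψ, sub_self] at this ⊢
    linear_combination this
  choose! N hN using hcov
  have hval : ∀ n, ∀ z ∈ Ω, z ∈ C n → ψ (N z) z = ψ n z := fun n z hz hzn => by
    rcases le_total (N z) n with hle | hle
    · exact hψeq _ _ hle z (hN z hz)
    · exact (hψeq _ _ hle z hzn).symm
  have hCo : ∀ n, IsOpen (C n) := fun n => (hUo n).connectedComponentIn
  refine ⟨fun z => ψ (N z) z, fun z hz => ?_, fun z hz => hψu _ z (hN z hz)⟩
  have hnhds : C (N z) ∈ 𝓝 z := (hCo _).mem_nhds (hN z hz)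
  refine ContinuousAt.continuousWithinAt ?_
  refine ((hψc (N z)).continuousAt hnhds).congr ?_
  filter_upwards [hnhds, hΩ.mem_nhds hz] with y hy hyΩ
  exact (hval _ y hyΩ hy).symm

/-- On a bounded domain it suffices to find logarithms of the functions `z - a`. -/
theorem hasAllLogs_of_forall_notMem {Ω : Set ℂ} (hΩ : IsOpen Ω) (hΩc : IsConnected Ω)
    (hb : Bornology.IsBounded Ω) (h : ∀ a ∉ Ω, HasLogOn (fun z => z - a) Ω) : HasAllLogs Ω := by
  intro u hu hu0
  have hne : Ωᶜ.Nonempty := by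
    rw [nonempty_compl]
    rintro rfl
    exact NormedSpace.unbounded_univ ℝ ℂ hb
  refine hasLogOn_of_forall_infDist hΩ hΩc hne fun ε hε => ?_
  have hsub : {z | ε ≤ infDist z Ωᶜ} ⊆ Ω := fun z hz => by
    by_contra hzΩ
    have := infDist_zero_of_mem (show z ∈ Ωᶜ from hzΩ)
    have hz' : ε ≤ infDist z Ωᶜ := hz
    linarith
  have hK : IsCompact {z | ε ≤ infDist z Ωᶜ} :=
    isCompact_of_isClosed_isBounded (isClosed_le continuous_const (continuous_infDist_pt _))
      (hb.subset hsub)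
  obtain ⟨w, hw, hwlog⟩ := hK.hasLinLogOn (hu.mono hsub) fun z hz => hu0 z (hsub hz)
  have hwl := hw.hasLogOn (s := {z | ε ≤ infDist z Ωᶜ}) fun c hc => by
    obtain ⟨a, ha, hac⟩ := (infDist_lt_iff hne).1 (not_le.1 hc)
    have hza : ∀ z : ℂ, ε ≤ infDist z Ωᶜ → ε ≤ ‖z - a‖ := fun z hz => by
      rw [← dist_eq_norm]
      exact hz.trans (infDist_le_dist_of_mem ha)
    have hza0 : ∀ z : ℂ, ε ≤ infDist z Ωᶜ → z - a ≠ 0 := fun z hz =>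
      norm_pos_iff.1 (hε.trans_le (hza z hz))
    have hr : HasLogOn (fun z => (z - c) / (z - a)) {z | ε ≤ infDist z Ωᶜ} := by
      refine .of_norm_sub_one_lt (.div (by fun_prop) (by fun_prop) hza0) fun z hz => ?_
      have h0 := hza0 z hz
      have : (z - c) / (z - a) - 1 = (a - c) / (z - a) := by field_simp; ring
      rw [this, norm_div, div_lt_one (norm_pos_iff.2 h0)]
      rw [dist_comm, dist_eq_norm] at hac
      exact hac.trans_le (hza z hz)
    refine (hr.mul ((h a ha).mono hsub)).congr fun z hz => ?_
    have h0 := hza0 z hz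
    field_simp
  refine (hwlog.mul hwl).congr fun z hz => ?_
  have := hwl.ne_zero hz
  field_simp

/-- The disc automorphism sending `a` to `0`. -/
noncomputable def discShift (a w : ℂ) : ℂ := (w - a) / (1 - conj a * w)

lemma discShift_denom_ne_zero {a w : ℂ} (ha : ‖a‖ < 1) (hw : ‖w‖ < 1) : 1 - conj a * w ≠ 0 := by
  rw [sub_ne_zero]
  intro h
  have h1 : ‖conj a * w‖ = 1 := by rw [← h, norm_one]
  rw [norm_mul, Complex.norm_conj] at h1
  nlinarith [norm_nonneg a, norm_nonneg w]

lemma norm_discShift_lt_one {a w : ℂ} (ha : ‖a‖ < 1) (hw : ‖w‖ < 1) : ‖discShift a w‖ < 1 := by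
  have h0 := discShift_denom_ne_zero ha hw
  rw [discShift, norm_div, div_lt_one (norm_pos_iff.2 h0)]
  refine lt_of_pow_lt_pow_left₀ 2 (norm_nonneg _) ?_
  rw [← Complex.normSq_eq_norm_sq, ← Complex.normSq_eq_norm_sq]
  have hid : Complex.normSq (1 - conj a * w) - Complex.normSq (w - a)
      = (1 - Complex.normSq a) * (1 - Complex.normSq w) := by
    simp only [Complex.normSq_apply, Complex.sub_re, Complex.sub_im, Complex.one_re,
      Complex.one_im, Complex.mul_re, Complex.mul_im, Complex.conj_re, Complex.conj_im]
    ring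
  have h1 : Complex.normSq a < 1 := by
    rw [Complex.normSq_eq_norm_sq]
    exact pow_lt_one₀ (norm_nonneg _) ha two_ne_zero
  have h2 : Complex.normSq w < 1 := by
    rw [Complex.normSq_eq_norm_sq]
    exact pow_lt_one₀ (norm_nonneg _) hw two_ne_zero
  have := mul_pos (sub_pos.2 h1) (sub_pos.2 h2)
  linarith

lemma one_sub_conj_mul_self_ne_zero {a : ℂ} (ha : ‖a‖ < 1) : 1 - conj a * a ≠ 0 :=
  discShift_denom_ne_zero ha ha

lemma discShift_injOn {a : ℂ} (ha : ‖a‖ < 1) : InjOn (discShift a) (ball 0 1) := by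
  intro w hw v hv h
  have hw0 := discShift_denom_ne_zero ha (by simpa using hw)
  have hv0 := discShift_denom_ne_zero ha (by simpa using hv)
  have h1 := one_sub_conj_mul_self_ne_zero ha
  rw [discShift, discShift, div_eq_div_iff hw0 hv0] at h
  have : (1 - conj a * a) * (w - v) = 0 := by linear_combination h
  exact sub_eq_zero.1 ((mul_eq_zero.1 this).resolve_left h1)

lemma hasDerivAt_discShift {a w : ℂ} (ha : ‖a‖ < 1) (hw : ‖w‖ < 1) :
    HasDerivAt (discShift a) ((1 - conj a * a) / (1 - conj a * w) ^ 2) w := by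
  have h0 := discShift_denom_ne_zero ha hw
  have h := ((hasDerivAt_id w).sub_const a).div
    (((hasDerivAt_id w).const_mul (conj a)).const_sub 1) h0
  refine h.congr_deriv ?_
  simp only [id]
  ring

lemma HasDerivAt.of_sq_eq {s u : ℂ → ℂ} {u' z : ℂ} (hs : ContinuousAt s z) (hu : HasDerivAt u u' z)
    (h0 : s z ≠ 0) (h : ∀ᶠ w in 𝓝 z, s w ^ 2 = u w) : HasDerivAt s (u' / (2 * s z)) z := by
  rw [hasDerivAt_iff_tendsto_slope] at hu ⊢
  have hsum : Tendsto (fun w => s w + s z) (𝓝[≠] z) (𝓝 (2 * s z)) := by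
    rw [two_mul]
    exact (hs.tendsto.mono_left nhdsWithin_le_nhds).add tendsto_const_nhds
  have h2 : 2 * s z ≠ 0 := mul_ne_zero two_ne_zero h0
  refine (hu.div hsum h2).congr' ?_
  filter_upwards [h.filter_mono nhdsWithin_le_nhds, hsum.eventually_ne h2, self_mem_nhdsWithin]
    with w hw hw0 hwz
  have hz := h.self_of_nhds
  have : w - z ≠ 0 := sub_ne_zero.2 hwz
  simp only [slope_def_field, Pi.div_apply]
  rw [← hw, ← hz]
  field_simp
  ring

/-- Candidates for the Riemann map of `Ω`. -/
structure IsDiscMap (Ω : Set ℂ) (f : ℂ → ℂ) : Prop where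
  differentiableOn : DifferentiableOn ℂ f Ω
  mapsTo : MapsTo f Ω (ball 0 1)
  injOn : InjOn f Ω
  map_zero : f 0 = 0

lemma IsDiscMap.exists_norm_deriv_lt {Ω : Set ℂ} {f : ℂ → ℂ} (hf : IsDiscMap Ω f) (hΩ : IsOpen Ω)
    (h0 : 0 ∈ Ω) (hlog : HasAllLogs Ω) (hd : deriv f 0 ≠ 0) {a : ℂ} (ha : ‖a‖ < 1)
    (haf : a ∉ f '' Ω) : ∃ g, IsDiscMap Ω g ∧ ‖deriv f 0‖ < ‖deriv g 0‖ := by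
  have hfn : ∀ z ∈ Ω, ‖f z‖ < 1 := fun z hz => by simpa using hf.mapsTo hz
  have ha0 : a ≠ 0 := by
    rintro rfl
    exact haf ⟨0, h0, hf.map_zero⟩
  have hfd : ∀ z ∈ Ω, HasDerivAt f (deriv f z) z := fun z hz =>
    (hf.differentiableOn.differentiableAt (hΩ.mem_nhds hz)).hasDerivAt
  set u : ℂ → ℂ := fun z => discShift a (f z) with hu
  have hud : ∀ z ∈ Ω, HasDerivAt u _ z := fun z hz =>
    (hasDerivAt_discShift ha (hfn z hz)).comp z (hfd z hz)
  have hu0 : ∀ z ∈ Ω, u z ≠ 0 := fun z hz => by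
    refine div_ne_zero (sub_ne_zero.2 fun h => haf ⟨z, hz, h⟩)
      (discShift_denom_ne_zero ha (hfn z hz))
  obtain ⟨φ, hφ, hφu⟩ := hlog u (fun z hz => (hud z hz).continuousAt.continuousWithinAt) hu0
  set s : ℂ → ℂ := fun z => Complex.exp (φ z / 2) with hs
  have hsu : ∀ z ∈ Ω, s z ^ 2 = u z := fun z hz => by
    rw [hφu z hz, hs, ← Complex.exp_nat_mul]
    congr 1
    push_cast
    ring
  have hs0 : ∀ z, s z ≠ 0 := fun z => Complex.exp_ne_zero _
  have hsn : ∀ z ∈ Ω, ‖s z‖ < 1 := fun z hz => by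
    have h1 : ‖s z‖ ^ 2 < 1 := by
      rw [← norm_pow, hsu z hz]
      exact norm_discShift_lt_one ha (hfn z hz)
    exact (sq_lt_one_iff₀ (norm_nonneg _)).1 h1
  have hsd : ∀ z ∈ Ω, HasDerivAt s _ z := fun z hz =>
    HasDerivAt.of_sq_eq ((Complex.continuous_exp.comp_continuousOn
      (hφ.div_const 2)).continuousAt (hΩ.mem_nhds hz)) (hud z hz) (hs0 z)
      (by filter_upwards [hΩ.mem_nhds hz] with w hw using hsu w hw)
  have hb := hsn 0 h0
  have hgd : ∀ z ∈ Ω, HasDerivAt (fun z => discShift (s 0) (s z)) _ z := fun z hz =>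
    (hasDerivAt_discShift hb (hsn z hz)).comp z (hsd z hz)
  refine ⟨fun z => discShift (s 0) (s z), ⟨fun z hz =>
    (hgd z hz).differentiableAt.differentiableWithinAt, fun z hz => ?_, fun z hz w hw h => ?_, ?_⟩,
    ?_⟩
  · simpa using norm_discShift_lt_one hb (hsn z hz)
  · have h1 : s z = s w :=
      discShift_injOn hb (by simpa using hsn z hz) (by simpa using hsn w hw) h
    have h2 : u z = u w := by rw [← hsu z hz, ← hsu w hw, h1]
    exact hf.injOn hz hw (discShift_injOn ha (hf.mapsTo hz) (hf.mapsTo hw) h2)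
  · simp [discShift]
  · rw [(hgd 0 h0).deriv, hf.map_zero]
    have hb0 : 0 < ‖s 0‖ := norm_pos_iff.2 (hs0 0)
    have hab : ‖a‖ = ‖s 0‖ ^ 2 := by
      rw [← norm_pow, hsu 0 h0, hu]
      simp [discShift, hf.map_zero]
    have hconj : ∀ b : ℂ, conj b * b = ((‖b‖ ^ 2 : ℝ) : ℂ) := fun b => by
      rw [mul_comm, Complex.mul_conj, Complex.normSq_eq_norm_sq]
    have hreal : ∀ b : ℂ, ‖b‖ < 1 → ‖1 - conj b * b‖ = 1 - ‖b‖ ^ 2 := fun b hb => by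
      have : ‖b‖ ^ 2 < 1 := (sq_lt_one_iff₀ (norm_nonneg _)).2 hb
      rw [hconj, ← Complex.ofReal_one, ← Complex.ofReal_sub, Complex.norm_real, Real.norm_eq_abs,
        abs_of_pos (by linarith)]
    simp only [mul_zero, sub_zero, one_pow, div_one, norm_mul, norm_div, norm_pow, hreal _ ha,
      hreal _ hb, Complex.norm_ofNat]
    rw [hab]
    set t := ‖s 0‖ with ht
    have ht2 : 0 < 1 - t ^ 2 := by
      have : t ^ 2 < 1 := (sq_lt_one_iff₀ hb0.le).2 hb
      linarith
    have hd' : 0 < ‖deriv f 0‖ := norm_pos_iff.2 hd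
    have : (1 - t ^ 2) / (1 - t ^ 2) ^ 2 * ((1 - (t ^ 2) ^ 2) * ‖deriv f 0‖ / (2 * t))
        = (1 + t ^ 2) / (2 * t) * ‖deriv f 0‖ := by
      field_simp
      ring
    rw [this]
    refine lt_mul_of_one_lt_left hd' ?_
    rw [one_lt_div (by positivity)]
    nlinarith [sq_pos_of_pos (sub_pos.2 hb)]

lemma dist_le_of_mapsTo_ball_one {f : ℂ → ℂ} {c z : ℂ} {r : ℝ}
    (hf : DifferentiableOn ℂ f (ball c r)) (hm : MapsTo f (ball c r) (ball 0 1))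
    (hz : z ∈ ball c r) : dist (f z) (f c) ≤ 2 / r * dist z c := by
  have hr : 0 < r := dist_nonneg.trans_lt hz
  refine Complex.dist_le_div_mul_dist_of_mapsTo_ball hf (fun w hw => ?_) hz
  have h1 : ‖f w‖ < 1 := by simpa using hm hw
  have h2 : ‖f c‖ < 1 := by simpa using hm (mem_ball_self hr)
  rw [mem_closedBall, dist_eq_norm]
  linarith [norm_sub_le (f w) (f c)]

/-- Montel's theorem along an ultrafilter. -/
lemma exists_tendstoLocallyUniformlyOn {ι : Type*} (𝓤 : Ultrafilter ι) {Ω : Set ℂ} (hΩ : IsOpen Ω)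
    {F : ι → ℂ → ℂ} (hF : ∀ n, DifferentiableOn ℂ (F n) Ω) (hm : ∀ n, MapsTo (F n) Ω (ball 0 1)) :
    ∃ f, TendstoLocallyUniformlyOn F f 𝓤 Ω := by
  have hlim : ∀ z ∈ Ω, ∃ l, Tendsto (fun n => F n z) 𝓤 (𝓝 l) := fun z hz => by
    obtain ⟨l, -, hl⟩ := (isCompact_closedBall (0 : ℂ) 1).ultrafilter_le_nhds
      (𝓤.map fun n => F n z) (by
        rw [le_principal_iff, Ultrafilter.coe_map]
        exact mem_map.2 (univ_mem' fun n => ball_subset_closedBall (hm n hz)))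
    exact ⟨l, hl⟩
  choose! f hf using hlim
  refine ⟨f, Metric.tendstoLocallyUniformlyOn_iff.2 fun ε hε x hx => ?_⟩
  obtain ⟨r, hr, hrΩ⟩ := Metric.isOpen_iff.1 hΩ x hx
  have hlip : ∀ n, ∀ z ∈ ball x r, dist (F n z) (F n x) ≤ 2 / r * dist z x := fun n z hz =>
    dist_le_of_mapsTo_ball_one ((hF n).mono hrΩ) ((hm n).mono_left hrΩ) hz
  have hlip' : ∀ z ∈ ball x r, dist (f z) (f x) ≤ 2 / r * dist z x := fun z hz =>
    le_of_tendsto ((hf z (hrΩ hz)).dist (hf x hx)) (univ_mem' fun n => hlip n z hz)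
  set δ := min r (ε / 3 * (r / 2)) with hδ
  have hδ0 : 0 < δ := by positivity
  have hδb : ∀ z ∈ ball x δ, 2 / r * dist z x < ε / 3 := fun z hz => by
    have h1 : dist z x < ε / 3 * (r / 2) := lt_of_lt_of_le (mem_ball.1 hz) (min_le_right _ _)
    calc 2 / r * dist z x < 2 / r * (ε / 3 * (r / 2)) := by gcongr
      _ = ε / 3 := by field_simp
  refine ⟨ball x δ, mem_nhdsWithin_of_mem_nhds (ball_mem_nhds x hδ0), ?_⟩
  filter_upwards [Metric.tendsto_nhds.1 (hf x hx) (ε / 3) (by positivity)] with n hn y hy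
  have hy' : y ∈ ball x r := ball_subset_ball (min_le_left _ _) hy
  have h1 := hlip n y hy'
  have h2 := hlip' y hy'
  have h3 := hδb y hy
  have h4 := dist_triangle4 (f y) (f x) (F n x) (F n y)
  rw [dist_comm (F n x) (F n y), dist_comm (f x) (F n x)] at h4
  linarith

/-- Hurwitz's theorem: nonconstant limits of injective holomorphic functions are injective. -/
lemma injOn_of_tendstoLocallyUniformlyOn {ι : Type*} {p : Filter ι} [p.NeBot] {Ω : Set ℂ}
    (hΩ : IsOpen Ω) (hΩc : IsPreconnected Ω) {F : ι → ℂ → ℂ} {f : ℂ → ℂ}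
    (hF : ∀ n, DifferentiableOn ℂ (F n) Ω) (hinj : ∀ n, InjOn (F n) Ω)
    (hlim : TendstoLocallyUniformlyOn F f p Ω) {x : ℂ} (hx : x ∈ Ω) (hd : deriv f x ≠ 0) :
    InjOn f Ω := by
  intro a ha b hb hab
  by_contra hne
  have hfd : DifferentiableOn ℂ f Ω := hlim.differentiableOn (Eventually.of_forall hF) hΩ
  have han : AnalyticOnNhd ℂ (fun z => f z - f a) Ω :=
    (hfd.sub_const _).analyticOnNhd hΩ
  have hnz : ∀ᶠ z in 𝓝[≠] b, f z - f a ≠ 0 := by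
    rcases (han b hb).eventually_eq_zero_or_eventually_ne_zero with h | h
    · exfalso
      have := han.eqOn_zero_of_preconnected_of_eventuallyEq_zero hΩc hb h
      have h2 : f =ᶠ[𝓝 x] fun _ => f a := by
        filter_upwards [hΩ.mem_nhds hx] with z hz
        exact sub_eq_zero.1 (this hz)
      exact hd (by rw [h2.deriv_eq, deriv_const])
    · exact h
  have hev : ∀ᶠ z in 𝓝 b, (z ≠ b → f z - f a ≠ 0) ∧ z ∈ Ω ∧ z ≠ a :=
    (eventually_nhdsWithin_iff.1 hnz).and ((hΩ.eventually_mem hb).and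
      (isOpen_ne.eventually_mem (Ne.symm hne)))
  obtain ⟨r, hr, hrb⟩ := nhds_basis_closedBall.eventually_iff.1 hev
  have hsphere : ∀ z ∈ sphere b r, f z - f a ≠ 0 := fun z hz =>
    (hrb (sphere_subset_closedBall hz)).1 (ne_of_mem_sphere hz hr.ne')
  have hsub : closedBall b r ⊆ Ω := fun z hz => (hrb hz).2.1
  have hne' : (sphere b r).Nonempty := NormedSpace.sphere_nonempty.2 hr.le
  obtain ⟨z₀, hz₀, hmin⟩ := (isCompact_sphere b r).exists_isMinOn hne'
    ((hfd.continuousOn.mono (sphere_subset_closedBall.trans hsub)).sub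
      (continuousOn_const (c := f a))).norm
  set m := ‖f z₀ - f a‖ with hm
  have hm0 : 0 < m := norm_pos_iff.2 (hsphere z₀ hz₀)
  have hunif := (tendstoLocallyUniformlyOn_iff_forall_isCompact hΩ).1 hlim
    (insert a (closedBall b r))
    (insert_subset ha hsub) ((isCompact_closedBall b r).insert a)
  obtain ⟨n, hn⟩ := (Metric.tendstoUniformlyOn_iff.1 hunif (m / 4) (by positivity)).exists
  have hclose : ∀ z ∈ closedBall b r, ‖(F n z - F n a) - (f z - f a)‖ < m / 2 := fun z hz => by
    have h1 := hn z (mem_insert_of_mem _ hz)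
    have h2 := hn a (mem_insert _ _)
    rw [dist_eq_norm, norm_sub_rev] at h1
    rw [dist_eq_norm] at h2
    calc ‖(F n z - F n a) - (f z - f a)‖ = ‖(F n z - f z) + (f a - F n a)‖ := by ring_nf
      _ ≤ _ := norm_add_le _ _
      _ < m / 2 := by linarith
  have hFne : ∀ z ∈ closedBall b r, F n z - F n a ≠ 0 := fun z hz h =>
    (hrb hz).2.2 (hinj n (hsub hz) ha (sub_eq_zero.1 h))
  have hcl : closure (ball b r) = closedBall b r := closure_ball b hr.ne'
  have hdc : DiffContOnCl ℂ (fun z => (F n z - F n a)⁻¹) (ball b r) := by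
    refine DiffContOnCl.inv (f := fun z => F n z - F n a) ?_ fun z hz => hFne z (by rwa [hcl] at hz)
    refine DifferentiableOn.diffContOnCl ?_
    rw [hcl]
    exact ((hF n).mono hsub).sub_const _
  have hle := Complex.norm_le_of_forall_mem_frontier_norm_le isBounded_ball hdc (C := (m / 2)⁻¹)
    (fun z hz => by
      rw [frontier_ball b hr.ne'] at hz
      have h1 : m ≤ ‖f z - f a‖ := hmin hz
      have h2 := hclose z (sphere_subset_closedBall hz)
      have h3 := norm_sub_norm_le (f z - f a) (F n z - F n a)
      rw [norm_sub_rev (f z - f a)] at h3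
      rw [norm_inv]
      exact inv_anti₀ (by positivity) (by linarith)) (subset_closure (mem_ball_self hr))
  have h1 := hclose b (mem_closedBall_self hr.le)
  rw [← hab, sub_self, sub_zero] at h1
  rw [norm_inv, inv_le_inv₀ (norm_pos_iff.2 (hFne b (mem_closedBall_self hr.le)))
    (by positivity)] at hle
  linarith

/-- The inverse of an injective holomorphic function is holomorphic. -/
lemma differentiableOn_of_leftInvOn {Ω V : Set ℂ} (hΩ : IsOpen Ω) (hΩc : IsPreconnected Ω)
    {f g : ℂ → ℂ} (hf : DifferentiableOn ℂ f Ω) (hV : f '' Ω = V)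
    (hg : ∀ z ∈ Ω, g (f z) = z) {x : ℂ} (hx : x ∈ Ω) (hd : deriv f x ≠ 0) :
    IsOpen V ∧ DifferentiableOn ℂ g V := by
  subst hV
  have han : AnalyticOnNhd ℂ f Ω := hf.analyticOnNhd hΩ
  have hopen : ∀ s ⊆ Ω, IsOpen s → IsOpen (f '' s) := by
    rcases han.is_constant_or_isOpen hΩc with ⟨w, hw⟩ | h
    · exfalso
      have h2 : f =ᶠ[𝓝 x] fun _ => w := by
        filter_upwards [hΩ.mem_nhds hx] with z hz using hw z hz
      exact hd (by rw [h2.deriv_eq, deriv_const])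
    · exact h
  have hVo := hopen Ω subset_rfl hΩ
  have hgc : ∀ z ∈ Ω, ContinuousAt g (f z) := fun z hz => by
    intro s hs
    rw [hg z hz] at hs
    obtain ⟨t, hts, hto, hzt⟩ := _root_.mem_nhds_iff.1 (inter_mem hs (hΩ.mem_nhds hz))
    refine mem_map.2 (mem_of_superset
      ((hopen t (fun y hy => (hts hy).2) hto).mem_nhds ⟨z, hzt, rfl⟩) ?_)
    rintro - ⟨y, hy, rfl⟩
    rw [mem_preimage, hg y (hts hy).2]
    exact (hts hy).1
  have hgd : ∀ z ∈ Ω, deriv f z ≠ 0 → DifferentiableAt ℂ g (f z) := fun z hz hz' => by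
    refine (HasDerivAt.of_local_left_inverse (f := f) (hgc z hz)
      (f' := deriv f z) ?_ hz' ?_).differentiableAt
    · rw [hg z hz]
      exact (hf.differentiableAt (hΩ.mem_nhds hz)).hasDerivAt
    · filter_upwards [hVo.mem_nhds ⟨z, hz, rfl⟩]
      rintro - ⟨y, hy, rfl⟩
      rw [hg y hy]
  have hdan : AnalyticOnNhd ℂ (deriv f) Ω := han.deriv
  refine ⟨hVo, ?_⟩
  rintro - ⟨z, hz, rfl⟩
  refine DifferentiableAt.differentiableWithinAt ?_
  have hiso : ∀ᶠ y in 𝓝[≠] z, deriv f y ≠ 0 := by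
    rcases (hdan z hz).eventually_eq_zero_or_eventually_ne_zero with h | h
    · exact absurd (hdan.eqOn_zero_of_preconnected_of_eventuallyEq_zero hΩc hz h hx) hd
    · exact h
  obtain ⟨t, hts, hto, hzt⟩ := _root_.mem_nhds_iff.1
    (inter_mem (eventually_nhdsWithin_iff.1 hiso) (hΩ.mem_nhds hz))
  have hW : f '' t ∈ 𝓝 (f z) := (hopen t (fun y hy => (hts hy).2) hto).mem_nhds ⟨z, hzt, rfl⟩
  have := (Complex.differentiableOn_compl_singleton_and_continuousAt_iff hW (f := g)).1
    ⟨?_, hgc z hz⟩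
  · exact this.differentiableAt hW
  · rintro - ⟨⟨y, hy, rfl⟩, hne⟩
    refine (hgd y (hts hy).2 ((hts hy).1 ?_)).differentiableWithinAt
    rintro rfl
    exact hne rfl

/-- The Riemann mapping theorem for bounded domains. -/
theorem exists_riemann_map {Ω : Set ℂ} (hΩ : IsOpen Ω) (hΩc : IsConnected Ω)
    (hb : Bornology.IsBounded Ω) (h0 : 0 ∈ Ω) (hlog : HasAllLogs Ω) :
    ∃ f g : ℂ → ℂ, DifferentiableOn ℂ f Ω ∧ DifferentiableOn ℂ g (ball 0 1) ∧
      MapsTo f Ω (ball 0 1) ∧ MapsTo g (ball 0 1) Ω ∧ (∀ z ∈ Ω, g (f z) = z) ∧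
      (∀ w ∈ ball 0 1, f (g w) = w) ∧ f 0 = 0 ∧ g 0 = 0 := by
  obtain ⟨B, hB0, hB⟩ := hb.exists_pos_norm_le
  have hB1 : (0 : ℝ) < B + 1 := by linarith
  have hf₀ : IsDiscMap Ω fun z => z / ((B + 1 : ℝ) : ℂ) := by
    refine ⟨by fun_prop, fun z hz => ?_, fun z hz w hw h => ?_, by simp⟩
    · rw [mem_ball_zero_iff, norm_div, Complex.norm_real, Real.norm_of_nonneg hB1.le,
        div_lt_one hB1]
      linarith [hB z hz]
    · have : ((B + 1 : ℝ) : ℂ) ≠ 0 := by exact_mod_cast hB1.ne'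
      field_simp at h
      exact h
  have hd₀ : 0 < ‖deriv (fun z : ℂ => z / ((B + 1 : ℝ) : ℂ)) 0‖ := by
    rw [((hasDerivAt_id' (0 : ℂ)).div_const ((B + 1 : ℝ) : ℂ)).deriv, norm_pos_iff]
    exact one_div_ne_zero (by exact_mod_cast hB1.ne')
  obtain ⟨r, hr, hrΩ⟩ := Metric.isOpen_iff.1 hΩ 0 h0
  set S : Set ℝ := {x | ∃ f, IsDiscMap Ω f ∧ ‖deriv f 0‖ = x} with hS
  have hSne : S.Nonempty := ⟨_, _, hf₀, rfl⟩
  have hSb : BddAbove S := by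
    refine ⟨1 / r, ?_⟩
    rintro - ⟨f, hf, rfl⟩
    refine Complex.norm_deriv_le_div_of_mapsTo_ball (hf.differentiableOn.mono hrΩ) ?_ hr
    rw [hf.map_zero]
    exact fun z hz => ball_subset_closedBall (hf.mapsTo (hrΩ hz))
  obtain ⟨x, -, hxlim, hxS⟩ := exists_seq_tendsto_sSup hSne hSb
  choose F hF hFx using hxS
  have hU : (hyperfilter ℕ : Filter ℕ) ≤ atTop := by
    rw [← Nat.cofinite_eq_atTop]
    exact hyperfilter_le_cofinite
  obtain ⟨f, hlim⟩ := exists_tendstoLocallyUniformlyOn (hyperfilter ℕ) hΩ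
    (fun n => (hF n).differentiableOn) (fun n => (hF n).mapsTo)
  have hfd : DifferentiableOn ℂ f Ω :=
    hlim.differentiableOn (Eventually.of_forall fun n => (hF n).differentiableOn) hΩ
  have hderiv : ‖deriv f 0‖ = sSup S := by
    have h1 := (hlim.deriv (Eventually.of_forall fun n => (hF n).differentiableOn) hΩ).tendsto_at h0
    have h2 : Tendsto x (hyperfilter ℕ) (𝓝 ‖deriv f 0‖) := by
      simpa only [Function.comp_apply, hFx] using h1.norm
    exact tendsto_nhds_unique h2 (hxlim.mono_left hU)
  have hd : deriv f 0 ≠ 0 := by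
    rw [← norm_pos_iff, hderiv]
    exact hd₀.trans_le (le_csSup hSb ⟨_, hf₀, rfl⟩)
  have hinj : InjOn f Ω := injOn_of_tendstoLocallyUniformlyOn hΩ hΩc.isPreconnected
    (fun n => (hF n).differentiableOn) (fun n => (hF n).injOn) hlim h0 hd
  have hf0 : f 0 = 0 := tendsto_nhds_unique (hlim.tendsto_at h0) (by
    simp only [(hF _).map_zero]
    exact tendsto_const_nhds)
  have hginv : ∀ z ∈ Ω, Function.invFunOn f Ω (f z) = z := fun z hz =>
    hinj (Function.invFunOn_mem ⟨z, hz, rfl⟩) hz (Function.invFunOn_eq ⟨z, hz, rfl⟩)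
  obtain ⟨hVo, hgd⟩ := differentiableOn_of_leftInvOn hΩ hΩc.isPreconnected hfd rfl hginv h0 hd
  have hm : MapsTo f Ω (ball 0 1) := by
    have hcl : f '' Ω ⊆ closedBall 0 1 := by
      rintro - ⟨z, hz, rfl⟩
      exact isClosed_closedBall.mem_of_tendsto (hlim.tendsto_at hz)
        (Eventually.of_forall fun n => ball_subset_closedBall ((hF n).mapsTo hz))
    have := interior_maximal hcl hVo
    rw [interior_closedBall _ one_ne_zero] at this
    exact mapsTo_iff_image_subset.2 this
  have hdisc : IsDiscMap Ω f := ⟨hfd, hm, hinj, hf0⟩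
  have himg : f '' Ω = ball 0 1 := by
    refine subset_antisymm hm.image_subset fun a ha => ?_
    by_contra haf
    obtain ⟨g, hg, hlt⟩ := hdisc.exists_norm_deriv_lt hΩ h0 hlog hd (by simpa using ha) haf
    rw [hderiv] at hlt
    exact not_lt.2 (le_csSup hSb ⟨g, hg, rfl⟩) hlt
  rw [himg] at hgd
  refine ⟨f, Function.invFunOn f Ω, hfd, hgd, hm, fun w hw => ?_, hginv, fun w hw => ?_, hf0, ?_⟩
  · rw [← himg] at hw
    exact Function.invFunOn_mem hw
  · rw [← himg] at hw
    exact Function.invFunOn_eq hw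
  · have := hginv 0 h0
    rwa [hf0] at this

section LengthArea

open MeasureTheory Complex

lemma lintegral_enorm_deriv_sq_eq {g : ℂ → ℂ} {Ω : Set ℂ} (hΩ : IsOpen Ω)
    (hg : DifferentiableOn ℂ g Ω) (hinj : InjOn g Ω) :
    ∫⁻ z, Ω.indicator (fun z => ‖deriv g z‖ₑ ^ 2) z = volume (g '' Ω) := by
  rw [lintegral_indicator hΩ.measurableSet, ← lintegral_abs_det_fderiv_eq_addHaar_image volume
    hΩ.measurableSet (f' := fun z => ((ContinuousLinearMap.toSpanSingleton ℂ
      (deriv g z)).restrictScalars ℝ : ℂ →L[ℝ] ℂ)) (fun z hz => ?_) hinj]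
  · refine lintegral_congr fun z => ?_
    have : ((ContinuousLinearMap.toSpanSingleton ℂ (deriv g z)).restrictScalars ℝ :
        ℂ →L[ℝ] ℂ).det = ‖deriv g z‖ ^ 2 := by
      simp [ContinuousLinearMap.det, LinearMap.det_restrictScalars,
        Algebra.norm_complex_eq, Complex.normSq_eq_norm_sq]
    rw [this, abs_of_nonneg (by positivity), ENNReal.ofReal_pow (norm_nonneg _), ofReal_norm]
  · exact ((hg.differentiableAt (hΩ.mem_nhds hz)).hasDerivAt.hasFDerivAt.restrictScalars
      ℝ).hasFDerivWithinAt

lemma sq_lintegral_le_mul_lintegral_sq {α : Type*} [MeasurableSpace α] (μ : Measure α)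
    {F : α → ENNReal} (hF : AEMeasurable F μ) :
    (∫⁻ x, F x ∂μ) ^ 2 ≤ μ univ * ∫⁻ x, F x ^ 2 ∂μ := by
  have h := ENNReal.lintegral_mul_le_Lp_mul_Lq μ Real.HolderConjugate.two_two
    (aemeasurable_const (b := (1 : ENNReal))) hF
  have h2 := pow_le_pow_left₀ (zero_le) h 2
  simp only [Pi.mul_apply, one_mul, ENNReal.rpow_two, mul_pow, one_pow] at h2
  have h3 : ∀ x : ENNReal, (x ^ (1 / 2 : ℝ)) ^ 2 = x := fun x => by
    rw [← ENNReal.rpow_two, ← ENNReal.rpow_mul]; norm_num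
  rwa [h3, h3, lintegral_one] at h2

lemma normSq_neg_add_polar (t ρ θ : ℝ) :
    ‖-(t : ℂ) + ρ * exp (θ * I)‖ ^ 2 = t ^ 2 + ρ ^ 2 - 2 * t * ρ * Real.cos θ := by
  rw [← Complex.normSq_eq_norm_sq, Complex.normSq_apply]
  simp only [add_re, neg_re, ofReal_re, mul_re, ofReal_im, add_im, neg_im, mul_im,
    exp_ofReal_mul_I_re, exp_ofReal_mul_I_im]
  linear_combination ρ ^ 2 * Real.sin_sq_add_cos_sq θ

lemma neg_add_polar_mem_ball {t ρ a b θ : ℝ} (ht : 0 ≤ t) (hρ : 0 ≤ ρ)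
    (ha : a ∈ Icc (-Real.pi) Real.pi) (hb : b ∈ Icc (-Real.pi) Real.pi)
    (hza : -(t : ℂ) + ρ * exp (a * I) ∈ ball (0 : ℂ) 1)
    (hzb : -(t : ℂ) + ρ * exp (b * I) ∈ ball (0 : ℂ) 1) (hθ : θ ∈ uIcc a b) :
    -(t : ℂ) + ρ * exp (θ * I) ∈ ball (0 : ℂ) 1 := by
  have key : ∀ x : ℝ, -(t : ℂ) + ρ * exp (x * I) ∈ ball (0 : ℂ) 1 ↔
      t ^ 2 + ρ ^ 2 - 2 * t * ρ * Real.cos x < 1 := fun x => by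
    rw [mem_ball_zero_iff, ← normSq_neg_add_polar, sq_lt_one_iff₀ (norm_nonneg _)]
  rw [key] at *
  have habs : |θ| ≤ max |a| |b| := by
    rcases le_total 0 θ with h | h
    · rw [abs_of_nonneg h]
      exact hθ.2.trans (max_le_max (le_abs_self _) (le_abs_self _))
    · rw [abs_of_nonpos h]
      rcases le_total a b with h' | h'
      · have := hθ.1; rw [inf_eq_left.2 h'] at this
        exact le_max_of_le_left ((neg_le_neg this).trans (neg_le_abs a))
      · have := hθ.1; rw [inf_eq_right.2 h'] at this
        exact le_max_of_le_right ((neg_le_neg this).trans (neg_le_abs b))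
  have hc : ∀ x ∈ Icc (-Real.pi) Real.pi, |θ| ≤ |x| → Real.cos x ≤ Real.cos θ := fun x hx h => by
    rw [← Real.cos_abs x, ← Real.cos_abs θ]
    exact Real.cos_le_cos_of_nonneg_of_le_pi (abs_nonneg _) (abs_le.2 hx) h
  have htρ : 0 ≤ 2 * t * ρ := by positivity
  rcases le_max_iff.1 habs with h | h
  · have := mul_le_mul_of_nonneg_left (hc a ha h) htρ; linarith
  · have := mul_le_mul_of_nonneg_left (hc b hb h) htρ; linarith

lemma enorm_sub_sq_le_arc {g : ℂ → ℂ} (hg : DifferentiableOn ℂ g (ball 0 1)) {t ρ : ℝ}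
    (ht : 0 ≤ t) (hρ : 0 < ρ) {z w : ℂ} (hz : z ∈ ball (0 : ℂ) 1) (hw : w ∈ ball (0 : ℂ) 1)
    (hz' : ‖z + t‖ = ρ) (hw' : ‖w + t‖ = ρ) :
    ‖g w - g z‖ₑ ^ 2 ≤ ENNReal.ofReal (2 * Real.pi) * (ENNReal.ofReal ρ ^ 2 *
      ∫⁻ θ in Ioo (-Real.pi) Real.pi,
        (ball (0 : ℂ) 1).indicator (fun z => ‖deriv g z‖ₑ ^ 2) (-t + ρ * exp (θ * I))) := by
  set a := arg (z + t)
  set b := arg (w + t)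
  set γ : ℝ → ℂ := fun θ => -t + ρ * exp (θ * I) with hγ
  have hza : γ a = z := by
    have := norm_mul_exp_arg_mul_I (z + t)
    rw [hz'] at this
    simp only [hγ, a, this]; ring
  have hzb : γ b = w := by
    have := norm_mul_exp_arg_mul_I (w + t)
    rw [hw'] at this
    simp only [hγ, b, this]; ring
  have hmem : ∀ x : ℂ, arg x ∈ Icc (-Real.pi) Real.pi := fun x =>
    Ioc_subset_Icc_self (arg_mem_Ioc x)
  have hball : ∀ θ ∈ uIcc a b, γ θ ∈ ball (0 : ℂ) 1 := fun θ hθ =>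
    neg_add_polar_mem_ball ht hρ.le (hmem _) (hmem _) (by change γ a ∈ _; rwa [hza])
      (by change γ b ∈ _; rwa [hzb]) hθ
  have hγc : Continuous γ := by fun_prop
  have hγd : ∀ θ : ℝ, HasDerivAt γ (ρ * (exp (θ * I) * I)) θ := fun θ => by
    have h1 : HasDerivAt (fun θ : ℝ => (θ : ℂ) * I) I θ := by
      simpa using (ofRealCLM.hasDerivAt (x := θ)).mul_const I
    exact (h1.cexp.const_mul (ρ : ℂ)).const_add _
  have hd : ∀ θ ∈ uIcc a b, HasDerivAt (fun θ => g (γ θ))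
      (deriv g (γ θ) * (ρ * (exp (θ * I) * I))) θ := fun θ hθ =>
    (hg.differentiableAt (isOpen_ball.mem_nhds (hball θ hθ))).hasDerivAt.comp θ (hγd θ)
  have hdc : ContinuousOn (fun θ : ℝ => deriv g (γ θ) * (ρ * (exp (θ * I) * I))) (uIcc a b) := by
    refine ContinuousOn.mul ((hg.deriv isOpen_ball).continuousOn.comp hγc.continuousOn hball) ?_
    fun_prop
  have hlat := intervalIntegral.integral_eq_sub_of_hasDerivAt hd hdc.intervalIntegrable
  rw [hza, hzb] at hlat
  have hsub : uIoc a b ⊆ Ioc (-Real.pi) Real.pi :=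
    Ioc_subset_Ioc (le_min (hmem _).1 (hmem _).1) (max_le (hmem _).2 (hmem _).2)
  have hF : Measurable fun z => (ball (0 : ℂ) 1).indicator (fun z => ‖deriv g z‖ₑ ^ 2) z :=
    ((measurable_deriv g).enorm.pow_const 2).indicator measurableSet_ball
  have hle : ‖g w - g z‖ₑ ≤ ENNReal.ofReal ρ * ∫⁻ θ in uIoc a b, ‖deriv g (γ θ)‖ₑ := by
    have hm : Measurable fun θ => ‖deriv g (γ θ)‖ₑ :=
      ((measurable_deriv g).comp hγc.measurable).enorm
    rw [← hlat, ← lintegral_const_mul _ hm]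
    have h1 : ‖∫ θ in a..b, deriv g (γ θ) * (ρ * (exp (θ * I) * I))‖ₑ =
        ‖∫ θ in uIoc a b, deriv g (γ θ) * (ρ * (exp (θ * I) * I))‖ₑ := by
      rw [← ofReal_norm, ← ofReal_norm, intervalIntegral.norm_intervalIntegral_eq]
    rw [h1]
    refine (enorm_integral_le_lintegral_enorm _).trans (lintegral_mono fun θ => ?_)
    rw [enorm_mul, enorm_mul, enorm_mul, ← ofReal_norm (exp _), norm_exp_ofReal_mul_I,
      ← ofReal_norm I, norm_I, ← ofReal_norm (ρ : ℂ), norm_real, Real.norm_of_nonneg hρ.le]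
    simp [mul_comm]
  have hcs := sq_lintegral_le_mul_lintegral_sq (volume.restrict (uIoc a b))
    (F := fun θ => ‖deriv g (γ θ)‖ₑ) ((measurable_deriv g).comp hγc.measurable).enorm.aemeasurable
  have hvol : volume.restrict (uIoc a b) univ ≤ ENNReal.ofReal (2 * Real.pi) := by
    rw [Measure.restrict_apply_univ]
    refine (measure_mono hsub).trans ?_
    rw [Real.volume_Ioc]
    exact ENNReal.ofReal_le_ofReal (by linarith)
  have hind : ∫⁻ θ in uIoc a b, ‖deriv g (γ θ)‖ₑ ^ 2 ≤ ∫⁻ θ in Ioo (-Real.pi) Real.pi,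
      (ball (0 : ℂ) 1).indicator (fun z => ‖deriv g z‖ₑ ^ 2) (γ θ) := by
    rw [setLIntegral_congr Ioo_ae_eq_Ioc]
    refine le_trans (le_of_eq ?_) (lintegral_mono_set hsub)
    refine setLIntegral_congr_fun measurableSet_uIoc fun θ hθ => ?_
    rw [indicator_of_mem (hball θ (uIoc_subset_uIcc hθ))]
  calc ‖g w - g z‖ₑ ^ 2 ≤ (ENNReal.ofReal ρ * ∫⁻ θ in uIoc a b, ‖deriv g (γ θ)‖ₑ) ^ 2 := by gcongr
    _ ≤ ENNReal.ofReal ρ ^ 2 * (ENNReal.ofReal (2 * Real.pi) * ∫⁻ θ in Ioo (-Real.pi) Real.pi,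
      (ball (0 : ℂ) 1).indicator (fun z => ‖deriv g z‖ₑ ^ 2) (γ θ)) := by
        rw [mul_pow]
        gcongr
        exact hcs.trans (mul_le_mul' hvol hind)
    _ = _ := by ring

lemma exists_radius_short_arc_of_real {g : ℂ → ℂ} (hg : DifferentiableOn ℂ g (ball 0 1))
    (hinj : InjOn g (ball 0 1)) {M : ℝ} (hM : volume (g '' ball 0 1) ≤ ENNReal.ofReal M)
    {ε δ δ' t : ℝ} (hε : 0 < ε) (hδ' : 0 < δ') (hδ : δ' < δ) (ht : 0 ≤ t)
    (hlog : 2 * Real.pi * M < ε ^ 2 * Real.log (δ / δ')) :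
    ∃ ρ ∈ Ioo δ' δ, ∀ z ∈ ball (0 : ℂ) 1 ∩ sphere (-(t : ℂ)) ρ,
      ∀ w ∈ ball (0 : ℂ) 1 ∩ sphere (-(t : ℂ)) ρ, ‖g w - g z‖ < ε := by
  by_contra! hcon
  set F : ℂ → ENNReal := (ball (0 : ℂ) 1).indicator (fun z => ‖deriv g z‖ₑ ^ 2) with hFdef
  have hF : Measurable F :=
    ((measurable_deriv g).enorm.pow_const 2).indicator measurableSet_ball
  have hA : ∫⁻ z, F (-t + z) ≤ ENNReal.ofReal M := by
    rw [lintegral_add_left_eq_self F (-(t : ℂ)), lintegral_enorm_deriv_sq_eq isOpen_ball hg hinj]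
    exact hM
  have hpolar : ∫⁻ z, F (-t + z) = ∫⁻ ρ in Ioi (0 : ℝ), ∫⁻ θ in Ioo (-Real.pi) Real.pi,
      ENNReal.ofReal ρ * F (-t + ρ * exp (θ * I)) := by
    rw [← Complex.lintegral_comp_polarCoord_symm, polarCoord_target,
      Measure.volume_eq_prod, setLIntegral_prod]
    · simp [Complex.polarCoord_symm_apply, exp_mul_I]
    · simp only [Complex.polarCoord_symm_apply]
      refine Measurable.aemeasurable ?_
      simp only [smul_eq_mul]
      refine Measurable.mul (by fun_prop) (hF.comp ?_)
      fun_prop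
  have hlow : ENNReal.ofReal (∫ ρ in δ'..δ, ε ^ 2 / (2 * Real.pi) * ρ⁻¹) ≤
      ∫⁻ z, F (-t + z) := by
    have h0 : (0 : ℝ) ∉ uIcc δ' δ := by
      rw [uIcc_of_le hδ.le]; exact fun h => not_lt.2 h.1 hδ'
    rw [hpolar, intervalIntegral.integral_of_le hδ.le, integral_Ioc_eq_integral_Ioo,
      ofReal_integral_eq_lintegral_ofReal]
    · refine le_trans ?_ (lintegral_mono_set (fun ρ (hρ : ρ ∈ Ioo δ' δ) => hδ'.trans hρ.1))
      refine setLIntegral_mono' measurableSet_Ioo fun ρ hρ => ?_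
      have hρ0 : 0 < ρ := hδ'.trans hρ.1
      obtain ⟨z, ⟨hz, hz'⟩, w, ⟨hw, hw'⟩, hzw⟩ := hcon ρ hρ
      have h1 := enorm_sub_sq_le_arc hg ht hρ0 hz hw (by simpa [dist_eq_norm] using hz')
        (by simpa [dist_eq_norm] using hw')
      have hm : Measurable fun θ : ℝ => F (-t + ρ * exp (θ * I)) := hF.comp (by fun_prop)
      rw [lintegral_const_mul _ hm]
      have h2 : ENNReal.ofReal (ε ^ 2) ≤ ‖g w - g z‖ₑ ^ 2 := by
        rw [ENNReal.ofReal_pow hε.le, ← ofReal_norm]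
        gcongr
      have h3 := h2.trans h1
      have h4 : ENNReal.ofReal (ε ^ 2 / (2 * Real.pi) * ρ⁻¹) =
          ENNReal.ofReal (1 / (2 * Real.pi) * ρ⁻¹) * ENNReal.ofReal (ε ^ 2) := by
        rw [← ENNReal.ofReal_mul (by positivity)]; ring_nf
      rw [h4]
      refine (mul_le_mul_right h3 _).trans (le_of_eq ?_)
      rw [← mul_assoc, ← mul_assoc, ← ENNReal.ofReal_mul (by positivity),
        ← ENNReal.ofReal_pow hρ0.le, ← ENNReal.ofReal_mul (by positivity)]
      congr 2
      field_simp
    · refine (IntegrableOn.mono_set ?_ Ioo_subset_Icc_self)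
      refine ContinuousOn.integrableOn_Icc ?_
      refine continuousOn_const.mul (continuousOn_id.inv₀ fun x hx => ?_)
      exact (hδ'.trans_le hx.1).ne'
    · refine (ae_restrict_iff' measurableSet_Ioo).2 (Eventually.of_forall fun ρ hρ => ?_)
      have := hδ'.trans hρ.1
      simp only [Pi.zero_apply]
      positivity
  have h5 := hlow.trans hA
  rw [intervalIntegral.integral_const_mul, integral_inv_of_pos hδ' (hδ'.trans hδ)] at h5
  have hpos : 0 < ε ^ 2 / (2 * Real.pi) * Real.log (δ / δ') := by
    have : 0 < Real.log (δ / δ') := Real.log_pos ((one_lt_div hδ').2 hδ)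
    have := Real.pi_pos
    positivity
  have h6 := (ENNReal.ofReal_le_ofReal_iff' .. |>.1 h5).resolve_right (not_le.2 hpos)
  rw [div_mul_eq_mul_div, div_le_iff₀ (by positivity)] at h6
  linarith

/-- **Length–area principle.** A bounded univalent function on the unit disc maps arcs of suitable
small circles to sets of small diameter. -/
lemma exists_radius_short_arc {g : ℂ → ℂ} (hg : DifferentiableOn ℂ g (ball 0 1))
    (hinj : InjOn g (ball 0 1)) (hb : Bornology.IsBounded (g '' ball 0 1))
    {ε δ : ℝ} (hε : 0 < ε) (hδ : 0 < δ) :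
    ∃ δ' > 0, ∀ ζ : ℂ, ∃ ρ ∈ Ioo δ' δ, ∀ z ∈ ball (0 : ℂ) 1 ∩ sphere ζ ρ,
      ∀ w ∈ ball (0 : ℂ) 1 ∩ sphere ζ ρ, ‖g w - g z‖ < ε := by
  set M := (volume (g '' ball 0 1)).toReal
  have hM : volume (g '' ball 0 1) ≤ ENNReal.ofReal M :=
    (ENNReal.ofReal_toReal hb.measure_lt_top.ne).ge
  have hpos : 0 ≤ 2 * Real.pi * M / ε ^ 2 := by positivity
  refine ⟨δ * Real.exp (-(2 * Real.pi * M / ε ^ 2 + 1)), by positivity, fun ζ => ?_⟩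
  obtain ⟨u, hu, hζ⟩ : ∃ u : ℂ, ‖u‖ = 1 ∧ ζ = u * (-(‖ζ‖ : ℂ)) := by
    refine ⟨-exp (arg ζ * I), by rw [norm_neg, norm_exp_ofReal_mul_I], ?_⟩
    rw [neg_mul_neg, mul_comm, norm_mul_exp_arg_mul_I]
  have hu0 : u ≠ 0 := fun h => by simp [h] at hu
  have hmaps : ∀ z ∈ ball (0 : ℂ) 1, u * z ∈ ball (0 : ℂ) 1 := fun z hz => by
    rw [mem_ball_zero_iff] at *; rwa [norm_mul, hu, one_mul]
  have hG : DifferentiableOn ℂ (fun z => g (u * z)) (ball 0 1) :=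
    hg.comp (by fun_prop) hmaps
  have hGi : InjOn (fun z => g (u * z)) (ball 0 1) := fun x hx y hy h =>
    mul_left_cancel₀ hu0 (hinj (hmaps x hx) (hmaps y hy) h)
  have hGM : volume ((fun z => g (u * z)) '' ball 0 1) ≤ ENNReal.ofReal M := by
    refine (measure_mono ?_).trans hM
    rintro - ⟨z, hz, rfl⟩
    exact ⟨_, hmaps z hz, rfl⟩
  have hlt : δ * Real.exp (-(2 * Real.pi * M / ε ^ 2 + 1)) < δ := by
    have : Real.exp (-(2 * Real.pi * M / ε ^ 2 + 1)) < 1 := by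
      rw [Real.exp_lt_one_iff]; linarith
    nlinarith
  obtain ⟨ρ, hρ, h⟩ := exists_radius_short_arc_of_real hG hGi hGM hε (by positivity) hlt
    (norm_nonneg ζ) (by
      rw [← div_div, div_self hδ.ne', one_div, ← Real.exp_neg, neg_neg, Real.log_exp, mul_add,
        mul_div_cancel₀ _ (by positivity)]
      nlinarith [sq_pos_of_pos hε])
  refine ⟨ρ, hρ, fun z hz w hw => ?_⟩
  have hinvu : ‖u⁻¹‖ = 1 := by simp [hu]
  have hconv : ∀ z ∈ ball (0 : ℂ) 1 ∩ sphere ζ ρ,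
      u⁻¹ * z ∈ ball (0 : ℂ) 1 ∩ sphere (-(‖ζ‖ : ℂ)) ρ := fun z hz => by
    refine ⟨?_, ?_⟩
    · have := hz.1
      rw [mem_ball_zero_iff] at *; rwa [norm_mul, hinvu, one_mul]
    · have h1 := mem_sphere_iff_norm.1 hz.2
      rw [mem_sphere_iff_norm]
      have h2 : z - ζ = u * (u⁻¹ * z - -(‖ζ‖ : ℂ)) := by
        rw [mul_sub, mul_inv_cancel_left₀ hu0, ← hζ]
      rwa [h2, norm_mul, hu, one_mul] at h1
  simpa [mul_inv_cancel_left₀ hu0] using h _ (hconv z hz) _ (hconv w hw)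

end LengthArea

section Caratheodory

open Complex

lemma exists_isPreconnected_away_of_real {t η : ℝ} (ht : 0 ≤ t) (hη : 0 < η)
    (hη' : η < 1 / 4) :
    ∃ S ⊆ ball (0 : ℂ) 1, IsPreconnected S ∧ Disjoint S (ball (t : ℂ) η) ∧
      ball (0 : ℂ) 1 \ S ⊆ closedBall (t : ℂ) (4 * η) := by
  set B := ball (0 : ℂ) 1
  have hB : ∀ z : ℂ, z ∈ B ↔ z.re * z.re + z.im * z.im < 1 := fun z => by
    rw [mem_ball_zero_iff, ← Complex.normSq_apply, Complex.normSq_eq_norm_sq,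
      sq_lt_one_iff₀ (norm_nonneg _)]
  have hBc : Convex ℝ B := convex_ball 0 1
  set H₁ := {z : ℂ | z.re < t - η}
  set H₂ := {z : ℂ | η < z.im}
  set H₃ := {z : ℂ | z.im < -η}
  set H₄ := {z : ℂ | t + η < z.re ∧ t < 1 - 3 * η}
  have hre : IsLinearMap ℝ Complex.re := Complex.reLm.isLinear
  have him : IsLinearMap ℝ Complex.im := Complex.imLm.isLinear
  have c₁ : IsPreconnected (B ∩ H₁) := (hBc.inter (convex_halfSpace_lt hre _)).isPreconnected
  have c₂ : IsPreconnected (B ∩ H₂) := (hBc.inter (convex_halfSpace_gt him _)).isPreconnected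
  have c₃ : IsPreconnected (B ∩ H₃) := (hBc.inter (convex_halfSpace_lt him _)).isPreconnected
  have c₁₂ : IsPreconnected (B ∩ H₁ ∪ B ∩ H₂) := by
    refine c₁.union (⟨-1 / 2, 1 / 2⟩ : ℂ) ⟨(hB _).2 ?_, ?_⟩ ⟨(hB _).2 ?_, ?_⟩ c₂
    · norm_num
    · show -1 / 2 < t - η; linarith
    · norm_num
    · show η < 1 / 2; linarith
  have c₁₂₃ : IsPreconnected (B ∩ H₁ ∪ B ∩ H₂ ∪ B ∩ H₃) := by
    refine c₁₂.union (⟨-1 / 2, -1 / 2⟩ : ℂ) (Or.inl ⟨(hB _).2 ?_, ?_⟩) ⟨(hB _).2 ?_, ?_⟩ c₃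
    · norm_num
    · show -1 / 2 < t - η; linarith
    · norm_num
    · show -1 / 2 < -η; linarith
  have c₄ : IsPreconnected (B ∩ H₁ ∪ B ∩ H₂ ∪ B ∩ H₃ ∪ B ∩ H₄) := by
    by_cases h : t < 1 - 3 * η
    · have hp : (⟨t + 3 / 2 * η, 3 / 2 * η⟩ : ℂ) ∈ B := by
        rw [hB]
        simp only
        nlinarith
      have h4 : H₄ = {z : ℂ | t + η < z.re} := by ext z; simp [H₄, h]
      refine c₁₂₃.union (⟨t + 3 / 2 * η, 3 / 2 * η⟩ : ℂ) (Or.inl (Or.inr ⟨hp, ?_⟩)) ⟨hp, ?_, h⟩ ?_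
      · show η < 3 / 2 * η; linarith
      · show t + η < t + 3 / 2 * η; linarith
      · rw [h4]
        exact (hBc.inter (convex_halfSpace_gt hre _)).isPreconnected
    · have h4 : H₄ = ∅ := by ext z; simp [H₄, h]
      simpa [h4] using c₁₂₃
  refine ⟨_, ?_, c₄, ?_, ?_⟩
  · simp only [union_subset_iff, inter_subset_left, and_self]
  · rw [Set.disjoint_left]
    rintro z hz hzt
    have hd := mem_ball_iff_norm.1 hzt
    have h1 := (abs_re_le_norm (z - t)).trans_lt hd
    have h2 := (abs_im_le_norm (z - t)).trans_lt hd
    simp only [sub_re, ofReal_re, sub_im, ofReal_im, sub_zero, abs_lt] at h1 h2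
    rcases hz with ((⟨-, hz⟩ | ⟨-, hz⟩) | ⟨-, hz⟩) | ⟨-, hz, -⟩
    · have : z.re < t - η := hz
      linarith [h1.1]
    · have : η < z.im := hz
      linarith [h2.2]
    · have : z.im < -η := hz
      linarith [h2.1]
    · linarith [h1.2]
  · rintro z ⟨hzB, hz⟩
    have n₁ : t - η ≤ z.re := not_lt.1 fun h => hz (Or.inl (Or.inl (Or.inl ⟨hzB, h⟩)))
    have n₂ : z.im ≤ η := not_lt.1 fun h => hz (Or.inl (Or.inl (Or.inr ⟨hzB, h⟩)))
    have n₃ : -η ≤ z.im := not_lt.1 fun h => hz (Or.inl (Or.inr ⟨hzB, h⟩))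
    have n₄ : z.re ≤ t + 3 * η := by
      by_contra! h
      have hz1 : z.re < 1 := by
        have := (le_abs_self _).trans (abs_re_le_norm z)
        exact this.trans_lt (mem_ball_zero_iff.1 hzB)
      exact hz (Or.inr ⟨hzB, show t + η < z.re by linarith, by linarith⟩)
    rw [mem_closedBall_iff_norm]
    refine (norm_le_abs_re_add_abs_im _).trans ?_
    simp only [sub_re, ofReal_re, sub_im, ofReal_im, sub_zero]
    have a₁ : |z.re - t| ≤ 3 * η := abs_le.2 ⟨by linarith, by linarith⟩
    have a₂ : |z.im| ≤ η := abs_le.2 ⟨n₃, n₂⟩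
    linarith

lemma exists_isPreconnected_away (y : ℂ) {η : ℝ} (hη : 0 < η) (hη' : η < 1 / 4) :
    ∃ S ⊆ ball (0 : ℂ) 1, IsPreconnected S ∧ Disjoint S (ball y η) ∧
      ball (0 : ℂ) 1 \ S ⊆ closedBall y (4 * η) := by
  obtain ⟨S, hS, hc, hd, hr⟩ := exists_isPreconnected_away_of_real (norm_nonneg y) hη hη'
  set u := exp (arg y * I)
  have hu : ‖u‖ = 1 := norm_exp_ofReal_mul_I _
  have hu0 : u ≠ 0 := exp_ne_zero _
  have hy : u * ‖y‖ = y := by rw [mul_comm]; exact norm_mul_exp_arg_mul_I y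
  have hn : ∀ z, ‖u * z‖ = ‖z‖ := fun z => by rw [norm_mul, hu, one_mul]
  have hdist : ∀ z : ℂ, ‖u * z - y‖ = ‖z - ‖y‖‖ := fun z => by
    conv_lhs => rw [← hy, ← mul_sub, hn]
  refine ⟨(fun z => u * z) '' S, ?_, hc.image _ (by fun_prop), ?_, ?_⟩
  · rintro - ⟨z, hz, rfl⟩
    have := mem_ball_zero_iff.1 (hS hz)
    rw [mem_ball_zero_iff, hn]
    exact this
  · rw [Set.disjoint_left]
    rintro - ⟨z, hz, rfl⟩ h
    rw [mem_ball_iff_norm, hdist] at h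
    exact Set.disjoint_left.1 hd hz (mem_ball_iff_norm.2 h)
  · rintro z ⟨hz, hzS⟩
    obtain ⟨w, rfl⟩ : ∃ w, z = u * w := ⟨u⁻¹ * z, by rw [mul_inv_cancel_left₀ hu0]⟩
    rw [mem_closedBall_iff_norm, hdist, ← mem_closedBall_iff_norm]
    refine hr ⟨?_, fun h => hzS ⟨w, h, rfl⟩⟩
    rwa [mem_ball_zero_iff, hn, ← mem_ball_zero_iff] at hz

lemma IsPreconnected.forall_lt_dist {S : Set ℂ} (hS : IsPreconnected S) {ζ p : ℂ} {ρ : ℝ}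
    (hd : Disjoint S (sphere ζ ρ)) (hp : p ∈ S) (hpρ : ρ < dist p ζ) :
    ∀ z ∈ S, ρ < dist z ζ := by
  intro z hz
  by_contra! h
  have := (hS.image (fun z => dist z ζ) (by fun_prop)).ordConnected.out
    (mem_image_of_mem _ hz) (mem_image_of_mem _ hp) ⟨h, hpρ.le⟩
  obtain ⟨x, hx, hxρ⟩ := this
  exact Set.disjoint_left.1 hd hx hxρ

lemma uniformContinuousOn_of_short_arcs {κ l : ℂ → ℂ}
    (hl : ContinuousOn l (ball 0 1)) (hκm : MapsTo κ (ball 0 1) (ball 0 1))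
    (hlm : MapsTo l (ball 0 1) (ball 0 1)) (hlκ : ∀ z ∈ ball (0 : ℂ) 1, l (κ z) = z)
    (hκl : ∀ z ∈ ball (0 : ℂ) 1, κ (l z) = z)
    (harc : ∀ η > 0, ∀ δ > 0, ∃ δ' > 0, ∀ ζ : ℂ, ∃ ρ ∈ Ioo δ' δ, ∀ z ∈ ball (0 : ℂ) 1 ∩ sphere ζ ρ,
      ∀ w ∈ ball (0 : ℂ) 1 ∩ sphere ζ ρ, dist (κ w) (κ z) < η) :
    UniformContinuousOn κ (ball 0 1) := by
  obtain ⟨p₀, p₁, p₂, hp₀, hp₁, hp₂, h01, h02, h12⟩ : ∃ p₀ p₁ p₂ : ℂ, p₀ ∈ ball (0 : ℂ) 1 ∧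
      p₁ ∈ ball (0 : ℂ) 1 ∧ p₂ ∈ ball (0 : ℂ) 1 ∧ 1 / 2 ≤ dist p₀ p₁ ∧ 1 / 2 ≤ dist p₀ p₂ ∧
      1 / 2 ≤ dist p₁ p₂ :=
    ⟨0, 1 / 2, -1 / 2, by norm_num, by norm_num, by norm_num, by norm_num [dist_eq_norm],
      by norm_num [dist_eq_norm], by norm_num [dist_eq_norm]⟩
  have hinj : InjOn κ (ball 0 1) := fun x hx y hy h => by rw [← hlκ x hx, h, hlκ y hy]
  have hpos : ∀ p ∈ ball (0 : ℂ) 1, ∀ q ∈ ball (0 : ℂ) 1, 1 / 2 ≤ dist p q →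
      0 < dist (κ p) (κ q) := fun p hp q hq h => by
    refine dist_pos.2 fun he => ?_
    rw [hinj hp hq he, dist_self] at h
    norm_num at h
  have d01 := hpos p₀ hp₀ p₁ hp₁ h01
  have d02 := hpos p₀ hp₀ p₂ hp₂ h02
  have d12 := hpos p₁ hp₁ p₂ hp₂ h12
  rw [Metric.uniformContinuousOn_iff]
  intro ε hε
  obtain ⟨η, hη, hη4, hηε, e01, e02, e12⟩ : ∃ η : ℝ, 0 < η ∧ η < 1 / 4 ∧ 8 * η < ε ∧
      8 * η < dist (κ p₀) (κ p₁) ∧ 8 * η < dist (κ p₀) (κ p₂) ∧ 8 * η < dist (κ p₁) (κ p₂) := by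
    have h : ∀ a : ℝ, 0 < a → ∀ᶠ η in 𝓝[>] (0 : ℝ), 8 * η < a := fun a ha => by
      have : Tendsto (fun η : ℝ => 8 * η) (𝓝[>] 0) (𝓝 (8 * 0)) :=
        ((continuous_const.mul continuous_id).tendsto 0).mono_left nhdsWithin_le_nhds
      rw [mul_zero] at this
      exact this.eventually_lt_const ha
    obtain ⟨η, ⟨⟨⟨⟨⟨h1, h2⟩, h3⟩, h4⟩, h5⟩, h6⟩⟩ := (((((eventually_mem_nhdsWithin.and
      (h 1 one_pos)).and (h ε hε)).and (h _ d01)).and (h _ d02)).and (h _ d12)).exists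
    exact ⟨η, h1, by linarith, h3, h4, h5, h6⟩
  obtain ⟨δ', hδ', hδ⟩ := harc η hη (1 / 4) (by norm_num)
  refine ⟨δ', hδ', ?_⟩
  intro ζ hζ z hz hzζ
  obtain ⟨ρ, hρ, hsmall⟩ := hδ ζ
  obtain ⟨y, hy⟩ : ∃ y, ∀ z ∈ ball (0 : ℂ) 1 ∩ sphere ζ ρ, κ z ∈ ball y η := by
    rcases (ball (0 : ℂ) 1 ∩ sphere ζ ρ).eq_empty_or_nonempty with h | ⟨z₀, hz₀⟩
    · exact ⟨0, by simp [h]⟩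
    · exact ⟨κ z₀, fun z hz => hsmall z₀ hz₀ z hz⟩
  obtain ⟨S, hS, hSc, hSd, hSr⟩ := exists_isPreconnected_away y hη hη4
  have hfar : ∃ p ∈ ball (0 : ℂ) 1, κ p ∈ S ∧ 1 / 4 ≤ dist p ζ := by
    by_contra! hcon
    have key : ∀ p ∈ ball (0 : ℂ) 1, κ p ∉ S → dist (κ p) y ≤ 4 * η := fun p hp h =>
      mem_closedBall.1 (hSr ⟨hκm hp, h⟩)
    have pair : ∀ p ∈ ball (0 : ℂ) 1, ∀ q ∈ ball (0 : ℂ) 1, 8 * η < dist (κ p) (κ q) →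
        κ p ∈ S ∨ κ q ∈ S := fun p hp q hq h => by
      by_contra! h'
      have := dist_triangle_right (κ p) (κ q) y
      linarith [key p hp h'.1, key q hq h'.2]
    have pair' : ∀ p ∈ ball (0 : ℂ) 1, ∀ q ∈ ball (0 : ℂ) 1, 1 / 2 ≤ dist p q →
        κ p ∈ S → κ q ∈ S → False := fun p hp q hq h h1 h2 => by
      have := dist_triangle_right p q ζ
      linarith [hcon p hp h1, hcon q hq h2]
    have a := pair p₀ hp₀ p₁ hp₁ e01
    have b := pair p₀ hp₀ p₂ hp₂ e02
    have c := pair p₁ hp₁ p₂ hp₂ e12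
    have a' := pair' p₀ hp₀ p₁ hp₁ h01
    have b' := pair' p₀ hp₀ p₂ hp₂ h02
    have c' := pair' p₁ hp₁ p₂ hp₂ h12
    tauto
  obtain ⟨p, hp, hpS, hpζ⟩ := hfar
  have hlS : Disjoint (l '' S) (sphere ζ ρ) := by
    rw [Set.disjoint_left]
    rintro - ⟨s, hs, rfl⟩ h
    have := hy _ ⟨hlm (hS hs), h⟩
    rw [hκl s (hS hs)] at this
    exact Set.disjoint_left.1 hSd hs this
  have hall := (hSc.image l (hl.mono hS)).forall_lt_dist hlS ⟨κ p, hpS, hlκ p hp⟩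
    (hρ.2.trans_le hpζ)
  have hin : ∀ w ∈ ball (0 : ℂ) 1, dist w ζ < ρ → dist (κ w) y ≤ 4 * η := fun w hw h => by
    refine mem_closedBall.1 (hSr ⟨hκm hw, fun hwS => ?_⟩)
    exact lt_asymm h (hall w ⟨κ w, hwS, hlκ w hw⟩)
  have h1 := hin ζ hζ (by rw [dist_self]; exact hδ'.trans hρ.1)
  have h2 := hin z hz (by rw [dist_comm]; exact hzζ.trans hρ.1)
  have := dist_triangle_right (κ ζ) (κ z) y
  linarith

lemma UniformContinuousOn.continuousOn_extendFrom_closure {X Y : Type*} [UniformSpace X]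
    [UniformSpace Y] [CompleteSpace Y] [T0Space Y] {s : Set X} {f : X → Y}
    (hf : UniformContinuousOn f s) : ContinuousOn (extendFrom s f) (closure s) := by
  refine continuousOn_extendFrom subset_rfl fun x hx => ?_
  have : (𝓝[s] x).NeBot := mem_closure_iff_nhdsWithin_neBot.1 hx
  refine CompleteSpace.complete (cauchy_map_iff.2 ⟨this, Tendsto.mono_left hf ?_⟩)
  refine le_inf ?_ ?_
  · refine (Filter.prod_mono nhdsWithin_le_nhds nhdsWithin_le_nhds).trans ?_
    rw [← nhds_prod_eq]
    exact nhds_le_uniformity x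
  · rw [← Filter.prod_principal_principal]
    exact Filter.prod_mono inf_le_right inf_le_right

lemma DiffContOnCl.eq_zero_of_eqOn_arc {h : ℂ → ℂ} (hh : DiffContOnCl ℂ h (ball 0 1))
    {N : Set ℂ} (hN : IsOpen N) {ξ₀ : ℂ} (hξ₀ : ξ₀ ∈ N) (hξ₀' : ‖ξ₀‖ = 1)
    (h0 : ∀ ξ ∈ N, ‖ξ‖ = 1 → h ξ = 0) : h 0 = 0 := by
  obtain ⟨t, ht, hcov⟩ := (isCompact_sphere (0 : ℂ) 1).elim_finite_subcover_image
    (b := sphere (0 : ℂ) 1) (c := fun u => {ξ | u * ξ ∈ N})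
    (fun u _ => hN.preimage (continuous_const.mul continuous_id)) (fun ξ hξ => by
      have hξ1 : ‖ξ‖ = 1 := by simpa using hξ
      have hξ0 : ξ ≠ 0 := fun h => by simp [h] at hξ1
      refine mem_iUnion₂.2 ⟨ξ₀ * ξ⁻¹, by simp [hξ1, hξ₀'], ?_⟩
      show ξ₀ * ξ⁻¹ * ξ ∈ N
      rwa [inv_mul_cancel_right₀ hξ0])
  obtain ⟨htf, hcov⟩ := hcov
  set T := htf.toFinset
  have hT : ∀ u ∈ T, ‖u‖ = 1 := fun u hu => by simpa using ht (htf.mem_toFinset.1 hu)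
  have hone : ∀ u ∈ T, DiffContOnCl ℂ (fun z => h (u * z)) (ball 0 1) := fun u hu => by
    have hm : Differentiable ℂ fun z : ℂ => u * z := by fun_prop
    refine hh.comp hm.diffContOnCl fun z hz => ?_
    rw [mem_ball_zero_iff] at *
    rwa [norm_mul, hT u hu, one_mul]
  have hP : DiffContOnCl ℂ (fun z => ∏ u ∈ T, h (u * z)) (ball 0 1) := by
    refine ⟨DifferentiableOn.fun_finsetProd fun u hu => (hone u hu).differentiableOn, ?_⟩
    exact continuousOn_finsetProd _ fun u hu => (hone u hu).continuousOn
  have hzero := Complex.norm_le_of_forall_mem_frontier_norm_le isBounded_ball hP (C := 0)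
    (fun z hz => by
      rw [frontier_ball _ one_ne_zero] at hz
      have hz1 : ‖z‖ = 1 := by simpa using hz
      obtain ⟨u, hu, huz⟩ := mem_iUnion₂.1 (hcov hz)
      have hu' : u ∈ T := htf.mem_toFinset.2 hu
      rw [Finset.prod_eq_zero hu' (h0 (u * z) huz
        (by rw [norm_mul, hT u hu', hz1, one_mul])), norm_zero])
    (z := 0) (subset_closure (mem_ball_self one_pos))
  rw [norm_le_zero_iff, Finset.prod_eq_zero_iff] at hzero
  obtain ⟨u, -, hu⟩ := hzero
  simpa using hu

end Caratheodory

section CaratheodoryExtension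

open Complex

lemma isPreconnected_sphere_diff_singleton {y : ℂ} (hy : ‖y‖ = 1) :
    IsPreconnected (sphere (0 : ℂ) 1 \ {y}) := by
  have hy0 : y ≠ 0 := fun h => by simp [h] at hy
  have : sphere (0 : ℂ) 1 \ {y} = (fun θ : ℝ => -y * exp (θ * I)) '' Ioo (-Real.pi) Real.pi := by
    ext b
    constructor
    · rintro ⟨hb, hby⟩
      have hb1 : ‖b‖ = 1 := by simpa using hb
      have hq : ‖b / -y‖ = 1 := by rw [norm_div, norm_neg, hb1, hy, div_one]
      have he := norm_mul_exp_arg_mul_I (b / -y)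
      rw [hq, ofReal_one, one_mul] at he
      refine ⟨arg (b / -y), ⟨neg_pi_lt_arg _, lt_of_le_of_ne (arg_le_pi _) fun h => hby ?_⟩, ?_⟩
      · rw [h, exp_pi_mul_I] at he
        have := (eq_div_iff (neg_ne_zero.2 hy0)).1 he
        rw [mem_singleton_iff, ← this]; ring
      · simp only [he]
        field_simp
    · rintro ⟨θ, hθ, rfl⟩
      refine ⟨by simp [hy, norm_exp_ofReal_mul_I], fun h => ?_⟩
      have h1 : exp (θ * I) = -1 := by
        have : y * exp (θ * I) = y * (-1) := by linear_combination -(mem_singleton_iff.1 h)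
        exact mul_left_cancel₀ hy0 this
      have h2 : Real.cos θ = -1 := by
        have := congrArg re h1
        simpa [exp_ofReal_mul_I_re] using this
      have h3 : Real.cos |θ| = Real.cos Real.pi := by rw [Real.cos_abs, h2, Real.cos_pi]
      have h4 := Real.injOn_cos ⟨abs_nonneg θ, (abs_lt.2 hθ).le⟩ ⟨Real.pi_pos.le, le_rfl⟩ h3
      exact (abs_lt.2 hθ).ne h4
  rw [this]
  exact isPreconnected_Ioo.image _ (by fun_prop)

lemma re_mul_conj_sub {a b : ℂ} (ha : ‖a‖ = 1) (hb : ‖b‖ = 1) :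
    2 * (a * conj (b - a)).re = - normSq (b - a) := by
  have ha' : a.re * a.re + a.im * a.im = 1 := by
    rw [← normSq_apply, normSq_eq_norm_sq, ha, one_pow]
  have hb' : b.re * b.re + b.im * b.im = 1 := by
    rw [← normSq_apply, normSq_eq_norm_sq, hb, one_pow]
  simp only [normSq_apply, mul_re, map_sub, sub_re, sub_im, conj_re, conj_im]
  linear_combination -ha' + hb'

lemma eq_or_eq_of_im_mul_conj_eq_zero {a b z : ℂ} (ha : ‖a‖ = 1) (hb : ‖b‖ = 1) (hz : ‖z‖ = 1)
    (hab : a ≠ b) (h : ((z - a) * conj (b - a)).im = 0) : z = a ∨ z = b := by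
  have hd : b - a ≠ 0 := sub_ne_zero.2 hab.symm
  have hn : normSq (b - a) ≠ 0 := fun h => hd (normSq_eq_zero.1 h)
  set s := ((z - a) * conj (b - a)).re / normSq (b - a)
  have hs : z = a + s * (b - a) := by
    have h1 : (z - a) * conj (b - a) = (s * normSq (b - a) : ℝ) := by
      rw [div_mul_cancel₀ _ hn]
      exact Complex.ext rfl h
    have h2 : (z - a) * conj (b - a) = s * (b - a) * conj (b - a) := by
      rw [h1, mul_assoc, mul_conj]; push_cast; rfl
    have h3 := mul_right_cancel₀ ((map_ne_zero _).2 hd) h2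
    linear_combination h3
  have hz' : normSq z = 1 := by rw [normSq_eq_norm_sq, hz, one_pow]
  have ha' : normSq a = 1 := by rw [normSq_eq_norm_sq, ha, one_pow]
  rw [hs, normSq_add, ha', normSq_mul, normSq_ofReal] at hz'
  have h4 : (a * conj (↑s * (b - a))).re = s * (a * conj (b - a)).re := by
    rw [map_mul, conj_ofReal, mul_left_comm, re_ofReal_mul]
  rw [h4] at hz'
  have h5 : normSq (b - a) * (s * (s - 1)) = 0 := by
    linear_combination hz' - s * re_mul_conj_sub ha hb
  rcases mul_eq_zero.1 ((mul_eq_zero.1 h5).resolve_left hn) with h6 | h6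
  · left; rw [hs, h6]; simp
  · right; rw [hs, sub_eq_zero.1 h6]; simp

lemma exists_im_mul_conj_pos {a b : ℂ} (ha : ‖a‖ = 1) (hb : ‖b‖ = 1) (hab : a ≠ b) {ε : ℝ}
    (hε : |ε| = 1) : ∃ z : ℂ, ‖z‖ = 1 ∧ 0 < ε * ((z - a) * conj (b - a)).im := by
  have hd : b - a ≠ 0 := sub_ne_zero.2 hab.symm
  have hn : ‖b - a‖ ≠ 0 := norm_ne_zero_iff.2 hd
  have hlt : |(a * conj (b - a)).im| < ‖b - a‖ := by
    have h1 : |(a * conj (b - a)).im| < ‖a * conj (b - a)‖ := by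
      rw [abs_im_lt_norm]
      have := re_mul_conj_sub ha hb
      intro h
      rw [h, mul_zero, zero_eq_neg, normSq_eq_zero] at this
      exact hd this
    rwa [norm_mul, ha, one_mul, norm_conj] at h1
  have hε2 : ε * ε = 1 := by rw [← abs_mul_abs_self, hε, one_mul]
  refine ⟨ε * I * ((b - a) / ‖b - a‖), ?_, ?_⟩
  · rw [norm_mul, norm_mul, norm_I, norm_real, Real.norm_eq_abs, hε, norm_div, norm_real, norm_norm,
      div_self hn]
    norm_num
  · have h2 : (ε * I * ((b - a) / ‖b - a‖)) * conj (b - a) = (ε * ‖b - a‖ : ℝ) * I := by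
      have : (b - a) * conj (b - a) = (‖b - a‖ : ℂ) * ‖b - a‖ := by
        rw [mul_conj, normSq_eq_norm_sq]; push_cast; ring
      have hn' : (‖b - a‖ : ℂ) ≠ 0 := by exact_mod_cast hn
      push_cast
      field_simp
      linear_combination ε * this
    rw [sub_mul, sub_im, h2, im_ofReal_mul, I_im, mul_one, mul_sub, ← mul_assoc, hε2, one_mul]
    have h3 : ε * (a * conj (b - a)).im ≤ |(a * conj (b - a)).im| := by
      refine (le_abs_self _).trans ?_
      rw [abs_mul, hε, one_mul]
    linarith

lemma exists_arc_const_of_not_injOn {κ l : ℂ → ℂ} (hκ : ContinuousOn κ (closedBall 0 1))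
    (hl : ContinuousOn l (ball 0 1)) (hκm : MapsTo κ (ball 0 1) (ball 0 1))
    (hκs : MapsTo κ (sphere 0 1) (sphere 0 1))
    (hlm : MapsTo l (ball 0 1) (ball 0 1)) (hlκ : ∀ z ∈ ball (0 : ℂ) 1, l (κ z) = z)
    (hκl : ∀ z ∈ ball (0 : ℂ) 1, κ (l z) = z) {a b y : ℂ} (ha : ‖a‖ = 1) (hb : ‖b‖ = 1)
    (hab : a ≠ b) (hay : κ a = y) (hby : κ b = y) :
    ∃ N : Set ℂ, IsOpen N ∧ (∃ ξ ∈ N, ‖ξ‖ = 1) ∧ ∀ ξ ∈ N, ‖ξ‖ = 1 → κ ξ = y := by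
  set L : ℂ → ℝ := fun z => ((z - a) * conj (b - a)).im with hL
  have hLc : Continuous L := by fun_prop
  set B := ball (0 : ℂ) 1 with hB
  have hs : ∀ z : ℂ, ‖z‖ = 1 → z ∈ sphere (0 : ℂ) 1 := fun z hz => by simpa using hz
  have hy : ‖y‖ = 1 := by simpa [hay] using hκs (hs a ha)
  set U : ℝ → Set ℂ := fun ε => {x | ∃ r > 0, ∀ w ∈ ball x r ∩ B, ε * L (l w) < 0} with hU
  have hUo : ∀ ε, IsOpen (U ε) := fun ε => by
    rw [Metric.isOpen_iff]
    rintro x ⟨r, hr, h⟩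
    refine ⟨r / 2, by positivity, fun x' hx' => ⟨r / 2, by positivity, fun w hw => h w ⟨?_, hw.2⟩⟩⟩
    refine mem_ball.2 ((dist_triangle w x' x).trans_lt ?_)
    linarith [mem_ball.1 hw.1, mem_ball.1 hx']
  have hne : ∀ x ∈ sphere (0 : ℂ) 1, ∀ r > 0, (ball x r ∩ B).Nonempty := fun x hx r hr => by
    have : x ∈ closure B := by
      rw [hB, closure_ball _ one_ne_zero]; exact sphere_subset_closedBall hx
    obtain ⟨w, hw, hwr⟩ := Metric.mem_closure_iff.1 this r hr
    exact ⟨w, by rwa [mem_ball, dist_comm], hw⟩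
  have hcov : sphere (0 : ℂ) 1 \ {y} ⊆ U 1 ∪ U (-1) := by
    rintro x ⟨hx, hxy⟩
    have hK : IsCompact (κ '' (closedBall 0 1 ∩ L ⁻¹' {0})) :=
      ((isCompact_closedBall 0 1).inter_right (isClosed_singleton.preimage hLc)).image_of_continuousOn
        (hκ.mono inter_subset_left)
    have hxK : x ∉ κ '' (closedBall 0 1 ∩ L ⁻¹' {0}) := by
      rintro ⟨z, ⟨hz, hz0⟩, rfl⟩
      rcases (mem_closedBall_zero_iff.1 hz).lt_or_eq with h | h
      · have h1 : ‖κ z‖ < 1 := mem_ball_zero_iff.1 (hκm (mem_ball_zero_iff.2 h))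
        have h2 : ‖κ z‖ = 1 := by simpa using hx
        exact h1.ne h2
      · rcases eq_or_eq_of_im_mul_conj_eq_zero ha hb h hab hz0 with rfl | rfl
        · exact hxy hay
        · exact hxy hby
    obtain ⟨r, hr, hrK⟩ := Metric.isOpen_iff.1 hK.isClosed.isOpen_compl x hxK
    have hne0 : ∀ w ∈ ball x r ∩ B, L (l w) ≠ 0 := fun w hw h0 => by
      refine hrK hw.1 ⟨l w, ⟨ball_subset_closedBall (hlm hw.2), h0⟩, hκl w hw.2⟩
    have hpre : IsPreconnected ((fun w => L (l w)) '' (ball x r ∩ B)) :=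
      ((convex_ball x r).inter (convex_ball 0 1)).isPreconnected.image _
        (hLc.comp_continuousOn (hl.mono inter_subset_right))
    by_contra hnot
    have hn1 : ∃ w ∈ ball x r ∩ B, 0 ≤ L (l w) := by
      by_contra! h
      exact hnot (Or.inl ⟨r, hr, fun w hw => by simpa using h w hw⟩)
    have hn2 : ∃ w ∈ ball x r ∩ B, L (l w) ≤ 0 := by
      by_contra! h
      exact hnot (Or.inr ⟨r, hr, fun w hw => by simpa using h w hw⟩)
    obtain ⟨w₁, hw₁, h₁⟩ := hn1
    obtain ⟨w₂, hw₂, h₂⟩ := hn2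
    obtain ⟨w, hw, h0⟩ := hpre.ordConnected.out (mem_image_of_mem _ hw₂) (mem_image_of_mem _ hw₁)
      ⟨h₂, h₁⟩
    exact hne0 w hw h0
  have key : ∀ ε : ℝ, |ε| = 1 → sphere (0 : ℂ) 1 \ {y} ⊆ U ε → ∃ N : Set ℂ, IsOpen N ∧
      (∃ ξ ∈ N, ‖ξ‖ = 1) ∧ ∀ ξ ∈ N, ‖ξ‖ = 1 → κ ξ = y := fun ε hε hsub => by
    obtain ⟨ξ₀, hξ₀, hpos⟩ := exists_im_mul_conj_pos ha hb hab hε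
    have hNo : IsOpen {ξ | 0 < ε * L ξ} := isOpen_lt continuous_const (continuous_const.mul hLc)
    refine ⟨{ξ | 0 < ε * L ξ}, hNo, ⟨ξ₀, hpos, hξ₀⟩, fun ξ hξ hξ1 => ?_⟩
    by_contra hne'
    obtain ⟨r, hr, h⟩ := hsub ⟨hκs (hs ξ hξ1), hne'⟩
    have hev : ∀ᶠ z in 𝓝[B] ξ, κ z ∈ ball (κ ξ) r ∧ 0 < ε * L z := by
      refine Filter.Eventually.and ?_ (nhdsWithin_le_nhds (hNo.mem_nhds hξ))
      exact ((hκ ξ (sphere_subset_closedBall (hs ξ hξ1))).mono ball_subset_closedBall).eventually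
        (ball_mem_nhds _ hr)
    have : (𝓝[B] ξ).NeBot := by
      rw [← mem_closure_iff_nhdsWithin_neBot, hB, closure_ball _ one_ne_zero]
      exact sphere_subset_closedBall (hs ξ hξ1)
    obtain ⟨z, ⟨hz1, hz2⟩, hz3⟩ := (hev.and self_mem_nhdsWithin).exists
    have h3 := h (κ z) ⟨hz1, hκm hz3⟩
    rw [hlκ z hz3] at h3
    exact lt_asymm h3 hz2
  rcases isPreconnected_iff_subset_of_disjoint.1 (isPreconnected_sphere_diff_singleton hy) _ _
    (hUo 1) (hUo (-1)) hcov (by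
      refine eq_empty_of_forall_notMem ?_
      rintro x ⟨⟨hx, -⟩, ⟨r₁, hr₁, h₁⟩, ⟨r₂, hr₂, h₂⟩⟩
      obtain ⟨w, hw, hwB⟩ := hne x hx (min r₁ r₂) (lt_min hr₁ hr₂)
      have e₁ := h₁ w ⟨ball_subset_ball (min_le_left _ _) hw, hwB⟩
      have e₂ := h₂ w ⟨ball_subset_ball (min_le_right _ _) hw, hwB⟩
      linarith) with h | h
  · exact key 1 (by norm_num) h
  · exact key (-1) (by norm_num) h

lemma IsCompact.exists_dist_lt_of_injOn {X Y : Type*} [PseudoMetricSpace X] [MetricSpace Y]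
    {K : Set X} (hK : IsCompact K) {c : X → Y} (hc : ContinuousOn c K) (hinj : InjOn c K)
    {η : ℝ} (hη : 0 < η) :
    ∃ ε > 0, ∀ a ∈ K, ∀ b ∈ K, dist (c a) (c b) < ε → dist a b < η := by
  set S := (K ×ˢ K) ∩ {q : X × X | η ≤ dist q.1 q.2}
  have hS : IsCompact S := (hK.prod hK).inter_right
    (isClosed_le continuous_const (continuous_fst.dist continuous_snd))
  have hcS : ContinuousOn (fun q : X × X => dist (c q.1) (c q.2)) S := by
    exact continuous_dist.comp_continuousOn ((hc.comp continuousOn_fst fun q hq => hq.1.1).prodMk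
      (hc.comp continuousOn_snd fun q hq => hq.1.2))
  rcases S.eq_empty_or_nonempty with h | h
  · refine ⟨1, one_pos, fun a ha b hb _ => not_le.1 fun hle => ?_⟩
    exact (h ▸ notMem_empty (a, b)) (show (a, b) ∈ S from ⟨⟨ha, hb⟩, hle⟩)
  · obtain ⟨q, hq, hmin⟩ := hS.exists_isMinOn h hcS
    refine ⟨dist (c q.1) (c q.2), dist_pos.2 fun he => ?_, fun a ha b hb hlt =>
      not_le.1 fun hle => ?_⟩
    · have h1 : η ≤ dist q.1 q.2 := hq.2
      rw [hinj hq.1.1 hq.1.2 he, dist_self] at h1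
      linarith
    · exact not_lt.2 (hmin (show (a, b) ∈ S from ⟨⟨ha, hb⟩, hle⟩)) hlt

lemma IsCompact.continuousOn_of_leftInvOn {X Y : Type*} [PseudoMetricSpace X] [MetricSpace Y]
    {K : Set X} (hK : IsCompact K) {c : X → Y} (hc : ContinuousOn c K) (hinj : InjOn c K)
    {d : Y → X} (hd : ∀ x ∈ K, d (c x) = x) : ContinuousOn d (c '' K) := by
  rw [Metric.continuousOn_iff]
  rintro - ⟨b, hb, rfl⟩ η hη
  obtain ⟨ε, hε, h⟩ := hK.exists_dist_lt_of_injOn hc hinj hη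
  refine ⟨ε, hε, ?_⟩
  rintro - ⟨a, ha, rfl⟩ hab
  rw [hd a ha, hd b hb]
  exact h a ha b hb hab

/-- **Carathéodory's theorem** for a Jordan domain given as a parametrized topological disc `c`:
a Riemann map `g` onto the interior differs from `c` by a homeomorphism `κ` of the closed disc. -/
theorem exists_caratheodory_extension {g f c : ℂ → ℂ} (hg : DifferentiableOn ℂ g (ball 0 1))
    (hf : ContinuousOn f (g '' ball 0 1)) (hfg : ∀ z ∈ ball (0 : ℂ) 1, f (g z) = z)
    (hc : ContinuousOn c (closedBall 0 1)) (hcinj : InjOn c (closedBall 0 1))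
    (himg : c '' ball 0 1 = g '' ball 0 1) :
    ∃ κ : ℂ → ℂ, ContinuousOn κ (closedBall 0 1) ∧ InjOn κ (closedBall 0 1) ∧
      κ '' closedBall 0 1 = closedBall 0 1 ∧ MapsTo κ (ball 0 1) (ball 0 1) ∧
      MapsTo κ (sphere 0 1) (sphere 0 1) ∧ ∀ z ∈ ball (0 : ℂ) 1, c (κ z) = g z := by
  have hgi : InjOn g (ball 0 1) := fun x hx y hy h => by rw [← hfg x hx, h, hfg y hy]
  have hBK : ball (0 : ℂ) 1 ⊆ closedBall 0 1 := ball_subset_closedBall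
  have hKc : IsCompact (closedBall (0 : ℂ) 1) := isCompact_closedBall 0 1
  set d := Function.invFunOn c (closedBall 0 1)
  have hdc : ∀ z ∈ closedBall (0 : ℂ) 1, d (c z) = z := fun z hz => hcinj.leftInvOn_invFunOn hz
  have hd : ContinuousOn d (c '' closedBall 0 1) := hKc.continuousOn_of_leftInvOn hc hcinj hdc
  set κ₀ : ℂ → ℂ := fun z => d (g z) with hκ₀
  set l : ℂ → ℂ := fun z => f (c z) with hldef
  have hgc : ∀ z ∈ ball (0 : ℂ) 1, ∃ w ∈ ball (0 : ℂ) 1, c w = g z := fun z hz => by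
    have : g z ∈ c '' ball 0 1 := himg ▸ mem_image_of_mem g hz
    exact this
  have hcg : ∀ z ∈ ball (0 : ℂ) 1, ∃ w ∈ ball (0 : ℂ) 1, g w = c z := fun z hz => by
    have : c z ∈ g '' ball 0 1 := himg ▸ mem_image_of_mem c hz
    exact this
  have hcκ : ∀ z ∈ ball (0 : ℂ) 1, c (κ₀ z) = g z := fun z hz => by
    obtain ⟨w, hw, h⟩ := hgc z hz
    rw [hκ₀]; simp only [← h, hdc w (hBK hw)]
  have hκm₀ : MapsTo κ₀ (ball 0 1) (ball 0 1) := fun z hz => by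
    obtain ⟨w, hw, h⟩ := hgc z hz
    rw [hκ₀]; simp only [← h, hdc w (hBK hw)]; exact hw
  have hlm : MapsTo l (ball 0 1) (ball 0 1) := fun z hz => by
    obtain ⟨w, hw, h⟩ := hcg z hz
    rw [hldef]; simp only [← h, hfg w hw]; exact hw
  have hl : ContinuousOn l (ball 0 1) :=
    hf.comp (hc.mono hBK) fun z hz => himg ▸ mem_image_of_mem c hz
  have hlκ₀ : ∀ z ∈ ball (0 : ℂ) 1, l (κ₀ z) = z := fun z hz => by
    rw [hldef]; simp only [hcκ z hz, hfg z hz]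
  have hκl₀ : ∀ z ∈ ball (0 : ℂ) 1, κ₀ (l z) = z := fun z hz => by
    obtain ⟨w, hw, h⟩ := hcg z hz
    rw [hκ₀, hldef]; simp only [← h, hfg w hw]; rw [h, hdc z (hBK hz)]
  have hbdd : Bornology.IsBounded (g '' ball 0 1) := by
    rw [← himg]
    exact (hKc.image_of_continuousOn hc).isBounded.subset (image_mono hBK)
  have huc : UniformContinuousOn κ₀ (ball 0 1) := by
    refine uniformContinuousOn_of_short_arcs hl hκm₀ hlm hlκ₀ hκl₀ fun η hη δ hδ => ?_
    obtain ⟨ε, hε, hεη⟩ := hKc.exists_dist_lt_of_injOn hc hcinj hη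
    obtain ⟨δ', hδ', h⟩ := exists_radius_short_arc hg hgi hbdd hε hδ
    refine ⟨δ', hδ', fun ζ => ?_⟩
    obtain ⟨ρ, hρ, hr⟩ := h ζ
    refine ⟨ρ, hρ, fun z hz w hw => hεη _ (hBK (hκm₀ hw.1)) _ (hBK (hκm₀ hz.1)) ?_⟩
    rw [hcκ z hz.1, hcκ w hw.1, dist_eq_norm]
    exact hr z hz w hw
  set κ := extendFrom (ball (0 : ℂ) 1) κ₀ with hκdef
  have hclos : closure (ball (0 : ℂ) 1) = closedBall 0 1 := closure_ball _ one_ne_zero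
  have hκ : ContinuousOn κ (closedBall 0 1) := by
    have := huc.continuousOn_extendFrom_closure
    rwa [hclos] at this
  have heq : ∀ z ∈ ball (0 : ℂ) 1, κ z = κ₀ z := fun z hz =>
    extendFrom_eq (subset_closure hz) (huc.continuousOn z hz)
  have hκm : MapsTo κ (ball 0 1) (ball 0 1) := fun z hz => by rw [heq z hz]; exact hκm₀ hz
  have hlκ : ∀ z ∈ ball (0 : ℂ) 1, l (κ z) = z := fun z hz => by rw [heq z hz, hlκ₀ z hz]
  have hκl : ∀ z ∈ ball (0 : ℂ) 1, κ (l z) = z := fun z hz => by rw [heq _ (hlm hz), hκl₀ z hz]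
  have hκK : MapsTo κ (closedBall 0 1) (closedBall 0 1) := by
    have h := hκm.closure_of_continuousOn (hclos ▸ hκ)
    rwa [hclos] at h
  have hκs : MapsTo κ (sphere 0 1) (sphere 0 1) := fun ξ hξ => by
    have hξK := sphere_subset_closedBall hξ
    by_contra hnot
    have hb : κ ξ ∈ ball (0 : ℂ) 1 := by
      have h1 := mem_closedBall_zero_iff.1 (hκK hξK)
      exact mem_ball_zero_iff.2 (lt_of_le_of_ne h1 fun h => hnot (by simpa using h))
    have : (𝓝[ball 0 1] ξ).NeBot := by
      rw [← mem_closure_iff_nhdsWithin_neBot, hclos]; exact hξK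
    have ht1 : Tendsto κ (𝓝[ball 0 1] ξ) (𝓝 (κ ξ)) := (hκ ξ hξK).mono hBK
    have ht2 : Tendsto (fun z => l (κ z)) (𝓝[ball 0 1] ξ) (𝓝 (l (κ ξ))) :=
      ((hl.continuousAt (isOpen_ball.mem_nhds hb)).tendsto).comp ht1
    have ht3 : Tendsto (fun z => l (κ z)) (𝓝[ball 0 1] ξ) (𝓝 ξ) :=
      (tendsto_id.mono_left nhdsWithin_le_nhds).congr'
        (eventually_mem_nhdsWithin.mono fun z hz => (hlκ z hz).symm)
    have h2 := hlm hb
    rw [tendsto_nhds_unique ht2 ht3] at h2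
    have h3 : ‖ξ‖ = 1 := by simpa using hξ
    exact (mem_ball_zero_iff.1 h2).ne h3
  have hcκ' : ∀ z ∈ ball (0 : ℂ) 1, c (κ z) = g z := fun z hz => by rw [heq z hz, hcκ z hz]
  have hsplit : ∀ z ∈ closedBall (0 : ℂ) 1, z ∈ ball (0 : ℂ) 1 ∨ z ∈ sphere (0 : ℂ) 1 :=
    fun z hz => by
      rw [← ball_union_sphere] at hz; exact hz
  have hdisj : ∀ z ∈ ball (0 : ℂ) 1, z ∉ sphere (0 : ℂ) 1 := fun z hz h =>
    (mem_ball.1 hz).ne (mem_sphere.1 h)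
  refine ⟨κ, hκ, ?_, ?_, hκm, hκs, hcκ'⟩
  · intro a ha b hb hab
    rcases hsplit a ha with ha' | ha' <;> rcases hsplit b hb with hb' | hb'
    · rw [← hlκ a ha', hab, hlκ b hb']
    · exact (hdisj _ (hκm ha') (hab ▸ hκs hb')).elim
    · exact (hdisj _ (hκm hb') (hab ▸ hκs ha')).elim
    · by_contra hne
      obtain ⟨N, hN, ⟨ξ, hξ, hξ1⟩, hconst⟩ :=
        exists_arc_const_of_not_injOn hκ hl hκm hκs hlm hlκ hκl
        (by simpa using ha') (by simpa using hb') hne rfl hab.symm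
      have hD : DiffContOnCl ℂ (fun z => c (κ z) - c (κ a)) (ball 0 1) := by
        refine ⟨(hg.congr hcκ').sub_const _, ?_⟩
        rw [hclos]
        exact (hc.comp hκ hκK).sub continuousOn_const
      have h0 := hD.eq_zero_of_eqOn_arc hN hξ hξ1 fun ξ hξ hξ1 => by rw [hconst ξ hξ hξ1, sub_self]
      have h0b := mem_ball_self (x := (0 : ℂ)) one_pos
      have := hcinj (hBK (hκm h0b)) (hκK ha) (sub_eq_zero.1 h0)
      exact hdisj _ (hκm h0b) (this ▸ hκs ha')
  · refine subset_antisymm hκK.image_subset ?_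
    rw [← hclos]
    refine closure_minimal (fun z hz => ⟨l z, subset_closure (hlm hz), hκl z hz⟩) ?_
    rw [hclos]
    exact (hKc.image_of_continuousOn hκ).isClosed

end CaratheodoryExtension

section Radial

variable {a b α β : ℝ}

/-- The factor of the radial map of the plane that is affine on radii in `[a, b]`, sends radius `a`
to `α` and radius `b` to `β`, and is linear on radii outside `[a, b]`. -/
noncomputable def radialScale (a b α β x : ℝ) : ℝ :=
  (α + (max a (min x b) - a) * ((β - α) / (b - a))) / max a (min x b)

lemma radialScale_of_le (hab : a < b) {x : ℝ} (hx : x ≤ a) :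
    radialScale a b α β x = α / a := by
  simp [radialScale, min_eq_left (hx.trans hab.le), max_eq_left hx]

lemma radialScale_of_ge (hab : a < b) {x : ℝ} (hx : b ≤ x) :
    radialScale a b α β x = β / b := by
  have : b - a ≠ 0 := (sub_pos.2 hab).ne'
  rw [radialScale, min_eq_right hx, max_eq_right hab.le, mul_div_cancel₀ _ this]
  ring

lemma radialScale_mul_of_mem (ha : 0 < a) {x : ℝ} (hx : x ∈ Icc a b) :
    radialScale a b α β x * x = α + (x - a) * ((β - α) / (b - a)) := by
  rw [radialScale, min_eq_left hx.2, max_eq_right hx.1,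
    div_mul_cancel₀ _ (ha.trans_le hx.1).ne']

lemma radialScale_pos (ha : 0 < a) (hab : a < b) (ha' : 0 < α) (hab' : α < β) (x : ℝ) :
    0 < radialScale a b α β x := by
  have h1 : 0 < b - a := sub_pos.2 hab
  have h2 : 0 < β - α := sub_pos.2 hab'
  have h3 : 0 ≤ max a (min x b) - a := sub_nonneg.2 (le_max_left _ _)
  have h4 : 0 < max a (min x b) := ha.trans_le (le_max_left _ _)
  unfold radialScale
  positivity

lemma continuous_radialScale (ha : 0 < a) : Continuous (radialScale a b α β) := by
  unfold radialScale
  refine Continuous.div (by fun_prop) (by fun_prop) fun x => ?_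
  exact (ha.trans_le (le_max_left _ _)).ne'

lemma radialScale_mul_radialScale (ha : 0 < a) (hab : a < b) (ha' : 0 < α) (hab' : α < β)
    (x : ℝ) :
    radialScale α β a b (radialScale a b α β x * x) * radialScale a b α β x = 1 := by
  have h1 : 0 < b - a := sub_pos.2 hab
  have h2 : 0 < β - α := sub_pos.2 hab'
  have hb : 0 < b := ha.trans hab
  have hb' : 0 < β := ha'.trans hab'
  rcases le_total x a with h | h
  · rw [radialScale_of_le hab h, radialScale_of_le hab']
    · field_simp
    · rw [div_mul_eq_mul_div, div_le_iff₀ ha]; gcongr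
  rcases le_total b x with h' | h'
  · rw [radialScale_of_ge hab h', radialScale_of_ge hab']
    · field_simp
    · rw [div_mul_eq_mul_div, le_div_iff₀ hb]; gcongr
  · have hx : 0 < x := ha.trans_le h
    have e := radialScale_mul_of_mem (α := α) (β := β) ha ⟨h, h'⟩
    have hmem : radialScale a b α β x * x ∈ Icc α β := by
      rw [e]
      constructor
      · have : 0 ≤ (x - a) * ((β - α) / (b - a)) :=
          mul_nonneg (sub_nonneg.2 h) (by positivity)
        linarith
      · have : (x - a) * ((β - α) / (b - a)) ≤ (b - a) * ((β - α) / (b - a)) := by gcongr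
        rw [mul_div_cancel₀ _ h1.ne'] at this
        linarith
    have e' := radialScale_mul_of_mem (α := a) (β := b) ha' hmem
    have : radialScale α β a b (radialScale a b α β x * x) * radialScale a b α β x * x =
        x := by
      rw [mul_assoc, e', e]
      field_simp
      ring
    exact mul_right_cancel₀ hx.ne' (this.trans (one_mul x).symm)

/-- The radial homeomorphism of the plane with factor `radialScale`. -/
noncomputable def radialHomeo (ha : 0 < a) (hab : a < b) (ha' : 0 < α) (hab' : α < β) :
    ℂ ≃ₜ ℂ where
  toFun z := (radialScale a b α β ‖z‖ : ℂ) * z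
  invFun z := (radialScale α β a b ‖z‖ : ℂ) * z
  left_inv z := by
    simp only [norm_mul, Complex.norm_real, Real.norm_of_nonneg
      (radialScale_pos ha hab ha' hab' _).le]
    rw [← mul_assoc, ← Complex.ofReal_mul, radialScale_mul_radialScale ha hab ha' hab',
      Complex.ofReal_one, one_mul]
  right_inv z := by
    simp only [norm_mul, Complex.norm_real, Real.norm_of_nonneg
      (radialScale_pos ha' hab' ha hab _).le]
    rw [← mul_assoc, ← Complex.ofReal_mul, radialScale_mul_radialScale ha' hab' ha hab,
      Complex.ofReal_one, one_mul]
  continuous_toFun := (Complex.continuous_ofReal.comp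
    ((continuous_radialScale ha).comp continuous_norm)).mul continuous_id
  continuous_invFun := (Complex.continuous_ofReal.comp
    ((continuous_radialScale ha').comp continuous_norm)).mul continuous_id

lemma radialHomeo_symm (ha : 0 < a) (hab : a < b) (ha' : 0 < α) (hab' : α < β) :
    (radialHomeo ha hab ha' hab').symm = radialHomeo ha' hab' ha hab := rfl

lemma radialHomeo_of_le (ha : 0 < a) (hab : a < b) (ha' : 0 < α) (hab' : α < β) {z : ℂ}
    (hz : ‖z‖ ≤ a) : radialHomeo ha hab ha' hab' z = ((α / a : ℝ) : ℂ) * z := by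
  change ((radialScale a b α β ‖z‖ : ℝ) : ℂ) * z = _
  rw [radialScale_of_le hab hz]

lemma radialHomeo_of_ge (ha : 0 < a) (hab : a < b) (ha' : 0 < α) (hab' : α < β) {z : ℂ}
    (hz : b ≤ ‖z‖) : radialHomeo ha hab ha' hab' z = ((β / b : ℝ) : ℂ) * z := by
  change ((radialScale a b α β ‖z‖ : ℝ) : ℂ) * z = _
  rw [radialScale_of_ge hab hz]

lemma le_norm_radialHomeo (ha : 0 < a) (hab : a < b) (ha' : 0 < α) (hab' : α < β) {z : ℂ}
    (hz : b ≤ ‖z‖) : β ≤ ‖radialHomeo ha hab ha' hab' z‖ := by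
  have hb : 0 < b := ha.trans hab
  have hb' : 0 < β := ha'.trans hab'
  rw [radialHomeo_of_ge ha hab ha' hab' hz, norm_mul, Complex.norm_real,
    Real.norm_of_nonneg (by positivity), div_mul_eq_mul_div, le_div_iff₀ hb]
  gcongr

lemma lt_norm_radialHomeo (ha : 0 < a) (hab : a < b) (ha' : 0 < α) (hab' : α < β) {z : ℂ}
    (hz : b < ‖z‖) : β < ‖radialHomeo ha hab ha' hab' z‖ := by
  have hb : 0 < b := ha.trans hab
  have hb' : 0 < β := ha'.trans hab'
  rw [radialHomeo_of_ge ha hab ha' hab' hz.le, norm_mul, Complex.norm_real,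
    Real.norm_of_nonneg (by positivity), div_mul_eq_mul_div, lt_div_iff₀ hb]
  gcongr

lemma norm_radialHomeo_lt_iff (ha : 0 < a) (hab : a < b) (ha' : 0 < α) (hab' : α < β) {z : ℂ} :
    ‖radialHomeo ha hab ha' hab' z‖ < β ↔ ‖z‖ < b := by
  refine ⟨fun h => ?_, fun h => ?_⟩
  · by_contra! h'
    exact not_lt.2 (le_norm_radialHomeo ha hab ha' hab' h') h
  · by_contra! h'
    have := le_norm_radialHomeo ha' hab' ha hab h'
    rw [← radialHomeo_symm ha hab ha' hab', Homeomorph.symm_apply_apply] at this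
    exact not_lt.2 this h

lemma norm_radialHomeo_le_iff (ha : 0 < a) (hab : a < b) (ha' : 0 < α) (hab' : α < β) {z : ℂ} :
    ‖radialHomeo ha hab ha' hab' z‖ ≤ β ↔ ‖z‖ ≤ b := by
  refine ⟨fun h => ?_, fun h => ?_⟩
  · by_contra! h'
    exact not_le.2 (lt_norm_radialHomeo ha hab ha' hab' h') h
  · by_contra! h'
    have := lt_norm_radialHomeo ha' hab' ha hab h'
    rw [← radialHomeo_symm ha hab ha' hab', Homeomorph.symm_apply_apply] at this
    exact not_le.2 this h

end Radial

section Transplant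

open Classical in
/-- The map of the plane that is `r` in the chart `φ` (with inverse `ψ`) and the identity off the
domain of the chart. -/
noncomputable def transplant (φ ψ r : ℂ → ℂ) (R : ℝ) (v : ℂ) : ℂ :=
  if v ∈ φ '' ball 0 R then φ (r (ψ v)) else v

variable {φ ψ r : ℂ → ℂ} {R R₁ : ℝ}

lemma transplant_apply (hψ : ∀ z ∈ ball (0 : ℂ) R, ψ (φ z) = z) {z : ℂ} (hz : z ∈ ball 0 R) :
    transplant φ ψ r R (φ z) = φ (r z) := by
  rw [transplant, if_pos (mem_image_of_mem φ hz), hψ z hz]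

lemma transplant_of_notMem (hψ : ∀ z ∈ ball (0 : ℂ) R, ψ (φ z) = z)
    (hr : ∀ z, R₁ ≤ ‖z‖ → r z = z) {v : ℂ} (hv : v ∉ φ '' closedBall 0 R₁) :
    transplant φ ψ r R v = v := by
  by_cases h : v ∈ φ '' ball 0 R
  · obtain ⟨z, hz, rfl⟩ := h
    rw [transplant_apply hψ hz, hr]
    by_contra! h
    exact hv ⟨z, mem_closedBall_zero_iff.2 h.le, rfl⟩
  · rw [transplant, if_neg h]

lemma continuous_transplant (hR : R₁ < R) (hφ : ContinuousOn φ (ball 0 R))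
    (ho : IsOpen (φ '' ball 0 R)) (hψc : ContinuousOn ψ (φ '' ball 0 R))
    (hψ : ∀ z ∈ ball (0 : ℂ) R, ψ (φ z) = z) (hrc : Continuous r)
    (hr : ∀ z, R₁ ≤ ‖z‖ → r z = z) (hrm : MapsTo r (ball 0 R) (ball 0 R)) :
    Continuous (transplant φ ψ r R) := by
  have hK : IsClosed (φ '' closedBall 0 R₁) := ((isCompact_closedBall 0 R₁).image_of_continuousOn
    (hφ.mono (closedBall_subset_ball hR))).isClosed
  rw [continuous_iff_continuousAt]
  intro v
  by_cases hv : v ∈ φ '' ball 0 R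
  · have hc : ContinuousOn (transplant φ ψ r R) (φ '' ball 0 R) := by
      have hm : MapsTo ψ (φ '' ball 0 R) (ball 0 R) := by
        rintro - ⟨z, hz, rfl⟩; rwa [hψ z hz]
      refine (hφ.comp (hrc.comp_continuousOn hψc) (hrm.comp hm)).congr fun v hv => ?_
      rw [transplant, if_pos hv]; rfl
    exact hc.continuousAt (ho.mem_nhds hv)
  · have hv' : v ∉ φ '' closedBall 0 R₁ := fun h =>
      hv (image_mono (closedBall_subset_ball hR) h)
    have : transplant φ ψ r R =ᶠ[𝓝 v] id := by
      filter_upwards [hK.isOpen_compl.mem_nhds hv'] with w hw using transplant_of_notMem hψ hr hw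
    exact continuousAt_id.congr this.symm

lemma transplant_transplant (hψ : ∀ z ∈ ball (0 : ℂ) R, ψ (φ z) = z) {r' : ℂ → ℂ}
    (hrm : MapsTo r (ball 0 R) (ball 0 R)) (hrr : ∀ z, r' (r z) = z) (v : ℂ) :
    transplant φ ψ r' R (transplant φ ψ r R v) = v := by
  by_cases hv : v ∈ φ '' ball 0 R
  · obtain ⟨z, hz, rfl⟩ := hv
    rw [transplant_apply hψ hz, transplant_apply hψ (hrm hz), hrr]
  · have h : ∀ r, transplant φ ψ r R v = v := fun r => by rw [transplant, if_neg hv]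
    rw [h, h]

lemma exists_homeomorph_transplant (hR : R₁ < R) (hφ : ContinuousOn φ (ball 0 R))
    (ho : IsOpen (φ '' ball 0 R)) (hψc : ContinuousOn ψ (φ '' ball 0 R))
    (hψ : ∀ z ∈ ball (0 : ℂ) R, ψ (φ z) = z) (r : ℂ ≃ₜ ℂ) (hr : ∀ z, R₁ ≤ ‖z‖ → r z = z) :
    ∃ q : ℂ ≃ₜ ℂ, (∀ z ∈ ball (0 : ℂ) R, q (φ z) = φ (r z)) ∧
      ∀ v ∉ φ '' closedBall 0 R₁, q v = v := by
  have hr' : ∀ z, R₁ ≤ ‖z‖ → r.symm z = z := fun z hz => by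
    rw [Homeomorph.symm_apply_eq, hr z hz]
  have hm : ∀ r : ℂ ≃ₜ ℂ, (∀ z, R₁ ≤ ‖z‖ → r z = z) → MapsTo r (ball 0 R) (ball 0 R) := by
    intro r hr z hz
    by_contra h
    have h1 : R ≤ ‖r z‖ := not_lt.1 fun h' => h (mem_ball_zero_iff.2 h')
    have h2 := r.injective (hr _ (hR.le.trans h1))
    rw [h2] at h1
    exact not_lt.2 h1 (mem_ball_zero_iff.1 hz)
  exact ⟨{
    toFun := transplant φ ψ r R
    invFun := transplant φ ψ r.symm R
    left_inv := transplant_transplant hψ (hm r hr) r.symm_apply_apply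
    right_inv := transplant_transplant hψ (hm _ hr') r.apply_symm_apply
    continuous_toFun := continuous_transplant hR hφ ho hψc hψ r.continuous hr (hm r hr)
    continuous_invFun := continuous_transplant hR hφ ho hψc hψ r.symm.continuous hr' (hm _ hr') },
    fun z hz => transplant_apply hψ hz, fun v hv => transplant_of_notMem hψ hr hv⟩

end Transplant

section Linearize

/-- A map with derivative `a ≠ 0` at the fixed point `0` agrees near `0` with a homeomorphism of the
plane that is linear away from `0`. -/
lemma exists_homeomorph_linearize {e : ℂ → ℂ} {U : Set ℂ} (hU : U ∈ 𝓝 (0 : ℂ))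
    (he : DifferentiableOn ℂ e U) (he0 : e 0 = 0) (hd : deriv e 0 ≠ 0) {T : ℝ} (hT : 0 < T) :
    ∃ t ∈ Ioo 0 T, ∃ Q : ℂ ≃ₜ ℂ, (∀ z, ‖z‖ ≤ t → Q z = e z) ∧
      ∀ z, T ≤ ‖z‖ → Q z = deriv e 0 * z := by
  set a := deriv e 0
  set N : ℂ → ℂ := fun z => a⁻¹ * e z - z with hN
  have hea : AnalyticAt ℂ e 0 := he.analyticAt hU
  have hstrict : HasStrictDerivAt N 0 0 := by
    have h := (hea.hasStrictDerivAt.const_mul a⁻¹).sub (hasStrictDerivAt_id 0)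
    rwa [inv_mul_cancel₀ hd, sub_self] at h
  have hlip := hstrict.hasStrictFDerivAt.exists_lipschitzOnWith_of_nnnorm_lt (1 / 8) (by
    simp)
  obtain ⟨s, hs, hsl⟩ := hlip
  obtain ⟨δ, hδ, hδs⟩ := Metric.mem_nhds_iff.1 hs
  obtain ⟨t, ht0, htT, htδ⟩ : ∃ t : ℝ, 0 < t ∧ 2 * t < T ∧ 2 * t < δ :=
    ⟨min T δ / 4, by positivity, by linarith [min_le_left T δ, lt_min hT hδ],
      by linarith [min_le_right T δ, lt_min hT hδ]⟩
  have hNl : ∀ z, ‖z‖ ≤ 2 * t → ∀ w, ‖w‖ ≤ 2 * t → ‖N z - N w‖ ≤ 1 / 8 * ‖z - w‖ :=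
    fun z hz w hw => by
      have := hsl.dist_le_mul z (hδs (mem_ball_zero_iff.2 (hz.trans_lt htδ))) w
        (hδs (mem_ball_zero_iff.2 (hw.trans_lt htδ)))
      simpa [dist_eq_norm] using this
  have hN0 : N 0 = 0 := by simp [hN, he0]
  have hNb : ∀ z, ‖z‖ ≤ 2 * t → ‖N z‖ ≤ t / 4 := fun z hz => by
    have := hNl z hz 0 (by simp; positivity)
    rw [hN0, sub_zero, sub_zero] at this
    linarith
  set c : ℂ → ℝ := fun z => max 0 (min 1 (2 - ‖z‖ / t)) with hc
  have hcl : ∀ z w, |c z - c w| ≤ ‖z - w‖ / t := fun z w => by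
    refine (abs_max_sub_max_le_max _ _ _ _).trans (max_le (by simp; positivity) ?_)
    refine (abs_min_sub_min_le_max _ _ _ _).trans (max_le (by simp; positivity) ?_)
    rw [sub_sub_sub_cancel_left, ← sub_div, abs_div, abs_of_pos ht0]
    gcongr
    rw [norm_sub_rev]
    exact abs_norm_sub_norm_le w z
  have hc0 : ∀ z, 2 * t ≤ ‖z‖ → c z = 0 := fun z hz => by
    have : 2 - ‖z‖ / t ≤ 0 := by rw [sub_nonpos, le_div_iff₀ ht0]; exact hz
    exact max_eq_left ((min_le_right _ _).trans this)
  have hc1 : ∀ z, ‖z‖ ≤ t → c z = 1 := fun z hz => by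
    have : 1 ≤ 2 - ‖z‖ / t := by
      have : ‖z‖ / t ≤ 1 := (div_le_one ht0).2 hz
      linarith
    simp only [hc]
    rw [min_eq_left this, max_eq_right zero_le_one]
  have hcn : ∀ z, |c z| ≤ 1 := fun z => by
    rw [abs_of_nonneg (le_max_left _ _)]
    exact max_le zero_le_one (min_le_left _ _)
  have hin : ∀ z w, ‖w‖ ≤ 2 * t → ‖(c z : ℂ) * N z - c w * N w‖ ≤ 1 / 2 * ‖z - w‖ := by
    intro z w hw
    have h2 : ‖((c z - c w : ℝ) : ℂ) * N w‖ ≤ ‖z - w‖ / t * (t / 4) := by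
      rw [norm_mul, Complex.norm_real]
      exact mul_le_mul (hcl z w) (hNb w hw) (norm_nonneg _) (by positivity)
    have h3 : ‖z - w‖ / t * (t / 4) = ‖z - w‖ / 4 := by field_simp
    have h1 : ‖(c z : ℂ) * (N z - N w)‖ ≤ 1 / 8 * ‖z - w‖ := by
      rcases le_total (2 * t) ‖z‖ with hz | hz
      · rw [hc0 z hz, Complex.ofReal_zero, zero_mul, norm_zero]; positivity
      · rw [norm_mul, Complex.norm_real]
        calc ‖c z‖ * ‖N z - N w‖ ≤ 1 * (1 / 8 * ‖z - w‖) :=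
              mul_le_mul (hcn z) (hNl z hz w hw) (norm_nonneg _) zero_le_one
          _ = _ := one_mul _
    have h4 : (c z : ℂ) * N z - c w * N w =
        (c z : ℂ) * (N z - N w) + ((c z - c w : ℝ) : ℂ) * N w := by push_cast; ring
    rw [h4]
    refine (norm_add_le _ _).trans ?_
    linarith [norm_nonneg (z - w)]
  have hall : ∀ z w, ‖(c z : ℂ) * N z - c w * N w‖ ≤ 1 / 2 * ‖z - w‖ := fun z w => by
    rcases le_total ‖w‖ (2 * t) with hw | hw
    · exact hin z w hw
    rcases le_total ‖z‖ (2 * t) with hz | hz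
    · rw [norm_sub_rev, norm_sub_rev z]; exact hin w z hz
    · rw [hc0 z hz, hc0 w hw]; simp
  have happ : ApproximatesLinearOn (fun z => z + (c z : ℂ) * N z)
      ((ContinuousLinearEquiv.refl ℂ ℂ : ℂ ≃L[ℂ] ℂ) : ℂ →L[ℂ] ℂ) univ (1 / 2) := by
    intro z _ w _
    have h : z + (c z : ℂ) * N z - (w + c w * N w) -
        ((ContinuousLinearEquiv.refl ℂ ℂ : ℂ ≃L[ℂ] ℂ) : ℂ →L[ℂ] ℂ) (z - w) =
        (c z : ℂ) * N z - c w * N w := by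
      simp only [ContinuousLinearEquiv.coe_refl, ContinuousLinearMap.id_apply]
      ring
    rw [h]
    simpa using hall z w
  let Q₀ : ℂ ≃ₜ ℂ := happ.toHomeomorph _ (Or.inr (by
    have : ‖((ContinuousLinearEquiv.refl ℂ ℂ).symm : ℂ →L[ℂ] ℂ)‖₊ = 1 := by
      simp [ContinuousLinearEquiv.coe_refl]
    rw [this, inv_one]
    exact NNReal.half_lt_self one_ne_zero))
  have hQ₀ : ∀ z, Q₀ z = z + (c z : ℂ) * N z := fun z => rfl
  refine ⟨t, ⟨ht0, by linarith⟩, Q₀.trans (Homeomorph.mulLeft₀ a hd), fun z hz => ?_,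
    fun z hz => ?_⟩
  · rw [Homeomorph.trans_apply, hQ₀, hc1 z hz, Homeomorph.coe_mulLeft₀]
    simp only [hN, Complex.ofReal_one, one_mul, add_sub_cancel, mul_inv_cancel_left₀ hd]
  · rw [Homeomorph.trans_apply, hQ₀, hc0 z (by linarith), Homeomorph.coe_mulLeft₀]
    simp

end Linearize

section Annulus

lemma norm_lt_one_iff_of_linear_off {Q : ℂ ≃ₜ ℂ} {a : ℂ} (ha : a ≠ 0) {T : ℝ} (hT : T ≤ ‖a‖⁻¹)
    (hQ : ∀ z, T ≤ ‖z‖ → Q z = a * z) (z : ℂ) :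
    (‖Q z‖ < 1 ↔ ‖z‖ < ‖a‖⁻¹) ∧ (‖Q z‖ ≤ 1 ↔ ‖z‖ ≤ ‖a‖⁻¹) := by
  have ha' : 0 < ‖a‖ := norm_pos_iff.2 ha
  have h1 : ∀ z, ‖a‖⁻¹ ≤ ‖z‖ → ‖Q z‖ = ‖a‖ * ‖z‖ := fun z hz => by
    rw [hQ z (hT.trans hz), norm_mul]
  have h2 : 1 ≤ ‖Q z‖ → ‖Q z‖ = ‖a‖ * ‖z‖ ∧ ‖a‖⁻¹ ≤ ‖z‖ := fun h => by
    have hw : ‖a‖⁻¹ ≤ ‖a⁻¹ * Q z‖ := by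
      rw [norm_mul, norm_inv]
      exact le_mul_of_one_le_right (by positivity) h
    have h3 := hQ _ (hT.trans hw)
    rw [mul_inv_cancel_left₀ ha] at h3
    have h4 := Q.injective h3
    rw [h4] at hw
    exact ⟨h1 z hw, hw⟩
  constructor
  · refine ⟨fun h => ?_, fun h => ?_⟩
    · by_contra! h'
      have := h1 z h'
      rw [inv_le_iff_one_le_mul₀' ha'] at h'
      linarith
    · by_contra! h'
      exact not_lt.2 (h2 h').2 h
  · refine ⟨fun h => ?_, fun h => ?_⟩
    · by_contra! h'
      have := h1 z h'.le
      rw [inv_lt_iff_one_lt_mul₀' ha'] at h'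
      linarith
    · by_contra! h'
      have h3 := (h2 h'.le).1
      rw [← mul_one ‖a‖⁻¹, le_inv_mul_iff₀ ha'] at h
      linarith

lemma deriv_ne_zero_of_leftInverse {f g : ℂ → ℂ} {x : ℂ} (hf : DifferentiableAt ℂ f x)
    (hg : DifferentiableAt ℂ g (f x)) (h : ∀ᶠ z in 𝓝 x, g (f z) = z) : deriv f x ≠ 0 := by
  intro h0
  have h1 := hg.hasDerivAt.comp x hf.hasDerivAt
  have h2 : HasDerivAt (g ∘ f) 1 x := (hasDerivAt_id x).congr_of_eventuallyEq h
  have := h1.unique h2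
  rw [h0, mul_zero] at this
  exact zero_ne_one this

lemma image_eq_of_forall_notMem {X : Type*} [TopologicalSpace X] (q : X ≃ₜ X) {J : Set X}
    (h : ∀ v ∉ J, q v = v) : q '' J = J := by
  have hm : ∀ v ∈ J, q v ∈ J := fun v hv => by
    by_contra hn
    have := q.injective (h _ hn)
    rw [this] at hn
    exact hn hv
  refine subset_antisymm (image_subset_iff.2 hm) fun v hv => ?_
  obtain ⟨w, rfl⟩ := q.surjective v
  refine ⟨w, ?_, rfl⟩
  by_contra hn
  rw [h w hn] at hv
  exact hn hv

/-- The region between an analytic disc `φ(𝔻)` and its image under a homeomorphism containing its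
closure is a round annulus. -/
theorem exists_disc_extension {φ ψ : ℂ → ℂ} {R s : ℝ} (hR : 1 < R) (hs : 1 < s)
    (hφ : DifferentiableOn ℂ φ (ball 0 R)) (ho : IsOpen (φ '' ball 0 R))
    (hψd : DifferentiableOn ℂ ψ (φ '' ball 0 R)) (hψ : ∀ z ∈ ball (0 : ℂ) R, ψ (φ z) = z)
    (hφ0 : φ 0 = 0) (Φ : ℂ ≃ₜ ℂ) (hΦ0 : Φ 0 = 0)
    (hsub : φ '' closedBall 0 1 ⊆ Φ '' (φ '' ball 0 1)) :
    ∃ K : ℂ → ℂ, ContinuousOn K (closedBall 0 s) ∧ InjOn K (closedBall 0 s) ∧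
      (∀ z ∈ closedBall (0 : ℂ) 1, K z = φ z) ∧ K '' ball 0 s = Φ '' (φ '' ball 0 1) ∧
      K '' closedBall 0 s = Φ '' (φ '' closedBall 0 1) := by
  have hb1R : closedBall (0 : ℂ) 1 ⊆ ball 0 R := closedBall_subset_ball hR
  have hbb : ball (0 : ℂ) 1 ⊆ ball 0 R := ball_subset_ball hR.le
  have hinj : InjOn φ (ball 0 R) := fun x hx y hy h => by rw [← hψ x hx, h, hψ y hy]
  set J := Φ '' (φ '' ball 0 1) with hJ
  set E := Φ '' (φ '' closedBall 0 1) with hE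
  have hJE : J ⊆ E := image_mono (image_mono ball_subset_closedBall)
  have hO1 : IsOpen (φ '' ball 0 1) := by
    have : φ '' ball 0 1 = φ '' ball 0 R ∩ ψ ⁻¹' ball 0 1 := by
      ext v
      constructor
      · rintro ⟨z, hz, rfl⟩
        exact ⟨⟨z, hbb hz, rfl⟩, by rwa [mem_preimage, hψ z (hbb hz)]⟩
      · rintro ⟨⟨z, hz, rfl⟩, hz'⟩
        rw [mem_preimage, hψ z hz] at hz'
        exact ⟨z, hz', rfl⟩
    rw [this]
    exact hψd.continuousOn.isOpen_inter_preimage ho isOpen_ball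
  have hJo : IsOpen J := Φ.isOpenMap _ hO1
  set c : ℂ → ℂ := fun z => Φ (φ z) with hc
  have hcc : ContinuousOn c (closedBall 0 1) :=
    Φ.continuous.comp_continuousOn (hφ.continuousOn.mono hb1R)
  have hcinj : InjOn c (closedBall 0 1) := fun x hx y hy h =>
    hinj (hb1R hx) (hb1R hy) (Φ.injective h)
  have hcJ : c '' ball 0 1 = J := by rw [hJ, image_image]
  have hcE : c '' closedBall 0 1 = E := by rw [hE, image_image]
  have hEc : IsCompact E := hcE ▸ (isCompact_closedBall 0 1).image_of_continuousOn hcc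
  have hJb : Bornology.IsBounded J := hEc.isBounded.subset hJE
  have h0J : (0 : ℂ) ∈ J := ⟨0, ⟨0, mem_ball_self one_pos, hφ0⟩, hΦ0⟩
  have hJconn : IsConnected J := by
    rw [← hcJ]
    exact ((convex_ball (0 : ℂ) 1).isConnected ⟨0, mem_ball_self one_pos⟩).image c
      (hcc.mono ball_subset_closedBall)
  have hJlog : HasAllLogs J := by
    refine (hasAllLogs_ball (0 : ℂ) one_pos).image (f := c) (g := fun v => ψ (Φ.symm v))
      (hcc.mono ball_subset_closedBall) ?_ ?_ ?_ ?_
    · refine hψd.continuousOn.comp Φ.symm.continuous.continuousOn ?_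
      rintro - ⟨v, hv, rfl⟩
      rw [Homeomorph.symm_apply_apply]
      exact image_mono hbb hv
    · exact fun z hz => hcJ ▸ mem_image_of_mem c hz
    · rintro - ⟨-, ⟨z, hz, rfl⟩, rfl⟩
      simp only [Homeomorph.symm_apply_apply, hψ z (hbb hz)]
      exact hz
    · rintro - ⟨-, ⟨z, hz, rfl⟩, rfl⟩
      simp only [Homeomorph.symm_apply_apply, hψ z (hbb hz), hc]
  obtain ⟨f, g, hf, hg, hfm, hgm, hgf, hfg, hf0, hg0⟩ := exists_riemann_map hJo hJconn hJb h0J hJlog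
  have hgJ : g '' ball 0 1 = J := subset_antisymm hgm.image_subset fun v hv =>
    ⟨f v, hfm hv, hgf v hv⟩
  obtain ⟨κ, hκc, hκi, hκK, hκb, hκs, hcκ⟩ := exists_caratheodory_extension hg
    (hgJ ▸ hf.continuousOn) hfg hcc hcinj (hcJ.trans hgJ.symm)
  have hκB : κ '' ball 0 1 = ball 0 1 := by
    refine subset_antisymm hκb.image_subset fun w hw => ?_
    have : w ∈ κ '' closedBall 0 1 := by
      rw [hκK]
      exact ball_subset_closedBall hw
    obtain ⟨z, hz, rfl⟩ := this
    rw [← ball_union_sphere] at hz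
    rcases hz with hz | hz
    · exact ⟨z, hz, rfl⟩
    · exact ((mem_ball.1 hw).ne (mem_sphere.1 (hκs hz))).elim
  -- the germ of `φ` in the conformal coordinate of `J`
  have hφJ : MapsTo φ (ball 0 1) J := fun z hz =>
    hsub (mem_image_of_mem φ (ball_subset_closedBall hz))
  set e : ℂ → ℂ := fun z => f (φ z) with he
  have hed : DifferentiableOn ℂ e (ball 0 1) := hf.comp (hφ.mono hbb) hφJ
  have hb0 : ball (0 : ℂ) 1 ∈ 𝓝 (0 : ℂ) := ball_mem_nhds 0 one_pos
  have he0 : e 0 = 0 := by simp only [he, hφ0, hf0]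
  have hda : deriv e 0 ≠ 0 := by
    refine deriv_ne_zero_of_leftInverse (g := fun w => ψ (g w)) (hed.differentiableAt hb0) ?_ ?_
    · rw [he0]
      refine DifferentiableAt.comp 0 (hψd.differentiableAt ?_) (hg.differentiableAt hb0)
      rw [hg0]
      exact ho.mem_nhds ⟨0, mem_ball_self (one_pos.trans hR), hφ0⟩
    · filter_upwards [hb0] with z hz
      simp only [he, hgf _ (hφJ hz), hψ z (hbb hz)]
  have ha : 0 < ‖deriv e 0‖ := norm_pos_iff.2 hda
  obtain ⟨t, ⟨ht0, htT⟩, Q, hQt, hQT⟩ := exists_homeomorph_linearize hb0 hed he0 hda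
    (T := min 1 ‖deriv e 0‖⁻¹) (by positivity)
  have ht1 : t < 1 := htT.trans_le (min_le_left _ _)
  have htb : t < ‖deriv e 0‖⁻¹ := htT.trans_le (min_le_right _ _)
  have hQn := norm_lt_one_iff_of_linear_off hda (min_le_right _ _) hQT
  -- the radial push
  obtain ⟨R₁, hR₁, hR₁R, hR₁J⟩ : ∃ R₁, 1 < R₁ ∧ R₁ < R ∧ φ '' closedBall 0 R₁ ⊆ J := by
    have hop : IsOpen (ball 0 R ∩ φ ⁻¹' J) := hφ.continuousOn.isOpen_inter_preimage isOpen_ball hJo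
    obtain ⟨δ, hδ, hδs⟩ := (isCompact_closedBall (0 : ℂ) 1).exists_cthickening_subset_open hop
      (fun z hz => ⟨hb1R hz, hsub (mem_image_of_mem φ hz)⟩)
    rw [cthickening_closedBall hδ.le zero_le_one] at hδs
    refine ⟨1 + δ, by linarith, ?_, ?_⟩
    · have : ((1 + δ : ℝ) : ℂ) ∈ ball (0 : ℂ) R := by
        refine (hδs ?_).1
        rw [mem_closedBall_zero_iff, Complex.norm_real, Real.norm_of_nonneg (by linarith), add_comm]
      rwa [mem_ball_zero_iff, Complex.norm_real, Real.norm_of_nonneg (by linarith)] at this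
    · rintro - ⟨z, hz, rfl⟩
      rw [add_comm] at hz
      exact (hδs hz).2
  obtain ⟨q, hqφ, hqid⟩ := exists_homeomorph_transplant hR₁R hφ.continuousOn ho hψd.continuousOn hψ
    (radialHomeo ht0 (ht1.trans hR₁) one_pos hR₁) (fun z hz => by
      rw [radialHomeo_of_ge _ _ _ _ hz, div_self (one_pos.trans hR₁).ne', Complex.ofReal_one,
        one_mul])
  have hqJ : q '' J = J := image_eq_of_forall_notMem q fun v hv => hqid v fun h => hv (hR₁J h)
  have hqE : q '' E = E := image_eq_of_forall_notMem q fun v hv =>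
    hqid v fun h => hv (hJE (hR₁J h))
  set h := radialHomeo one_pos hs ht0 htb
  set Qh : ℂ ≃ₜ ℂ := h.trans Q
  have hball : ∀ w, Qh w ∈ ball (0 : ℂ) 1 ↔ w ∈ ball (0 : ℂ) s := fun w => by
    rw [mem_ball_zero_iff, mem_ball_zero_iff]
    exact (hQn (h w)).1.trans (norm_radialHomeo_lt_iff one_pos hs ht0 htb)
  have hcball : ∀ w, Qh w ∈ closedBall (0 : ℂ) 1 ↔ w ∈ closedBall (0 : ℂ) s := fun w => by
    rw [mem_closedBall_zero_iff, mem_closedBall_zero_iff]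
    exact (hQn (h w)).2.trans (norm_radialHomeo_le_iff one_pos hs ht0 htb)
  have himb : Qh '' ball 0 s = ball 0 1 := by
    have : ball (0 : ℂ) s = Qh ⁻¹' ball 0 1 := by ext w; exact (hball w).symm
    rw [this, image_preimage_eq _ Qh.surjective]
  have himc : Qh '' closedBall 0 s = closedBall 0 1 := by
    have : closedBall (0 : ℂ) s = Qh ⁻¹' closedBall 0 1 := by ext w; exact (hcball w).symm
    rw [this, image_preimage_eq _ Qh.surjective]
  have hκm : MapsTo κ (closedBall 0 1) (closedBall 0 1) := fun z hz =>
    hκK ▸ mem_image_of_mem κ hz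
  refine ⟨fun w => q (c (κ (Qh w))), ?_, ?_, ?_, ?_, ?_⟩
  · exact q.continuous.comp_continuousOn ((hcc.comp hκc hκm).comp Qh.continuous.continuousOn
      fun w hw => (hcball w).2 hw)
  · intro x hx y hy hxy
    have hx' := (hcball x).2 hx
    have hy' := (hcball y).2 hy
    exact Qh.injective (hκi hx' hy' (hcinj (hκm hx') (hκm hy') (q.injective hxy)))
  · intro w hw
    have hw1 := mem_closedBall_zero_iff.1 hw
    have htw : ‖(t : ℂ) * w‖ ≤ t := by
      rw [norm_mul, Complex.norm_real, Real.norm_of_nonneg ht0.le]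
      exact mul_le_of_le_one_right ht0.le hw1
    have htw1 : (t : ℂ) * w ∈ ball (0 : ℂ) 1 := mem_ball_zero_iff.2 (htw.trans_lt ht1)
    have e1 : Qh w = e (t * w) := by
      change Q (h w) = _
      rw [radialHomeo_of_le one_pos hs ht0 htb hw1, div_one, hQt _ htw]
    have e2 : c (κ (Qh w)) = φ (t * w) := by
      rw [e1, hcκ _ (hfm (hφJ htw1)), hgf _ (hφJ htw1)]
    simp only [e2]
    rw [hqφ _ (hbb htw1), radialHomeo_of_le _ _ _ _ htw, ← mul_assoc, ← Complex.ofReal_mul,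
      one_div_mul_cancel ht0.ne', Complex.ofReal_one, one_mul]
  · rw [← image_image q, ← image_image c, ← image_image κ, himb, hκB, hcJ, hqJ]
  · rw [← image_image q, ← image_image c, ← image_image κ, himc, hκK, hcE, hqE]

end Annulus

/-! ### An analytic disc absorbed by the homeomorphism -/

section AttractingDisc

lemma hasAllLogs_connectedComponentIn {V : Set ℂ} (hV : IsOpen V) (hb : Bornology.IsBounded V)
    {x : ℂ} (hx : x ∈ V) (h : ∀ a ∉ V, HasLogOn (fun z => z - a) V) :
    HasAllLogs (connectedComponentIn V x) := by
  have hsub := connectedComponentIn_subset V x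
  refine hasAllLogs_of_forall_notMem hV.connectedComponentIn
    (isConnected_connectedComponentIn_iff.2 hx) (hb.subset hsub) fun a ha => ?_
  by_cases haV : a ∉ V
  · exact (h a haV).mono hsub
  rw [not_not] at haV
  set S : Set ℝ := {t | 0 ≤ t ∧ a + (t : ℂ) ∉ V} with hS
  have hcont : Continuous fun t : ℝ => a + (t : ℂ) := by fun_prop
  have hSc : IsClosed S := isClosed_Ici.inter (hV.isClosed_compl.preimage hcont)
  have hSne : S.Nonempty := by
    obtain ⟨M, hM⟩ := hb.exists_norm_le
    refine ⟨M + 1 + ‖a‖, ?_, fun hmem => ?_⟩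
    · have := (norm_nonneg a).trans (hM a haV)
      positivity
    · have h1 := hM _ hmem
      have h2 := (norm_nonneg a).trans (hM a haV)
      have h3 := norm_sub_le (a + ((M + 1 + ‖a‖ : ℝ) : ℂ)) a
      rw [add_sub_cancel_left, Complex.norm_real, Real.norm_of_nonneg (by positivity)] at h3
      linarith
  have hSb : BddBelow S := ⟨0, fun t ht => ht.1⟩
  set t₀ := sInf S
  obtain ⟨ht0, ht0V⟩ : t₀ ∈ S := hSc.csInf_mem hSne hSb
  have hseg : ∀ t, 0 ≤ t → t < t₀ → a + (t : ℂ) ∉ connectedComponentIn V x := by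
    intro t ht htt hmem
    have hpre : IsPreconnected ((fun t : ℝ => a + (t : ℂ)) '' Icc 0 t) :=
      isPreconnected_Icc.image _ hcont.continuousOn
    have hsV : (fun t : ℝ => a + (t : ℂ)) '' Icc 0 t ⊆ V := by
      rintro - ⟨u, hu, rfl⟩
      by_contra hn
      exact ((csInf_le hSb (show u ∈ S from ⟨hu.1, hn⟩)).trans hu.2).not_gt htt
    have := hpre.subset_connectedComponentIn (mem_image_of_mem _ (right_mem_Icc.2 ht)) hsV
    rw [← connectedComponentIn_eq hmem] at this
    exact ha (this ⟨0, left_mem_Icc.2 ht, by simp⟩)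
  have hlog := (h _ ht0V).mono hsub
  have hq : HasLogOn (fun z => (z - a) / (z - (a + (t₀ : ℂ)))) (connectedComponentIn V x) := by
    refine HasLogOn.of_slitPlane ?_ ?_
    · exact (by fun_prop : Continuous fun z : ℂ => z - a).continuousOn.div
        (by fun_prop) fun z hz => hlog.ne_zero hz
    · intro z hz
      by_contra hn
      rw [Complex.mem_slitPlane_iff, not_or, not_lt, not_not] at hn
      obtain ⟨c, hc0, hc⟩ : ∃ c : ℝ, c ≤ 0 ∧ (z - a) / (z - (a + (t₀ : ℂ))) = c :=
        ⟨_, hn.1, Complex.ext (by simp) (by simpa using hn.2)⟩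
      have hne := hlog.ne_zero hz
      rw [div_eq_iff hne] at hc
      have hc1 : (1 - c) ≠ 0 := by linarith
      have hc1' : (1 - c : ℂ) ≠ 0 := by exact_mod_cast hc1
      have hpos : 0 < 1 - c := by linarith
      have hz' : z = a + ((-c / (1 - c) * t₀ : ℝ) : ℂ) := by
        push_cast
        field_simp
        linear_combination hc
      have ht0' : 0 < t₀ := by
        refine ht0.lt_of_ne fun h0 => ?_
        rw [← h0] at ht0V
        simp at ht0V
        exact ht0V haV
      rw [hz'] at hz
      refine hseg _ ?_ ?_ hz
      · exact mul_nonneg (div_nonneg (by linarith) hpos.le) ht0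
      · refine mul_lt_of_lt_one_left ht0' ?_
        rw [div_lt_one hpos]
        linarith
  refine (hq.mul hlog).congr fun z hz => ?_
  rw [div_mul_cancel₀ _ (hlog.ne_zero hz)]

theorem exists_absorbed_disc (Φ : ℂ ≃ₜ ℂ) (hΦ0 : Φ 0 = 0) {p : ℕ} (hp : 0 < p) {s : ℝ}
    (hs : 1 < s) (hΦp : ∀ w, Φ^[p] w = (s : ℂ) ^ p * w) :
    ∃ (φ ψ : ℂ → ℂ) (R : ℝ), 1 < R ∧ DifferentiableOn ℂ φ (ball 0 R) ∧
      IsOpen (φ '' ball 0 R) ∧ DifferentiableOn ℂ ψ (φ '' ball 0 R) ∧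
      (∀ z ∈ ball 0 R, ψ (φ z) = z) ∧ φ 0 = 0 ∧
      φ '' closedBall 0 1 ⊆ Φ '' (φ '' ball 0 1) := by
  have hs0 : 0 < s := one_pos.trans hs
  have hinv : ∀ k z, Φ.symm^[k] (Φ^[k] z) = z := fun k =>
    (Function.LeftInverse.iterate Φ.symm_apply_apply k)
  have hinv' : ∀ k z, Φ^[k] (Φ.symm^[k] z) = z := fun k =>
    (Function.LeftInverse.iterate Φ.apply_symm_apply k)
  have hsc : ∀ k, Continuous Φ.symm^[k] := fun k => Φ.symm.continuous.iterate k
  have hΦc : ∀ k, Continuous Φ^[k] := fun k => Φ.continuous.iterate k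
  have hsymm0 : Φ.symm 0 = 0 := by rw [Homeomorph.symm_apply_eq, hΦ0]
  have hsymmp : ∀ w, Φ.symm^[p] w = w / (s : ℂ) ^ p := fun w => by
    have h1 := hinv' p w
    rw [hΦp] at h1
    rw [eq_div_iff (pow_ne_zero _ (by exact_mod_cast hs0.ne')), mul_comm, h1]
  set V : Set ℂ := {z | ∀ k < p, ‖Φ.symm^[k] z‖ < (s ^ k)⁻¹} with hVdef
  have hVo : IsOpen V := by
    have : V = ⋂ k ∈ Finset.range p, {z | ‖Φ.symm^[k] z‖ < (s ^ k)⁻¹} := by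
      ext z
      simp [hVdef]
    rw [this]
    exact isOpen_biInter_finset fun k _ => isOpen_lt (hsc k).norm continuous_const
  have hVle : ∀ z ∈ closure V, ∀ k < p, ‖Φ.symm^[k] z‖ ≤ (s ^ k)⁻¹ := fun z hz k hk =>
    closure_minimal (fun w hw => (hw k hk).le) (isClosed_le (hsc k).norm continuous_const) hz
  have hVb : Bornology.IsBounded V := (isBounded_ball (x := (0 : ℂ)) (r := 1)).subset fun z hz => by
    have := hz 0 hp
    simpa using this
  have h0V : (0 : ℂ) ∈ V := fun k _ => by
    rw [Function.iterate_fixed hsymm0, norm_zero]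
    positivity
  have hVsymm : ∀ z ∈ closure V, Φ.symm z ∈ V := by
    intro z hz k hk
    rw [← Function.iterate_succ_apply]
    have hlt : (s ^ (k + 1))⁻¹ < (s ^ k)⁻¹ :=
      inv_strictAnti₀ (by positivity) (pow_lt_pow_right₀ hs k.lt_succ_self)
    rcases (Nat.succ_le_of_lt hk).lt_or_eq with h | h
    · exact (hVle z hz _ h).trans_lt hlt
    · have h1 := hVle z hz 0 hp
      rw [h, hsymmp, norm_div, norm_pow, Complex.norm_real, Real.norm_of_nonneg hs0.le, ← h]
      refine lt_of_le_of_lt ?_ hlt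
      rw [div_eq_mul_inv]
      exact mul_le_of_le_one_left (by positivity) (by simpa using h1)
  set Ω := connectedComponentIn V 0 with hΩdef
  have hsub : Ω ⊆ V := connectedComponentIn_subset V 0
  have hΩo : IsOpen Ω := hVo.connectedComponentIn
  have hΩc : IsConnected Ω := isConnected_connectedComponentIn_iff.2 h0V
  have h0Ω : (0 : ℂ) ∈ Ω := mem_connectedComponentIn h0V
  have hΩb : Bornology.IsBounded Ω := hVb.subset hsub
  have habs : ∀ z ∈ closure Ω, Φ.symm z ∈ Ω := by
    have : Φ.symm '' closure Ω ⊆ Ω := by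
      refine (hΩc.closure.isPreconnected.image _ Φ.symm.continuous.continuousOn)
        |>.subset_connectedComponentIn ⟨0, subset_closure h0Ω, hsymm0⟩ ?_
      rintro - ⟨z, hz, rfl⟩
      exact hVsymm z (closure_mono hsub hz)
    exact fun z hz => this (mem_image_of_mem _ hz)
  have hlogs : HasAllLogs Ω := by
    refine hasAllLogs_connectedComponentIn hVo hVb h0V fun a ha => ?_
    obtain ⟨k, hk, hka⟩ : ∃ k < p, (s ^ k)⁻¹ ≤ ‖Φ.symm^[k] a‖ := by
      by_contra! hn
      exact ha hn
    have hball := hasAllLogs_ball (0 : ℂ) (r := (s ^ k)⁻¹) (by positivity)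
    have hlog := hball (fun z => Φ^[k] z - a) ((hΦc k).continuousOn.sub continuousOn_const)
      fun z hz h0 => by
        rw [← sub_eq_zero.1 h0, hinv] at hka
        exact hka.not_gt (mem_ball_zero_iff.1 hz)
    refine (hlog.comp (r := V) (g := Φ.symm^[k]) (hsc k).continuousOn
      (fun z hz => mem_ball_zero_iff.2 (hz k hk))).congr fun z _ => ?_
    simp only [hinv']
  obtain ⟨f, g, hf, hg, hfm, hgm, hgf, hfg, hf0, hg0⟩ := exists_riemann_map hΩo hΩc hΩb h0Ω hlogs
  have hcpt : IsCompact (Φ.symm '' closure Ω) :=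
    (isCompact_of_isClosed_isBounded isClosed_closure hΩb.closure).image Φ.symm.continuous
  obtain ⟨r, hr0, hr1, hr⟩ : ∃ r : ℝ, 0 < r ∧ r < 1 ∧ ∀ z ∈ closure Ω, ‖f (Φ.symm z)‖ < r := by
    obtain ⟨w, hw, hmax⟩ := hcpt.exists_isMaxOn ((closure_nonempty_iff.2 ⟨0, h0Ω⟩).image _)
      (f := fun z => ‖f z‖) (hf.continuousOn.norm.mono (image_subset_iff.2 habs))
    obtain ⟨v, hv, rfl⟩ := hw
    have h1 : ‖f (Φ.symm v)‖ < 1 := mem_ball_zero_iff.1 (hfm (habs v hv))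
    obtain ⟨r, hr, hr1⟩ := exists_between h1
    exact ⟨r, (norm_nonneg _).trans_lt hr, hr1, fun z hz =>
      (hmax (mem_image_of_mem _ hz)).trans_lt hr⟩
  have hrc : (r : ℂ) ≠ 0 := by exact_mod_cast hr0.ne'
  have hm : MapsTo (fun z : ℂ => r * z) (ball 0 r⁻¹) (ball 0 1) := fun z hz => by
    rw [mem_ball_zero_iff] at hz ⊢
    rw [norm_mul, Complex.norm_real, Real.norm_of_nonneg hr0.le]
    calc r * ‖z‖ < r * r⁻¹ := by gcongr
      _ = 1 := mul_inv_cancel₀ hr0.ne'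
  have him : (fun z : ℂ => g (r * z)) '' ball 0 r⁻¹ = Ω := by
    refine subset_antisymm (image_subset_iff.2 fun z hz => hgm (hm hz)) fun v hv => ?_
    refine ⟨f v / r, ?_, ?_⟩
    · have := mem_ball_zero_iff.1 (hfm hv)
      rw [mem_ball_zero_iff, norm_div, Complex.norm_real, Real.norm_of_nonneg hr0.le,
        div_eq_mul_inv]
      exact mul_lt_of_lt_one_left (by positivity) this
    · simp only [mul_div_cancel₀ _ hrc, hgf v hv]
  refine ⟨fun z => g (r * z), fun z => f z / r, r⁻¹, (one_lt_inv₀ hr0).2 hr1,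
    ?_, ?_, ?_, ?_, ?_, ?_⟩
  · exact hg.comp (by fun_prop) hm
  · rwa [him]
  · rw [him]
    exact hf.div_const _
  · intro z hz
    simp only [hfg _ (hm hz), mul_div_cancel_left₀ _ hrc]
  · simp only [mul_zero, hg0]
  · rintro - ⟨z, hz, rfl⟩
    have hzR : z ∈ ball (0 : ℂ) r⁻¹ :=
      closedBall_subset_ball ((one_lt_inv₀ hr0).2 hr1) hz
    have hv : g (r * z) ∈ closure Ω := subset_closure (hgm (hm hzR))
    refine ⟨Φ.symm (g (r * z)), ⟨f (Φ.symm (g (r * z))) / r, ?_, ?_⟩, Φ.apply_symm_apply _⟩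
    · rw [mem_ball_zero_iff, norm_div, Complex.norm_real, Real.norm_of_nonneg hr0.le,
        div_lt_one hr0]
      exact hr _ hv
    · simp only [mul_div_cancel₀ _ hrc, hgf _ (habs _ hv)]

end AttractingDisc

/-! ### Equivariant extension from a fundamental annulus -/

section Equivariant

lemma homeomorph_pow_apply {X : Type*} [TopologicalSpace X] (Φ : X ≃ₜ X) (n : ℕ) (v : X) :
    (Φ ^ n) v = Φ^[n] v := by
  induction n generalizing v with
  | zero => rfl
  | succ n ih => rw [pow_succ, Homeomorph.mul_apply, ih, Function.iterate_succ_apply]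

theorem exists_equivariant_extension (Φ : ℂ ≃ₜ ℂ) (hΦ0 : Φ 0 = 0) {s : ℝ} (hs : 1 < s) {O : Set ℂ}
    (h0 : 0 ∈ O) (hO : ∀ v ∈ O, Φ.symm v ∈ O) (hex : ∀ v, ∃ n : ℤ, (Φ ^ n) v ∈ O)
    (hnot : ∀ v ≠ 0, ∃ n : ℤ, (Φ ^ n) v ∉ O) {k : ℂ → ℂ}
    (hk : ContinuousOn k {w | 1 ≤ ‖w‖ ∧ ‖w‖ ≤ s})
    (hbij : BijOn k {w | 1 ≤ ‖w‖ ∧ ‖w‖ < s} (Φ '' O \ O))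
    (hks : ∀ w, ‖w‖ = 1 → k (s * w) = Φ (k w)) :
    ∃ Ψ : ℂ → ℂ, ContinuousOn Ψ {0}ᶜ ∧ BijOn Ψ {0}ᶜ {0}ᶜ ∧ ∀ w ≠ 0, Ψ (s * w) = Φ (Ψ w) := by
  have hs0 : 0 < s := one_pos.trans hs
  have hsc : (s : ℂ) ≠ 0 := by exact_mod_cast hs0.ne'
  have hnorm : ∀ (n : ℤ) (w : ℂ), ‖(s : ℂ) ^ n * w‖ = s ^ n * ‖w‖ := fun n w => by
    rw [norm_mul, norm_zpow, Complex.norm_real, Real.norm_of_nonneg hs0.le]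
  have hzadd : ∀ (m n : ℤ) (v : ℂ), (Φ ^ m) ((Φ ^ n) v) = (Φ ^ (m + n)) v := fun m n v => by
    rw [zpow_add]
    rfl
  have hzfix : ∀ n : ℤ, (Φ ^ n) 0 = 0 := fun n => by
    have h1 : ∀ m : ℕ, (Φ ^ m) 0 = 0 := fun m => by
      rw [homeomorph_pow_apply, Function.iterate_fixed hΦ0]
    cases n with
    | ofNat m => rw [Int.ofNat_eq_natCast, zpow_natCast, h1]
    | negSucc m =>
      rw [zpow_negSucc, Homeomorph.inv_apply, Homeomorph.symm_apply_eq, h1]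
  have hzone : ∀ (n : ℤ) (v : ℂ), (Φ ^ (n + 1)) v = Φ ((Φ ^ n) v) := fun n v => by
    rw [add_comm, zpow_add, zpow_one]
    rfl
  have hmono : ∀ (v : ℂ) (n : ℤ) (j : ℕ), (Φ ^ (n + j)) v ∈ O → (Φ ^ n) v ∈ O := fun v n j => by
    induction j with
    | zero => simp
    | succ j ih =>
      intro h
      refine ih ?_
      have := hO _ h
      rwa [Nat.cast_succ, ← add_assoc, hzone, Homeomorph.symm_apply_apply] at this
  have hmono' : ∀ (v : ℂ) (m n : ℤ), m ≤ n → (Φ ^ n) v ∈ O → (Φ ^ m) v ∈ O := fun v m n hmn h => by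
    obtain ⟨j, rfl⟩ := Int.le.dest hmn
    exact hmono v m j h
  set N : ℂ → ℤ := fun w => ⌊Real.logb s ‖w‖⌋ with hN
  have hNeq : ∀ (n : ℤ) (w : ℂ), s ^ n ≤ ‖w‖ → ‖w‖ < s ^ (n + 1) → N w = n := by
    intro n w h1 h2
    have hw : 0 < ‖w‖ := (zpow_pos hs0 n).trans_le h1
    rw [hN, Int.floor_eq_iff, Real.le_logb_iff_rpow_le hs hw, Real.logb_lt_iff_lt_rpow hs hw]
    rw [← Real.rpow_intCast] at h1 h2
    exact ⟨h1, by exact_mod_cast h2⟩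
  set Ψ : ℂ → ℂ := fun w => (Φ ^ N w) (k ((s : ℂ) ^ (-N w) * w)) with hΨ
  have hΨlt : ∀ (n : ℤ) (w : ℂ), 1 ≤ ‖w‖ → ‖w‖ < s → Ψ ((s : ℂ) ^ n * w) = (Φ ^ n) (k w) := by
    intro n w h1 h2
    have : N ((s : ℂ) ^ n * w) = n := by
      apply hNeq <;> rw [hnorm]
      · exact le_mul_of_one_le_right (zpow_pos hs0 n).le h1
      · rw [zpow_add_one₀ hs0.ne']
        exact mul_lt_mul_of_pos_left h2 (zpow_pos hs0 n)
    simp only [hΨ, this]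
    rw [← mul_assoc, ← zpow_add₀ hsc, neg_add_cancel, zpow_zero, one_mul]
  have hΨle : ∀ (n : ℤ) (w : ℂ), 1 ≤ ‖w‖ → ‖w‖ ≤ s → Ψ ((s : ℂ) ^ n * w) = (Φ ^ n) (k w) := by
    intro n w h1 h2
    rcases h2.lt_or_eq with h2 | h2
    · exact hΨlt n w h1 h2
    · have hw : ‖w / s‖ = 1 := by
        rw [norm_div, Complex.norm_real, Real.norm_of_nonneg hs0.le, h2, div_self hs0.ne']
      have h3 := hΨlt (n + 1) (w / s) hw.ge (hw.trans_lt hs)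
      have h4 := hks _ hw
      rw [mul_div_cancel₀ _ hsc] at h4
      rw [zpow_add_one₀ hsc, mul_assoc, mul_div_cancel₀ _ hsc] at h3
      rw [h3, h4, zpow_add_one]
      rfl
  have hdecomp : ∀ w ≠ 0, ∃ (n : ℤ) (x : ℂ), 1 ≤ ‖x‖ ∧ ‖x‖ < s ∧ w = (s : ℂ) ^ n * x := by
    intro w hw
    obtain ⟨n, hn1, hn2⟩ := exists_mem_Ico_zpow (norm_pos_iff.2 hw) hs
    have hw' : w = (s : ℂ) ^ n * ((s : ℂ) ^ (-n) * w) := by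
      rw [← mul_assoc, ← zpow_add₀ hsc, add_neg_cancel, zpow_zero, one_mul]
    refine ⟨n, (s : ℂ) ^ (-n) * w, ?_, ?_, hw'⟩ <;> rw [hnorm, zpow_neg, inv_mul_eq_div]
    · rwa [le_div_iff₀ (zpow_pos hs0 n), one_mul]
    · rwa [div_lt_iff₀ (zpow_pos hs0 n), mul_comm, ← zpow_add_one₀ hs0.ne']
  have hsn : ∀ n : ℤ, (s : ℂ) ^ n ≠ 0 := fun n => zpow_ne_zero n hsc
  refine ⟨Ψ, ?_, ⟨?_, ?_, ?_⟩, ?_⟩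
  · have hA : ∀ n : ℤ, ContinuousOn Ψ {w | s ^ n ≤ ‖w‖ ∧ ‖w‖ ≤ s ^ (n + 1)} := by
      intro n
      have hm : MapsTo (fun w : ℂ => (s : ℂ) ^ (-n) * w) {w | s ^ n ≤ ‖w‖ ∧ ‖w‖ ≤ s ^ (n + 1)}
          {w | 1 ≤ ‖w‖ ∧ ‖w‖ ≤ s} := by
        rintro w ⟨h1, h2⟩
        change 1 ≤ ‖(s : ℂ) ^ (-n) * w‖ ∧ ‖(s : ℂ) ^ (-n) * w‖ ≤ s
        rw [hnorm, zpow_neg, inv_mul_eq_div, le_div_iff₀ (zpow_pos hs0 n),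
          div_le_iff₀ (zpow_pos hs0 n), one_mul, mul_comm s, ← zpow_add_one₀ hs0.ne']
        exact ⟨h1, h2⟩
      refine ((Φ ^ n).continuous.comp_continuousOn (hk.comp (by fun_prop) hm)).congr fun w hw => ?_
      have := hΨle n _ (hm hw).1 (hm hw).2
      rwa [← mul_assoc, ← zpow_add₀ hsc, add_neg_cancel, zpow_zero, one_mul] at this
    have hcl : ∀ n : ℤ, IsClosed {w : ℂ | s ^ n ≤ ‖w‖ ∧ ‖w‖ ≤ s ^ (n + 1)} := fun n =>
      (isClosed_le continuous_const continuous_norm).inter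
        (isClosed_le continuous_norm continuous_const)
    intro w hw
    obtain ⟨n, hn1, hn2⟩ := exists_mem_Ico_zpow (norm_pos_iff.2 hw) hs
    refine (((hA (n - 1)).union_of_isClosed (hA n) (hcl _) (hcl _)).continuousAt
      ?_).continuousWithinAt
    have hlt : s ^ (n - 1) < ‖w‖ := (zpow_lt_zpow_right₀ hs (by omega)).trans_le hn1
    filter_upwards [continuous_norm.continuousAt.eventually (lt_mem_nhds hlt),
      continuous_norm.continuousAt.eventually (gt_mem_nhds hn2)] with v hv1 hv2
    rcases le_total ‖v‖ (s ^ n) with h | h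
    · exact Or.inl ⟨hv1.le, by rwa [sub_add_cancel]⟩
    · exact Or.inr ⟨h, hv2.le⟩
  · intro w hw h
    obtain ⟨n, x, hx1, hx2, rfl⟩ := hdecomp w hw
    rw [mem_singleton_iff, hΨlt n x hx1 hx2, ← hzfix n, (Φ ^ n).injective.eq_iff] at h
    refine (hbij.mapsTo ⟨hx1, hx2⟩).2 ?_
    rwa [h]
  · have key : ∀ (n m : ℤ) (x y : ℂ), 1 ≤ ‖x‖ → ‖x‖ < s → 1 ≤ ‖y‖ → ‖y‖ < s →
        (Φ ^ n) (k x) = (Φ ^ m) (k y) → m ≤ n := by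
      intro n m x y hx1 hx2 hy1 hy2 h
      by_contra! hlt
      refine (hbij.mapsTo ⟨hy1, hy2⟩).2 ?_
      obtain ⟨o, ho, hox⟩ := (hbij.mapsTo ⟨hx1, hx2⟩).1
      have h1 : o = (Φ ^ (m - n - 1)) (k y) := by
        refine Φ.injective ?_
        rw [hox, ← hzone, sub_add_cancel]
        refine (Φ ^ n).injective ?_
        rw [h, hzadd, add_sub_cancel]
      rw [h1] at ho
      exact hmono' _ 0 _ (by omega) ho
    intro w hw w' hw' h
    obtain ⟨n, x, hx1, hx2, rfl⟩ := hdecomp w hw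
    obtain ⟨m, y, hy1, hy2, rfl⟩ := hdecomp w' hw'
    rw [hΨlt n x hx1 hx2, hΨlt m y hy1 hy2] at h
    obtain rfl : n = m := le_antisymm (key _ _ _ _ hy1 hy2 hx1 hx2 h.symm)
      (key _ _ _ _ hx1 hx2 hy1 hy2 h)
    rw [hbij.injOn ⟨hx1, hx2⟩ ⟨hy1, hy2⟩ ((Φ ^ n).injective h)]
  · intro v hv
    obtain ⟨b, hb⟩ := hnot v hv
    obtain ⟨n, hn, hmax⟩ := Int.exists_greatest_of_bdd (P := fun n => (Φ ^ n) v ∈ O)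
      ⟨b, fun z hz => by
        by_contra! hlt
        exact hb (hmono' v b z hlt.le hz)⟩ (hex v)
    have hD : (Φ ^ (n + 1)) v ∈ Φ '' O \ O :=
      ⟨⟨_, hn, (hzone n v).symm⟩, fun h => by have := hmax _ h; omega⟩
    obtain ⟨x, ⟨hx1, hx2⟩, hx⟩ := hbij.surjOn hD
    refine ⟨(s : ℂ) ^ (-(n + 1)) * x, ?_, ?_⟩
    · refine mul_ne_zero (hsn _) (norm_pos_iff.1 (one_pos.trans_le hx1))
    · rw [hΨlt _ x hx1 hx2, hx, hzadd, neg_add_cancel]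
      rfl
  · intro w hw
    obtain ⟨n, x, hx1, hx2, rfl⟩ := hdecomp w hw
    rw [← mul_assoc, ← zpow_one_add₀ hsc, hΨlt _ x hx1 hx2, hΨlt n x hx1 hx2, add_comm, hzone]

end Equivariant

/-! ### Untwisting circle maps of degree one -/

section Twist

lemma strictMono_add_circle {b : ℂ → ℝ} (hb : ContinuousOn b (sphere 0 1))
    (hinj : InjOn (fun w => w * Complex.exp (b w * Complex.I)) (sphere 0 1)) :
    StrictMono fun θ : ℝ => θ + b (Complex.exp (θ * Complex.I)) := by
  have hmem : ∀ θ : ℝ, Complex.exp (θ * Complex.I) ∈ sphere (0 : ℂ) 1 := fun θ => by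
    rw [mem_sphere_zero_iff_norm, Complex.norm_exp_ofReal_mul_I]
  have hc : Continuous fun θ : ℝ => θ + b (Complex.exp (θ * Complex.I)) :=
    continuous_id.add (hb.comp_continuous (by fun_prop) hmem)
  have hi : Function.Injective fun θ : ℝ => θ + b (Complex.exp (θ * Complex.I)) := by
    intro θ θ' h
    simp only at h
    have h1 : Complex.exp (θ * Complex.I) = Complex.exp (θ' * Complex.I) := by
      refine hinj (hmem θ) (hmem θ') ?_
      simp only [← Complex.exp_add, ← add_mul, ← Complex.ofReal_add, h]
    rw [h1] at h
    exact add_right_cancel h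
  refine (hc.strictMono_of_inj hi).resolve_right fun ha => ?_
  have := ha (show (0 : ℝ) < 2 * Real.pi by positivity)
  simp only [Complex.ofReal_zero, zero_mul, Complex.ofReal_mul, Complex.ofReal_ofNat,
    Complex.exp_two_pi_mul_I, Complex.exp_zero, zero_add] at this
  linarith [Real.pi_pos]

lemma bijOn_circle_twist {b : ℂ → ℝ} (hb : ContinuousOn b (sphere 0 1))
    (hinj : InjOn (fun w => w * Complex.exp (b w * Complex.I)) (sphere 0 1)) {l : ℝ} (hl0 : 0 ≤ l)
    (hl1 : l ≤ 1) :
    BijOn (fun w => w * Complex.exp ((l * b w : ℝ) * Complex.I)) (sphere 0 1) (sphere 0 1) := by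
  have hmem : ∀ θ : ℝ, Complex.exp (θ * Complex.I) ∈ sphere (0 : ℂ) 1 := fun θ => by
    rw [mem_sphere_zero_iff_norm, Complex.norm_exp_ofReal_mul_I]
  have hrep : ∀ w ∈ sphere (0 : ℂ) 1, ∃ θ : ℝ, Complex.exp (θ * Complex.I) = w := fun w hw =>
    (Complex.norm_eq_one_iff w).1 (mem_sphere_zero_iff_norm.1 hw)
  have hmono := strictMono_add_circle hb hinj
  set B : ℝ → ℝ := fun θ => θ + l * b (Complex.exp (θ * Complex.I)) with hB
  have hBm : StrictMono B := by
    intro θ θ' h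
    have h1 := hmono h
    simp only at h1
    simp only [hB]
    rcases hl0.eq_or_lt with rfl | hl
    · linarith
    · nlinarith [mul_lt_mul_of_pos_left h1 hl, mul_le_mul_of_nonneg_left h.le (sub_nonneg.2 hl1)]
  have hbc : Continuous fun θ : ℝ => b (Complex.exp (θ * Complex.I)) :=
    hb.comp_continuous (by fun_prop) hmem
  have hBc : Continuous B := continuous_id.add (continuous_const.mul hbc)
  obtain ⟨M, hM⟩ := (isCompact_sphere (0 : ℂ) 1).exists_bound_of_continuousOn hb
  have hBb : ∀ θ, |B θ - θ| ≤ M := fun θ => by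
    have h1 := hM _ (hmem θ)
    simp only [hB, add_sub_cancel_left, abs_mul, abs_of_nonneg hl0]
    exact (mul_le_of_le_one_left (abs_nonneg _) hl1).trans h1
  have hBs : Function.Surjective B := by
    refine hBc.surjective ?_ ?_
    · refine tendsto_atTop_mono (fun θ => ?_) (tendsto_atTop_add_const_right _ (-M) tendsto_id)
      have := (abs_le.1 (hBb θ)).1
      simp only [id]
      linarith
    · refine tendsto_atBot_mono (fun θ => ?_) (tendsto_atBot_add_const_right _ M tendsto_id)
      have := (abs_le.1 (hBb θ)).2
      simp only [id]
      linarith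
  have hBexp : ∀ θ : ℝ, Complex.exp (θ * Complex.I) *
      Complex.exp ((l * b (Complex.exp (θ * Complex.I)) : ℝ) * Complex.I) =
      Complex.exp (B θ * Complex.I) := fun θ => by
    rw [← Complex.exp_add, ← add_mul, ← Complex.ofReal_add]
  refine ⟨fun w hw => ?_, fun w hw w' hw' h => ?_, fun w hw => ?_⟩
  · obtain ⟨θ, rfl⟩ := hrep w hw
    simp only [hBexp]
    exact hmem _
  · obtain ⟨θ, rfl⟩ := hrep w hw
    obtain ⟨θ', rfl⟩ := hrep w' hw'
    simp only [hBexp] at h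
    obtain ⟨n, hn⟩ := Complex.exp_eq_exp_iff_exists_int.1 h
    have h1 : B θ = B (θ' + n * (2 * Real.pi)) := by
      have h2 : B θ = B θ' + n * (2 * Real.pi) := by
        have h3 : ((B θ : ℝ) : ℂ) * Complex.I =
            ((B θ' + n * (2 * Real.pi) : ℝ) : ℂ) * Complex.I := by
          rw [hn]
          push_cast
          ring
        exact_mod_cast mul_right_cancel₀ Complex.I_ne_zero h3
      rw [h2]
      have h4 : Complex.exp ((θ' + n * (2 * Real.pi) : ℝ) * Complex.I) =
          Complex.exp (θ' * Complex.I) :=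
        Complex.exp_eq_exp_iff_exists_int.2 ⟨n, by push_cast; ring⟩
      simp only [hB, h4]
      ring
    rw [hBm.injective h1]
    exact Complex.exp_eq_exp_iff_exists_int.2 ⟨n, by push_cast; ring⟩
  · obtain ⟨θ, rfl⟩ := hrep w hw
    obtain ⟨θ', rfl⟩ := hBs θ
    exact ⟨_, hmem θ', hBexp θ'⟩

lemma exists_annulus_twist {b : ℂ → ℝ} (hb : ContinuousOn b (sphere 0 1))
    (hinj : InjOn (fun w => w * Complex.exp (b w * Complex.I)) (sphere 0 1)) {s : ℝ} (hs : 1 < s) :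
    ∃ τ : ℂ → ℂ, ContinuousOn τ {w | 1 ≤ ‖w‖ ∧ ‖w‖ ≤ s} ∧ (∀ w, ‖τ w‖ = ‖w‖) ∧
      InjOn τ {w | 1 ≤ ‖w‖ ∧ ‖w‖ ≤ s} ∧
      SurjOn τ {w | 1 ≤ ‖w‖ ∧ ‖w‖ ≤ s} {w | 1 ≤ ‖w‖ ∧ ‖w‖ ≤ s} ∧
      (∀ w, ‖w‖ = 1 → τ w = w) ∧
      ∀ w, ‖w‖ = 1 → τ (s * w) = s * (w * Complex.exp (b w * Complex.I)) := by
  have hs1 : 0 < s - 1 := sub_pos.2 hs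
  set l : ℝ → ℝ := fun r => (r - 1) / (s - 1) with hl
  have hl0 : ∀ r, 1 ≤ r → 0 ≤ l r := fun r hr => div_nonneg (sub_nonneg.2 hr) hs1.le
  have hl1 : ∀ r, r ≤ s → l r ≤ 1 := fun r hr => (div_le_one hs1).2 (by linarith)
  set τ : ℂ → ℂ := fun w => w * Complex.exp ((l ‖w‖ * b (w / ‖w‖) : ℝ) * Complex.I) with hτ
  have hτn : ∀ w, ‖τ w‖ = ‖w‖ := fun w => by
    rw [hτ, norm_mul, Complex.norm_exp_ofReal_mul_I, mul_one]
  have hτr : ∀ (r : ℝ) (w : ℂ), 0 < r → ‖w‖ = 1 →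
      τ (r * w) = r * (w * Complex.exp ((l r * b w : ℝ) * Complex.I)) := fun r w hr hw => by
    have h1 : ‖(r : ℂ) * w‖ = r := by
      rw [norm_mul, hw, Complex.norm_real, Real.norm_of_nonneg hr.le, mul_one]
    simp only [hτ, h1]
    rw [mul_div_cancel_left₀ _ (by exact_mod_cast hr.ne'), mul_assoc]
  have hpolar : ∀ w : ℂ, 1 ≤ ‖w‖ → ‖w / ‖w‖‖ = 1 ∧ w = (‖w‖ : ℂ) * (w / ‖w‖) := fun w hw => by
    have h0 : ‖w‖ ≠ 0 := (one_pos.trans_le hw).ne'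
    refine ⟨by rw [norm_div, Complex.norm_real, norm_norm, div_self h0], ?_⟩
    rw [mul_div_cancel₀ _ (by exact_mod_cast h0)]
  refine ⟨τ, ?_, hτn, ?_, ?_, fun w hw => ?_, fun w hw => ?_⟩
  · have hd : ContinuousOn (fun w : ℂ => w / ‖w‖) {w | 1 ≤ ‖w‖ ∧ ‖w‖ ≤ s} :=
      continuousOn_id.div (Complex.continuous_ofReal.comp continuous_norm).continuousOn
        fun w hw => by exact_mod_cast (one_pos.trans_le hw.1).ne'
    have hb' : ContinuousOn (fun w : ℂ => b (w / ‖w‖)) {w | 1 ≤ ‖w‖ ∧ ‖w‖ ≤ s} :=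
      hb.comp hd fun w hw => mem_sphere_zero_iff_norm.2 (hpolar w hw.1).1
    have hl' : Continuous fun w : ℂ => l ‖w‖ := by
      simp only [hl]
      fun_prop
    exact continuousOn_id.mul (Complex.continuous_exp.comp_continuousOn
      ((Complex.continuous_ofReal.comp_continuousOn (hl'.continuousOn.mul hb')).mul
        continuousOn_const))
  · intro w hw w' hw' h
    have hn : ‖w‖ = ‖w'‖ := by rw [← hτn w, h, hτn]
    obtain ⟨h1, h2⟩ := hpolar w hw.1
    obtain ⟨h1', h2'⟩ := hpolar w' hw'.1
    have h0 : 0 < ‖w‖ := one_pos.trans_le hw.1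
    rw [h2, h2', ← hn, hτr _ _ h0 h1, hτr _ _ h0 (hn ▸ h1')] at h
    have h3 := (bijOn_circle_twist hb hinj (hl0 _ hw.1) (hl1 _ hw.2)).injOn
      (mem_sphere_zero_iff_norm.2 h1) (mem_sphere_zero_iff_norm.2 (hn ▸ h1'))
      (mul_left_cancel₀ (by exact_mod_cast h0.ne') h)
    rw [h2, h2', ← hn, h3]
  · intro w hw
    obtain ⟨h1, h2⟩ := hpolar w hw.1
    have h0 : 0 < ‖w‖ := one_pos.trans_le hw.1
    obtain ⟨v, hv, hvw⟩ := (bijOn_circle_twist hb hinj (hl0 _ hw.1) (hl1 _ hw.2)).surjOn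
      (mem_sphere_zero_iff_norm.2 h1)
    have hv1 := mem_sphere_zero_iff_norm.1 hv
    have hτv : τ (‖w‖ * v) = w := by
      rw [hτr _ _ h0 hv1]
      simp only at hvw
      rw [hvw, ← h2]
    refine ⟨‖w‖ * v, ?_, hτv⟩
    change 1 ≤ ‖(‖w‖ : ℂ) * v‖ ∧ ‖(‖w‖ : ℂ) * v‖ ≤ s
    rw [norm_mul, hv1, Complex.norm_real, norm_norm, mul_one]
    exact hw
  · have := hτr 1 w one_pos hw
    simpa [hl] using this
  · rw [hτr s w (one_pos.trans hs) hw]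
    simp only [hl, div_self hs1.ne', one_mul]

end Twist

/-! ### Linearization of roots of a dilation -/

section Linearization

lemma hasLogOn_dslope {K φ : ℂ → ℂ} {s : ℝ} (hs : 1 < s) (hK : ContinuousOn K (closedBall 0 s))
    (hinj : InjOn K (closedBall 0 s)) (hKφ : ∀ z ∈ closedBall 0 1, K z = φ z) (hφ0 : φ 0 = 0)
    (hφ : DifferentiableAt ℂ φ 0) (hφ' : deriv φ 0 ≠ 0) :
    HasLogOn (fun w => K w / w) (closedBall 0 s \ {0}) := by
  have hs0 : 0 < s := one_pos.trans hs
  have hK0 : K 0 = 0 := (hKφ 0 (mem_closedBall_self zero_le_one)).trans hφ0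
  have hev : K =ᶠ[𝓝 0] φ := by
    filter_upwards [closedBall_mem_nhds (0 : ℂ) one_pos] with z hz using hKφ z hz
  have hc : ContinuousOn (dslope K 0) (closedBall 0 s) :=
    (continuousOn_dslope (closedBall_mem_nhds 0 hs0)).2 ⟨hK, hφ.congr_of_eventuallyEq hev⟩
  have heq : ∀ w ≠ 0, dslope K 0 w = K w / w := fun w hw => by
    rw [dslope_of_ne _ hw, slope_def_field, hK0, sub_zero, sub_zero]
  have hne : ∀ w ∈ closedBall 0 s, dslope K 0 w ≠ 0 := by
    intro w hw
    by_cases h : w = 0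
    · rw [h, dslope_same, hev.deriv_eq]
      exact hφ'
    · rw [heq w h]
      refine div_ne_zero (fun h0 => h ?_) h
      exact hinj hw (mem_closedBall_self hs0.le) (h0.trans hK0.symm)
  have hret : Continuous fun w : ℂ => ((s / max s ‖w‖ : ℝ) : ℂ) * w := by
    refine (Complex.continuous_ofReal.comp (continuous_const.div
      (continuous_const.max continuous_norm) fun w => ?_)).mul continuous_id
    exact (hs0.trans_le (le_max_left _ _)).ne'
  refine ((HasLogOn.of_retract hc hne hret (fun w => ?_) (g' := id) continuousOn_id
    fun w hw => ?_).mono sdiff_subset).congr fun w hw => (heq w hw.2).symm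
  · have hm : 0 < max s ‖w‖ := hs0.trans_le (le_max_left _ _)
    rw [mem_closedBall_zero_iff, norm_mul, Complex.norm_real,
      Real.norm_of_nonneg (div_nonneg hs0.le hm.le), div_mul_eq_mul_div, div_le_iff₀ hm]
    exact mul_le_mul_of_nonneg_left (le_max_right _ _) hs0.le
  · rw [mem_closedBall_zero_iff] at hw
    simp only [id, max_eq_left hw, div_self hs0.ne', Complex.ofReal_one, one_mul]

theorem exists_linearization (Φ : ℂ ≃ₜ ℂ) (hΦ0 : Φ 0 = 0) {p : ℕ} (hp : 0 < p) {s : ℝ}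
    (hs : 1 < s) (hΦp : ∀ w, Φ^[p] w = (s : ℂ) ^ p * w)
    (hlog : HasLogOn (fun w => Φ w / w) {0}ᶜ) :
    ∃ Ψ : ℂ → ℂ, ContinuousOn Ψ {0}ᶜ ∧ BijOn Ψ {0}ᶜ {0}ᶜ ∧ ∀ w ≠ 0, Ψ (s * w) = Φ (Ψ w) := by
  have hs0 : 0 < s := one_pos.trans hs
  have hsc : (s : ℂ) ≠ 0 := by exact_mod_cast hs0.ne'
  obtain ⟨φ, ψ, R, hR, hφ, ho, hψd, hψ, hφ0, hsub⟩ := exists_absorbed_disc Φ hΦ0 hp hs hΦp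
  obtain ⟨K, hK, hKinj, hKφ, hKb, hKc⟩ := exists_disc_extension hR hs hφ ho hψd hψ hφ0 Φ hΦ0 hsub
  have hbb : ball (0 : ℂ) 1 ⊆ ball 0 R := ball_subset_ball hR.le
  have hbc : closedBall (0 : ℂ) 1 ⊆ ball 0 R := closedBall_subset_ball hR
  have hcs : closedBall (0 : ℂ) 1 ⊆ closedBall 0 s := closedBall_subset_closedBall hs.le
  have hφinj : InjOn φ (ball 0 R) := fun z hz w hw h => by rw [← hψ z hz, h, hψ w hw]
  set O := φ '' ball 0 1 with hOdef
  have hR0 : ball (0 : ℂ) R ∈ 𝓝 (0 : ℂ) := ball_mem_nhds 0 (one_pos.trans hR)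
  have hφd0 : DifferentiableAt ℂ φ 0 := hφ.differentiableAt hR0
  have hφ' : deriv φ 0 ≠ 0 := by
    refine deriv_ne_zero_of_leftInverse hφd0 (g := ψ) (hψd.differentiableAt (ho.mem_nhds ?_)) ?_
    · exact mem_image_of_mem φ (mem_ball_self (one_pos.trans hR))
    · filter_upwards [hR0] with z hz using hψ z hz
  have hKlog := hasLogOn_dslope hs hK hKinj hKφ hφ0 hφd0 hφ'
  set L := Function.invFunOn K (closedBall 0 s) with hL
  have hLK : ∀ z ∈ closedBall (0 : ℂ) s, L (K z) = z := fun z hz => hKinj.leftInvOn_invFunOn hz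
  have hLc : ContinuousOn L (K '' closedBall 0 s) :=
    (isCompact_closedBall (0 : ℂ) s).continuousOn_of_leftInvOn hK hKinj hLK
  have hbd : ∀ w, ‖w‖ = 1 → ∃ v, ‖v‖ = s ∧ K v = Φ (φ w) := by
    intro w hw
    have hwc : w ∈ closedBall (0 : ℂ) 1 := mem_closedBall_zero_iff.2 hw.le
    have : Φ (φ w) ∈ K '' closedBall 0 s := by
      rw [hKc]
      exact mem_image_of_mem Φ (mem_image_of_mem φ hwc)
    obtain ⟨v, hv, hvw⟩ := this
    refine ⟨v, (mem_closedBall_zero_iff.1 hv).antisymm (not_lt.1 fun hlt => ?_), hvw⟩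
    have : K v ∈ Φ '' O := by
      rw [← hKb]
      exact mem_image_of_mem K (mem_ball_zero_iff.2 hlt)
    obtain ⟨-, ⟨z, hz, rfl⟩, hzv⟩ := this
    have h1 := hφinj (hbb hz) (hbc hwc) (Φ.injective (hzv.trans hvw))
    rw [h1, mem_ball_zero_iff, hw] at hz
    exact hz.false
  set m : ℂ → ℂ := fun w => L (Φ (φ w)) / s with hm
  have hmn : ∀ w, ‖w‖ = 1 → ‖m w‖ = 1 := fun w hw => by
    obtain ⟨v, hv, hvw⟩ := hbd w hw
    rw [hm]
    beta_reduce
    rw [← hvw, hLK v (mem_closedBall_zero_iff.2 hv.le), norm_div, hv, Complex.norm_real,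
      Real.norm_of_nonneg hs0.le, div_self hs0.ne']
  have hKm : ∀ w, ‖w‖ = 1 → K (s * m w) = Φ (φ w) := fun w hw => by
    obtain ⟨v, hv, hvw⟩ := hbd w hw
    simp only [hm, mul_div_cancel₀ _ hsc]
    rw [← hvw, hLK v (mem_closedBall_zero_iff.2 hv.le)]
  have hsmem : ∀ v : ℂ, ‖v‖ = 1 → (s : ℂ) * v ∈ closedBall (0 : ℂ) s := fun v hv => by
    rw [mem_closedBall_zero_iff, norm_mul, hv, Complex.norm_real, Real.norm_of_nonneg hs0.le,
      mul_one]
  have hne1 : ∀ v : ℂ, ‖v‖ = 1 → v ≠ 0 := fun v hv => norm_pos_iff.1 (by rw [hv]; exact one_pos)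
  have hφS : ContinuousOn φ (sphere 0 1) :=
    hφ.continuousOn.mono (sphere_subset_closedBall.trans hbc)
  have hmc : ContinuousOn m (sphere 0 1) := by
    refine (hLc.comp (Φ.continuous.comp_continuousOn hφS) fun w hw => ?_).div_const _
    rw [hKc]
    exact mem_image_of_mem Φ (mem_image_of_mem φ (sphere_subset_closedBall hw))
  have hminj : InjOn m (sphere 0 1) := by
    intro w hw w' hw' h
    have h1 := hKm w (mem_sphere_zero_iff_norm.1 hw)
    rw [h, hKm w' (mem_sphere_zero_iff_norm.1 hw')] at h1
    exact hφinj (hbc (sphere_subset_closedBall hw)) (hbc (sphere_subset_closedBall hw'))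
      (Φ.injective h1.symm)
  have hφne : ∀ w, ‖w‖ = 1 → φ w ≠ 0 := fun w hw h => hne1 w hw
    (hφinj (hbc (mem_closedBall_zero_iff.2 hw.le)) (mem_of_mem_nhds hR0) (h.trans hφ0.symm))
  have hmlog : HasLogOn (fun w => m w / w) (sphere 0 1) := by
    have l1 : HasLogOn (fun w => K (s * m w) / (s * m w)) (sphere 0 1) :=
      hKlog.comp (g := fun w => (s : ℂ) * m w) (continuousOn_const.mul hmc) fun w hw =>
        ⟨hsmem _ (hmn w (mem_sphere_zero_iff_norm.1 hw)),
          mul_ne_zero hsc (hne1 _ (hmn w (mem_sphere_zero_iff_norm.1 hw)))⟩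
    have l2 : HasLogOn (fun w => K w / w) (sphere 0 1) := hKlog.mono fun w hw =>
      ⟨hcs (sphere_subset_closedBall hw), hne1 w (mem_sphere_zero_iff_norm.1 hw)⟩
    have l3 : HasLogOn (fun w => Φ (φ w) / φ w) (sphere 0 1) :=
      hlog.comp (g := φ) hφS fun w hw => hφne w (mem_sphere_zero_iff_norm.1 hw)
    refine (((l3.mul l2).div l1).div (HasLogOn.const hsc)).congr fun w hw => ?_
    have hw1 := mem_sphere_zero_iff_norm.1 hw
    have h1 := hne1 w hw1
    have h2 := hne1 _ (hmn w hw1)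
    have h3 := hφne w hw1
    have h4 : Φ (φ w) ≠ 0 := fun h => h3 (Φ.injective (h.trans hΦ0.symm))
    rw [hKm w hw1, hKφ w (sphere_subset_closedBall hw)]
    field_simp
  obtain ⟨l, hlc, hl⟩ := hmlog
  set b : ℂ → ℝ := fun w => (l w).im with hb
  have hbc' : ContinuousOn b (sphere 0 1) := Complex.continuous_im.comp_continuousOn hlc
  have hmb : ∀ w ∈ sphere (0 : ℂ) 1, w * Complex.exp (b w * Complex.I) = m w := by
    intro w hw
    have hw1 := mem_sphere_zero_iff_norm.1 hw
    have h1 := hl w hw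
    have h2 : (l w).re = 0 := by
      have h3 := congrArg norm h1
      rw [norm_div, hmn w hw1, hw1, div_one, Complex.norm_exp] at h3
      exact (Real.exp_eq_one_iff _).1 h3.symm
    have h3 : l w = b w * Complex.I := Complex.ext (by simp [h2]) (by simp [hb])
    rw [← h3, ← h1, mul_div_cancel₀ _ (hne1 w hw1)]
  obtain ⟨τ, hτc, hτn, hτi, hτs, hτ1, hτ2⟩ := exists_annulus_twist hbc'
    (hminj.congr fun w hw => (hmb w hw).symm) hs
  have hKO : K '' ball 0 1 = O := image_congr fun z hz => hKφ z (ball_subset_closedBall hz)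
  have hKball : ∀ v ∈ closedBall (0 : ℂ) s, (K v ∈ Φ '' O ↔ ‖v‖ < s) := fun v hv => by
    rw [← hKb, hKinj.mem_image_iff ball_subset_closedBall hv, mem_ball_zero_iff]
  have hKO' : ∀ v ∈ closedBall (0 : ℂ) s, (K v ∈ O ↔ ‖v‖ < 1) := fun v hv => by
    rw [← hKO, hKinj.mem_image_iff (ball_subset_closedBall.trans hcs) hv, mem_ball_zero_iff]
  have hA : ∀ w : ℂ, 1 ≤ ‖w‖ ∧ ‖w‖ ≤ s → τ w ∈ closedBall (0 : ℂ) s := fun w hw => by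
    rw [mem_closedBall_zero_iff, hτn]
    exact hw.2
  have h0O : (0 : ℂ) ∈ O := ⟨0, mem_ball_self one_pos, hφ0⟩
  have hOΦ : O ⊆ Φ '' O := (image_mono ball_subset_closedBall).trans hsub
  have hpown : ∀ (n : ℕ) (v : ℂ), (Φ ^ (p * n)) v = ((s : ℂ) ^ p) ^ n * v := fun n => by
    induction n with
    | zero => intro v; simp
    | succ n ih =>
      intro v
      rw [Nat.mul_succ, pow_add, Homeomorph.mul_apply, ih, homeomorph_pow_apply, hΦp,
        pow_succ, mul_assoc]
  have hsp : 1 < s ^ p := one_lt_pow₀ hs hp.ne'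
  have hspn : ∀ n : ℕ, ‖((s : ℂ) ^ p) ^ n‖ = (s ^ p) ^ n := fun n => by
    rw [norm_pow, norm_pow, Complex.norm_real, Real.norm_of_nonneg hs0.le]
  refine exists_equivariant_extension Φ hΦ0 hs (O := O) (k := fun w => K (τ w)) h0O
    ?_ ?_ ?_ ?_ ⟨?_, ?_, ?_⟩ ?_
  · intro v hv
    obtain ⟨w, hw, rfl⟩ := hOΦ hv
    rwa [Φ.symm_apply_apply]
  · intro v
    have hOo : O ∈ 𝓝 (0 : ℂ) := by
      have : O = φ '' ball 0 R ∩ ψ ⁻¹' ball 0 1 := by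
        ext y
        constructor
        · rintro ⟨z, hz, rfl⟩
          exact ⟨mem_image_of_mem φ (hbb hz), by rwa [mem_preimage, hψ z (hbb hz)]⟩
        · rintro ⟨⟨z, hz, rfl⟩, hy⟩
          rw [mem_preimage, hψ z hz] at hy
          exact mem_image_of_mem φ hy
      rw [this] at h0O ⊢
      exact (hψd.continuousOn.isOpen_inter_preimage ho isOpen_ball).mem_nhds h0O
    obtain ⟨ε, hε, hεO⟩ := Metric.mem_nhds_iff.1 hOo
    obtain ⟨n, hn⟩ := pow_unbounded_of_one_lt (‖v‖ / ε) hsp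
    refine ⟨-((p * n : ℕ) : ℤ), hεO ?_⟩
    have h1 : (Φ ^ (-((p * n : ℕ) : ℤ))) v = (((s : ℂ) ^ p) ^ n)⁻¹ * v := by
      rw [zpow_neg, zpow_natCast, Homeomorph.inv_apply, Homeomorph.symm_apply_eq, hpown,
        mul_inv_cancel_left₀ (pow_ne_zero _ (pow_ne_zero _ hsc))]
    rw [h1, mem_ball_zero_iff, norm_mul, norm_inv, hspn, inv_mul_lt_iff₀ (by positivity)]
    rwa [div_lt_iff₀ hε] at hn
  · intro v hv
    obtain ⟨M, hM⟩ := ((isCompact_closedBall (0 : ℂ) 1).image_of_continuousOn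
      (hφ.continuousOn.mono hbc)).isBounded.exists_norm_le
    obtain ⟨n, hn⟩ := pow_unbounded_of_one_lt (M / ‖v‖) hsp
    refine ⟨((p * n : ℕ) : ℤ), fun h => ?_⟩
    have h1 := hM _ (image_mono ball_subset_closedBall h)
    rw [zpow_natCast, hpown, norm_mul, hspn] at h1
    rw [div_lt_iff₀ (norm_pos_iff.2 hv)] at hn
    exact h1.not_gt hn
  · exact hK.comp hτc hA
  · intro w hw
    have hw' := hA w ⟨hw.1, hw.2.le⟩
    refine ⟨(hKball _ hw').2 ((hτn w).trans_lt hw.2), fun h => ?_⟩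
    rw [hKO' _ hw', hτn] at h
    exact h.not_ge hw.1
  · intro w hw w' hw' h
    have h1 : 1 ≤ ‖w‖ ∧ ‖w‖ ≤ s := ⟨hw.1, hw.2.le⟩
    have h1' : 1 ≤ ‖w'‖ ∧ ‖w'‖ ≤ s := ⟨hw'.1, hw'.2.le⟩
    exact hτi h1 h1' (hKinj (hA w h1) (hA w' h1') h)
  · rintro v ⟨hv, hvO⟩
    rw [← hKb] at hv
    obtain ⟨z, hz, rfl⟩ := hv
    have hz1 : 1 ≤ ‖z‖ := not_lt.1 fun h => hvO ((hKO' z (ball_subset_closedBall hz)).2 h)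
    have hz2 := mem_ball_zero_iff.1 hz
    obtain ⟨w, hw, rfl⟩ := hτs (show 1 ≤ ‖z‖ ∧ ‖z‖ ≤ s from ⟨hz1, hz2.le⟩)
    rw [hτn] at hz1 hz2
    exact ⟨w, ⟨hz1, hz2⟩, rfl⟩
  · intro w hw
    have hw' := mem_sphere_zero_iff_norm.2 hw
    rw [hτ2 w hw, hτ1 w hw, hmb w hw', hKm w hw, hKφ w (sphere_subset_closedBall hw')]

end Linearization

/-! ### Lifting to the plane -/

section Lifting

/-- The universal covering `ℂ → T²`, `x + iy ↦ (x, y)`. -/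
noncomputable def torusProj : ℂ →+ Torus2 where
  toFun z := (z.re, z.im)
  map_zero' := by simp
  map_add' z w := by simp

lemma torusProj_apply (z : ℂ) :
    torusProj z = ((z.re : AddCircle (1 : ℝ)), (z.im : AddCircle (1 : ℝ))) := rfl

lemma torusProj_surjective : Function.Surjective torusProj := by
  rintro ⟨x, y⟩
  obtain ⟨a, rfl⟩ := QuotientAddGroup.mk_surjective x
  obtain ⟨b, rfl⟩ := QuotientAddGroup.mk_surjective y
  exact ⟨⟨a, b⟩, rfl⟩

lemma continuous_torusProj : Continuous torusProj :=
  ((AddCircle.continuous_mk' 1).comp Complex.continuous_re).prodMk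
    ((AddCircle.continuous_mk' 1).comp Complex.continuous_im)

lemma isOpenMap_torusProj : IsOpenMap torusProj := by
  have h : IsOpenMap ((↑) : ℝ → AddCircle (1 : ℝ)) := QuotientAddGroup.isOpenMap_coe
  exact (h.prodMap h).comp Complex.equivRealProdCLM.toHomeomorph.isOpenMap

lemma torusProj_eq_zero_iff {z : ℂ} : torusProj z = 0 ↔ ∃ m n : ℤ, z = m + n * Complex.I := by
  rw [torusProj_apply, Prod.mk_eq_zero, AddCircle.coe_eq_zero_iff, AddCircle.coe_eq_zero_iff]
  constructor
  · rintro ⟨⟨m, hm⟩, n, hn⟩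
    exact ⟨m, n, Complex.ext (by simp [← hm]) (by simp [← hn])⟩
  · rintro ⟨m, n, rfl⟩
    exact ⟨⟨m, by simp⟩, n, by simp⟩

lemma torusProj_eq_iff {z w : ℂ} : torusProj z = torusProj w ↔ torusProj (z - w) = 0 := by
  rw [map_sub, sub_eq_zero]

lemma exists_torus_displacement {f : C(Torus2, Torus2)}
    (h : f.Homotopic (ContinuousMap.id Torus2)) :
    ∃ δ : Torus2 → ℂ, Continuous δ ∧ ∀ x, f x = x + torusProj (δ x) := by
  obtain ⟨H⟩ := h.symm
  have cov := AddCircle.isCoveringMap_coe (1 : ℝ)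
  let D₁ : C(unitInterval × Torus2, AddCircle (1 : ℝ)) :=
    ⟨fun q => (H q).1 - q.2.1, by fun_prop⟩
  let D₂ : C(unitInterval × Torus2, AddCircle (1 : ℝ)) :=
    ⟨fun q => (H q).2 - q.2.2, by fun_prop⟩
  have h₁ : ∀ a, D₁ (0, a) = ((ContinuousMap.const Torus2 (0 : ℝ) a : ℝ) : AddCircle (1 : ℝ)) :=
    fun a => by simp [D₁]
  have h₂ : ∀ a, D₂ (0, a) = ((ContinuousMap.const Torus2 (0 : ℝ) a : ℝ) : AddCircle (1 : ℝ)) :=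
    fun a => by simp [D₂]
  have e₁ := fun x => congrFun (cov.liftHomotopy_lifts D₁ _ h₁) (1, x)
  have e₂ := fun x => congrFun (cov.liftHomotopy_lifts D₂ _ h₂) (1, x)
  refine ⟨fun x => ⟨cov.liftHomotopy D₁ _ h₁ (1, x), cov.liftHomotopy D₂ _ h₂ (1, x)⟩,
    ?_, fun x => ?_⟩
  · exact Complex.equivRealProdCLM.symm.continuous.comp
      (((cov.liftHomotopy D₁ _ h₁).continuous.comp (.prodMk_right 1)).prodMk
        ((cov.liftHomotopy D₂ _ h₂).continuous.comp (.prodMk_right 1)))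
  · have e₁' : ((cov.liftHomotopy D₁ _ h₁ (1, x) : ℝ) : AddCircle (1 : ℝ)) = (f x).1 - x.1 := by
      refine (e₁ x).trans ?_
      simp [D₁]
    have e₂' : ((cov.liftHomotopy D₂ _ h₂ (1, x) : ℝ) : AddCircle (1 : ℝ)) = (f x).2 - x.2 := by
      refine (e₂ x).trans ?_
      simp [D₂]
    rw [torusProj_apply, e₁', e₂']
    ext <;> simp

/-- `G` commutes with the deck transformations of `torusProj`. -/
def IsDeckEquivariant (G : ℂ → ℂ) : Prop := ∀ z w, torusProj w = 0 → G (z + w) = G z + w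

theorem exists_lift {f : Torus2 → Torus2} {δ : Torus2 → ℂ} (hδ : Continuous δ)
    (hf : ∀ x, f x = x + torusProj (δ x)) {p : ℕ} (hp : 0 < p) (hfp : f^[p] = id) :
    ∃ (F : ℂ ≃ₜ ℂ) (v : ℂ), IsDeckEquivariant F ∧ (∀ z, torusProj (F z) = f (torusProj z)) ∧
      torusProj v = 0 ∧ ∀ z, F^[p] z = z + v := by
  set F : ℂ → ℂ := fun z => z + δ (torusProj z) with hF
  have hFc : Continuous F := continuous_id.add (hδ.comp continuous_torusProj)
  have hFd : IsDeckEquivariant F := fun z w hw => by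
    simp only [hF, map_add, hw, add_zero]
    ring
  have hFπ : Function.Semiconj torusProj F f := fun z => by
    simp only [hF, map_add, hf]
  have hFp : ∀ z, torusProj (F^[p] z - z) = 0 := fun z => by
    rw [map_sub, (hFπ.iterate_right p) z, hfp, id, sub_self]
  have hcp : Continuous fun z => F^[p] z - z := (hFc.iterate p).sub continuous_id
  have cov := AddCircle.isCoveringMap_coe (1 : ℝ)
  have hconst : ∀ z, F^[p] z = z + (F^[p] 0 - 0) := fun z => by
    rw [← sub_eq_iff_eq_add']
    refine Complex.ext ?_ ?_
    · refine cov.const_of_comp (g := fun z => (F^[p] z - z).re)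
        (Complex.continuous_re.comp hcp) (fun a a' => ?_) z 0
      have h1 := congrArg Prod.fst (hFp a)
      have h2 := congrArg Prod.fst (hFp a')
      exact h1.trans h2.symm
    · refine cov.const_of_comp (g := fun z => (F^[p] z - z).im)
        (Complex.continuous_im.comp hcp) (fun a a' => ?_) z 0
      have h1 := congrArg Prod.snd (hFp a)
      have h2 := congrArg Prod.snd (hFp a')
      exact h1.trans h2.symm
  obtain ⟨v, hv⟩ : ∃ v, v = F^[p] 0 - 0 := ⟨_, rfl⟩
  have hv0 : torusProj v = 0 := hv ▸ hFp 0
  rw [← hv] at hconst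
  obtain ⟨k, rfl⟩ : ∃ k, p = k + 1 := ⟨p - 1, by omega⟩
  refine ⟨⟨⟨F, fun z => F^[k] (z - v), fun z => ?_, fun z => ?_⟩, hFc,
    (hFc.iterate k).comp (continuous_id.sub continuous_const)⟩, v, hFd, hFπ, hv0, hconst⟩
  · have h1 : F z - v = F (z - v) := by
      rw [sub_eq_add_neg z, hFd z (-v) (by rw [map_neg, hv0, neg_zero]), sub_eq_add_neg]
    beta_reduce
    rw [h1, ← Function.iterate_succ_apply, hconst, sub_add_cancel]
  · beta_reduce
    rw [← Function.iterate_succ_apply' F, hconst, sub_add_cancel]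

lemma exists_lattice_basis {v : ℂ} (hv : torusProj v = 0) :
    ∃ (A : ℂ ≃L[ℝ] ℂ) (d : ℤ), (∀ z, torusProj (A z) = 0 ↔ torusProj z = 0) ∧ A d = v := by
  obtain ⟨m, n, rfl⟩ := torusProj_eq_zero_iff.1 hv
  obtain ⟨a, b, c, e, d, hdet, rfl, rfl⟩ :
      ∃ a b c e d : ℤ, a * e - b * c = 1 ∧ m = d * a ∧ n = d * b := by
    by_cases h : m = 0 ∧ n = 0
    · exact ⟨1, 0, 0, 1, 0, by simp, by simp [h.1], by simp [h.2]⟩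
    · have hg : 0 < Int.gcd m n := Int.gcd_pos_iff.2 (by tauto)
      obtain ⟨g, a, b, hg0, hco, h1, h2⟩ := Int.exists_gcd_one' hg
      obtain ⟨x, y, hxy⟩ := Int.isCoprime_iff_gcd_eq_one.2 hco
      exact ⟨a, b, -y, x, g, by linarith, by linarith, by linarith⟩
  have hdet' : (a * e - b * c : ℝ) = 1 := by exact_mod_cast hdet
  let A : ℂ →ₗ[ℝ] ℂ :=
    { toFun := fun z => ⟨a * z.re + c * z.im, b * z.re + e * z.im⟩
      map_add' := fun z w => Complex.ext (by simp; ring) (by simp; ring)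
      map_smul' := fun r z => Complex.ext (by simp; ring) (by simp; ring) }
  let B : ℂ →ₗ[ℝ] ℂ :=
    { toFun := fun z => ⟨e * z.re - c * z.im, a * z.im - b * z.re⟩
      map_add' := fun z w => Complex.ext (by simp; ring) (by simp; ring)
      map_smul' := fun r z => Complex.ext (by simp; ring) (by simp; ring) }
  have hBA : ∀ z, B (A z) = z := fun z => Complex.ext
    (show (e * (a * z.re + c * z.im) - c * (b * z.re + e * z.im) : ℝ) = z.re by
      linear_combination z.re * hdet')
    (show (a * (b * z.re + e * z.im) - b * (a * z.re + c * z.im) : ℝ) = z.im by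
      linear_combination z.im * hdet')
  have hAB : ∀ z, A (B z) = z := fun z => Complex.ext
    (show (a * (e * z.re - c * z.im) + c * (a * z.im - b * z.re) : ℝ) = z.re by
      linear_combination z.re * hdet')
    (show (b * (e * z.re - c * z.im) + e * (a * z.im - b * z.re) : ℝ) = z.im by
      linear_combination z.im * hdet')
  have hAl : ∀ z, torusProj z = 0 → torusProj (A z) = 0 := fun z hz => by
    obtain ⟨m, n, rfl⟩ := torusProj_eq_zero_iff.1 hz
    exact torusProj_eq_zero_iff.2 ⟨a * m + c * n, b * m + e * n,
      Complex.ext (by simp [A]) (by simp [A])⟩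
  have hBl : ∀ z, torusProj z = 0 → torusProj (B z) = 0 := fun z hz => by
    obtain ⟨m, n, rfl⟩ := torusProj_eq_zero_iff.1 hz
    exact torusProj_eq_zero_iff.2 ⟨e * m - c * n, a * n - b * m,
      Complex.ext (by simp [B]) (by simp [B])⟩
  refine ⟨(LinearEquiv.ofLinearMap A B (LinearMap.ext hAB)
    (LinearMap.ext hBA)).toContinuousLinearEquiv, d, fun z => ⟨fun h => ?_, hAl z⟩, ?_⟩
  · rw [← hBA z]
    exact hBl _ h
  · exact Complex.ext (by simp [A]; ring) (by simp [A]; ring)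

end Lifting

/-! ### Deck-equivariant homeomorphisms of the plane -/

section DeckEquivariant

/-- The homeomorphisms of the plane which commute with the deck transformations. -/
def deckCentralizer : Subgroup (ℂ ≃ₜ ℂ) where
  carrier := {G | IsDeckEquivariant G}
  mul_mem' {F G} hF hG z w hw := by
    rw [Homeomorph.mul_apply, hG z w hw, hF _ w hw, Homeomorph.mul_apply]
  one_mem' _ _ _ := rfl
  inv_mem' {G} hG z w hw := by
    refine G.injective ?_
    rw [hG _ w hw]
    simp [Homeomorph.inv_apply]

lemma addRight_mem_deckCentralizer (c : ℂ) : Homeomorph.addRight c ∈ deckCentralizer :=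
  fun z w _ => add_right_comm z w c

lemma commute_addRight {G : ℂ ≃ₜ ℂ} (hG : G ∈ deckCentralizer) {c : ℂ} (hc : torusProj c = 0) :
    Commute G (Homeomorph.addRight c) :=
  Homeomorph.ext fun z => hG z c hc

lemma zpow_semiconj {X Y : Type*} [TopologicalSpace X] [TopologicalSpace Y] {Φ : X ≃ₜ X}
    {u : Y ≃ₜ Y} {E : Y → X} (h : ∀ z, E (u z) = Φ (E z)) (n : ℤ) (z : Y) :
    E ((u ^ n) z) = (Φ ^ n) (E z) := by
  induction n generalizing z with
  | zero => rfl
  | succ n ih => rw [zpow_add_one, zpow_add_one, Homeomorph.mul_apply, ih, h]; rfl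
  | pred n ih =>
    rw [zpow_sub_one, zpow_sub_one, Homeomorph.mul_apply, ih, Homeomorph.mul_apply]
    congr 1
    rw [Homeomorph.inv_apply, Homeomorph.inv_apply, Homeomorph.eq_symm_apply, ← h,
      Homeomorph.apply_symm_apply]

lemma addRight_zpow_apply (c : ℂ) (n : ℤ) (z : ℂ) : (Homeomorph.addRight c ^ n) z = z + n * c := by
  induction n generalizing z with
  | zero => simp
  | succ n ih =>
    rw [zpow_add_one, Homeomorph.mul_apply, ih]
    simp
    ring
  | pred n ih =>
    have h : (Homeomorph.addRight c)⁻¹ z = z - c := by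
      rw [Homeomorph.inv_apply, Homeomorph.symm_apply_eq]
      exact (sub_add_cancel z c).symm
    rw [zpow_sub_one, Homeomorph.mul_apply, ih, h]
    push_cast
    ring

lemma torusProj_intCast (n : ℤ) : torusProj n = 0 :=
  torusProj_eq_zero_iff.2 ⟨n, 0, by simp⟩

lemma torusProj_intCast_mul_I (n : ℤ) : torusProj (n * Complex.I) = 0 :=
  torusProj_eq_zero_iff.2 ⟨0, n, by simp⟩

lemma IsDeckEquivariant.exists_norm_sub_le {G : ℂ → ℂ} (hG : Continuous G)
    (h : IsDeckEquivariant G) : ∃ M, ∀ z, ‖G z - z‖ ≤ M := by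
  obtain ⟨M, hM⟩ := (isCompact_closedBall (0 : ℂ) 2).exists_bound_of_continuousOn
    (hG.sub continuous_id).continuousOn
  refine ⟨M, fun z => ?_⟩
  set w : ℂ := ⌊z.re⌋ + ⌊z.im⌋ * Complex.I with hw
  have hw0 : torusProj w = 0 := torusProj_eq_zero_iff.2 ⟨_, _, rfl⟩
  have h1 := hM (z - w) (by
    rw [mem_closedBall_zero_iff]
    refine (Complex.norm_le_abs_re_add_abs_im _).trans ?_
    have h1 : (z - w).re = Int.fract z.re := by simp [hw]
    have h2 : (z - w).im = Int.fract z.im := by simp [hw]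
    rw [h1, h2, abs_of_nonneg (Int.fract_nonneg _), abs_of_nonneg (Int.fract_nonneg _)]
    linarith [Int.fract_lt_one z.re, Int.fract_lt_one z.im])
  have h2 := h (z - w) w hw0
  rw [sub_add_cancel] at h2
  have h3 : G z - z = G (z - w) - (z - w) := by linear_combination h2
  rw [h3]
  exact h1

lemma eq_one_of_pow_prime {G : ℂ ≃ₜ ℂ} (hG : G ∈ deckCentralizer) {l : ℕ} (hl : l.Prime)
    (h : G ^ l = 1) : G = 1 := by
  obtain ⟨M, hM⟩ := IsDeckEquivariant.exists_norm_sub_le G.continuous hG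
  refine Homeomorph.ext fun z => eq_id_of_iterate_prime G.continuous hM hl (fun z => ?_) z
  rw [← homeomorph_pow_apply, h]
  rfl

end DeckEquivariant

/-! ### Passing to the punctured plane -/

section Cylinder

/-- The covering `z ↦ exp (2πz)` of the punctured plane. -/
noncomputable def cylProj (z : ℂ) : ℂ := Complex.exp (2 * Real.pi * z)

lemma two_pi_ne_zero' : (2 * Real.pi : ℂ) ≠ 0 := by
  exact_mod_cast Real.two_pi_pos.ne'

lemma continuous_cylProj : Continuous cylProj := by
  unfold cylProj
  fun_prop

lemma cylProj_ne_zero (z : ℂ) : cylProj z ≠ 0 := Complex.exp_ne_zero _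

lemma cylProj_add (z w : ℂ) : cylProj (z + w) = cylProj z * cylProj w := by
  rw [cylProj, mul_add, Complex.exp_add]
  rfl

lemma cylProj_log {w : ℂ} (hw : w ≠ 0) : cylProj (Complex.log w / (2 * Real.pi)) = w := by
  rw [cylProj, mul_div_cancel₀ _ two_pi_ne_zero', Complex.exp_log hw]

lemma cylProj_eq_iff {z w : ℂ} : cylProj z = cylProj w ↔ ∃ n : ℤ, z = w + n * Complex.I := by
  rw [cylProj, cylProj, Complex.exp_eq_exp_iff_exists_int]
  refine exists_congr fun n => ⟨fun h => ?_, fun h => by rw [h]; ring⟩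
  refine mul_left_cancel₀ two_pi_ne_zero' ?_
  rw [h]
  ring

lemma torusProj_eq_of_cylProj_eq {z w : ℂ} (h : cylProj z = cylProj w) :
    torusProj z = torusProj w := by
  obtain ⟨n, rfl⟩ := cylProj_eq_iff.1 h
  rw [map_add, torusProj_intCast_mul_I, add_zero]

lemma continuousOn_comp_log {g : ℂ → ℂ} (hg : Continuous g)
    (h : ∀ z w, cylProj z = cylProj w → g z = g w) :
    ContinuousOn (fun w => g (Complex.log w / (2 * Real.pi))) {0}ᶜ := by
  intro a ha
  have ha : a ≠ 0 := ha
  have hc : ContinuousAt (fun w => g (Complex.log a / (2 * Real.pi) +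
      Complex.log (w / a) / (2 * Real.pi))) a := by
    refine hg.continuousAt.comp (continuousAt_const.add (ContinuousAt.div_const ?_ _))
    refine ContinuousAt.clog (continuousAt_id.div_const a) ?_
    simp only [div_self ha]
    exact Complex.one_mem_slitPlane
  refine hc.continuousWithinAt.congr (fun w hw => h _ _ ?_) (h _ _ ?_)
  · rw [cylProj_add, cylProj_log hw, cylProj_log ha, cylProj_log (div_ne_zero hw ha),
      mul_div_cancel₀ _ ha]
  · rw [cylProj_add, cylProj_log ha, cylProj_log (div_ne_zero ha ha), mul_div_cancel₀ _ ha]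

lemma exists_map_punctured {G : ℂ → ℂ} (hG : Continuous G) (h : IsDeckEquivariant G) :
    ∃ Φ : ℂ → ℂ, Continuous Φ ∧ Φ 0 = 0 ∧ (∀ z, Φ (cylProj z) = cylProj (G z)) ∧
      HasLogOn (fun w => Φ w / w) {0}ᶜ := by
  set g : ℂ → ℂ := fun z => G z - z with hg
  have hgc : Continuous g := hG.sub continuous_id
  have hgi : ∀ z w, cylProj z = cylProj w → g z = g w := fun z w hzw => by
    obtain ⟨n, rfl⟩ := cylProj_eq_iff.1 hzw
    simp only [hg]
    rw [h w _ (torusProj_intCast_mul_I n)]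
    ring
  have hγ := continuousOn_comp_log hgc hgi
  set γ : ℂ → ℂ := fun w => g (Complex.log w / (2 * Real.pi)) with hγdef
  obtain ⟨M, hM⟩ := h.exists_norm_sub_le hG
  have hc : ContinuousOn (fun w => cylProj (γ w)) {0}ᶜ := continuous_cylProj.comp_continuousOn hγ
  refine ⟨fun w => w * cylProj (γ w), ?_, zero_mul _, fun z => ?_,
    fun w => 2 * Real.pi * γ w, continuousOn_const.mul hγ, fun w hw => ?_⟩
  · refine continuous_iff_continuousAt.2 fun a => ?_
    by_cases ha : a = 0
    · rw [ha, ContinuousAt, zero_mul]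
      refine squeeze_zero_norm (a := fun w => ‖w‖ * Real.exp (2 * Real.pi * M)) (fun w => ?_) ?_
      · rw [norm_mul, cylProj, Complex.norm_exp]
        refine mul_le_mul_of_nonneg_left (Real.exp_le_exp.2 ?_) (norm_nonneg _)
        have h1 : (2 * Real.pi * γ w : ℂ).re = 2 * Real.pi * (γ w).re := by
          rw [← Complex.re_ofReal_mul]
          push_cast
          rfl
        rw [h1]
        exact mul_le_mul_of_nonneg_left ((Complex.re_le_norm _).trans (hM _)) Real.two_pi_pos.le
      · have : Continuous fun w : ℂ => ‖w‖ * Real.exp (2 * Real.pi * M) := by fun_prop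
        simpa using this.tendsto 0
    · exact continuousAt_id.mul (hc.continuousAt (isOpen_compl_singleton.mem_nhds ha))
  · beta_reduce
    have h1 : γ (cylProj z) = g z := hgi _ _ (cylProj_log (cylProj_ne_zero z))
    rw [h1, ← cylProj_add]
    simp only [hg, add_sub_cancel]
  · beta_reduce
    rw [mul_div_cancel_left₀ _ hw]
    rfl

lemma exists_homeomorph_punctured {u : ℂ ≃ₜ ℂ} (hu : u ∈ deckCentralizer) :
    ∃ Φ : ℂ ≃ₜ ℂ, Φ 0 = 0 ∧ (∀ z, cylProj (u z) = Φ (cylProj z)) ∧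
      HasLogOn (fun w => Φ w / w) {0}ᶜ := by
  obtain ⟨Φ, hΦ, hΦ0, hΦE, hlog⟩ := exists_map_punctured u.continuous hu
  obtain ⟨Φ', hΦ', hΦ0', hΦE', -⟩ :=
    exists_map_punctured u.symm.continuous (deckCentralizer.inv_mem hu)
  refine ⟨⟨⟨Φ, Φ', fun w => ?_, fun w => ?_⟩, hΦ, hΦ'⟩, hΦ0, fun z => (hΦE z).symm, hlog⟩
  all_goals
    rcases eq_or_ne w 0 with rfl | hw
    · simp only [hΦ0, hΦ0']
    · rw [← cylProj_log hw]
      simp only [hΦE, hΦE', Homeomorph.symm_apply_apply, Homeomorph.apply_symm_apply]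

theorem exists_planar_conjugacy {G : ℂ ≃ₜ ℂ} (hG : G ∈ deckCentralizer) {p : ℕ} (hp : 0 < p)
    {d : ℤ} (hd : IsCoprime d (p : ℤ)) (hGp : G ^ p = Homeomorph.addRight (d : ℂ)) :
    ∃ Θ : ℂ → ℂ, Continuous Θ ∧
      (∀ z w, torusProj (Θ z) = torusProj (Θ w) ↔ torusProj z = torusProj w) ∧
      (∀ y, ∃ z, torusProj (Θ z) = torusProj y) ∧
      ∀ z, torusProj (Θ (z + d / p)) = torusProj (G (Θ z)) := by
  have hp0 : (p : ℂ) ≠ 0 := by exact_mod_cast hp.ne'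
  have hT : ∀ n : ℤ, Homeomorph.addRight (n : ℂ) = Homeomorph.addRight (1 : ℂ) ^ n := fun n =>
    Homeomorph.ext fun z => by rw [addRight_zpow_apply, mul_one]; rfl
  obtain ⟨u, hu, hup, hud⟩ : ∃ u ∈ deckCentralizer,
      u ^ (p : ℤ) = Homeomorph.addRight (1 : ℂ) ∧ u ^ d = G := by
    obtain ⟨b, a, hab⟩ := hd
    have hcomm : Commute G (Homeomorph.addRight (1 : ℂ)) :=
      commute_addRight hG (by simpa using torusProj_intCast 1)
    have hGp' : G ^ (p : ℤ) = Homeomorph.addRight (1 : ℂ) ^ d := by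
      rw [zpow_natCast, hGp, hT]
    have hcomm' := hcomm.zpow_zpow b a
    refine ⟨G ^ b * Homeomorph.addRight (1 : ℂ) ^ a, deckCentralizer.mul_mem
      (deckCentralizer.zpow_mem hG b)
      (deckCentralizer.zpow_mem (addRight_mem_deckCentralizer 1) a), ?_, ?_⟩
    · rw [hcomm'.mul_zpow, ← zpow_mul, mul_comm b, zpow_mul, hGp', ← zpow_mul, ← zpow_mul,
        ← zpow_add, mul_comm d, hab, zpow_one]
    · rw [hcomm'.mul_zpow, ← zpow_mul, ← zpow_mul, mul_comm a d, zpow_mul _ d a, ← hGp',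
        ← zpow_mul, ← zpow_add, mul_comm (p : ℤ), hab, zpow_one]
  obtain ⟨Φ, hΦ0, hΦE, hlog⟩ := exists_homeomorph_punctured hu
  set s : ℝ := Real.exp (2 * Real.pi / p) with hs
  have hs1 : 1 < s := Real.one_lt_exp_iff.2 (by positivity)
  have hsE : (s : ℂ) = cylProj (1 / p) := by
    rw [hs, cylProj]
    push_cast
    congr 1
    ring
  have hspow : (s : ℂ) ^ p = cylProj 1 := by
    rw [hsE, cylProj, ← Complex.exp_nat_mul, cylProj]
    congr 1
    field_simp
  have hΦp : ∀ w, Φ^[p] w = (s : ℂ) ^ p * w := fun w => by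
    rcases eq_or_ne w 0 with rfl | hw
    · rw [Function.iterate_fixed hΦ0, mul_zero]
    · rw [← cylProj_log hw, ← homeomorph_pow_apply, ← zpow_natCast, ← zpow_semiconj hΦE, hup,
        hspow, mul_comm (cylProj 1), ← cylProj_add]
      rfl
  obtain ⟨Ψ, hΨc, hΨb, hΨs⟩ := exists_linearization Φ hΦ0 hp hs1 hΦp hlog
  obtain ⟨l, hlc, hl⟩ := HasLogOn.of_normedSpace (hΨc.comp_continuous continuous_cylProj
    fun z => cylProj_ne_zero z) fun z => hΨb.mapsTo (cylProj_ne_zero z)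
  set Θ : ℂ → ℂ := fun z => l z / (2 * Real.pi) with hΘ
  have hΘE : ∀ z, cylProj (Θ z) = Ψ (cylProj z) := fun z => by
    rw [cylProj, hΘ]
    beta_reduce
    rw [mul_div_cancel₀ _ two_pi_ne_zero']
    exact (hl z (mem_univ z)).symm
  have hstep : ∀ z, Ψ (cylProj (Homeomorph.addRight (1 / p : ℂ) z)) = Φ (Ψ (cylProj z)) :=
    fun z => by
      rw [← hΨs _ (cylProj_ne_zero z), hsE, mul_comm, ← cylProj_add]
      rfl
  have hstepn : ∀ (n : ℤ) (z : ℂ), cylProj (Θ (z + n / p)) = cylProj ((u ^ n) (Θ z)) :=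
    fun n z => by
      rw [zpow_semiconj hΦE, hΘE, hΘE, ← zpow_semiconj (E := fun z => Ψ (cylProj z)) hstep,
        addRight_zpow_apply, mul_one_div]
  have hlat : ∀ (m : ℤ) (z : ℂ), cylProj (Θ (z + m)) = cylProj (Θ z + m) := fun m z => by
    have h1 := hstepn (p * m) z
    rw [zpow_mul, hup, addRight_zpow_apply, mul_one] at h1
    rw [← h1]
    push_cast
    rw [mul_div_cancel_left₀ _ hp0]
  have hinj : ∀ z w, cylProj (Θ z) = cylProj (Θ w) ↔ cylProj z = cylProj w := fun z w => by
    rw [hΘE, hΘE]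
    exact hΨb.injOn.eq_iff (cylProj_ne_zero z) (cylProj_ne_zero w)
  refine ⟨Θ, (continuousOn_univ.1 hlc).div_const _, fun z w => ⟨fun h => ?_, fun h => ?_⟩,
    fun y => ?_, fun z => ?_⟩
  · rw [torusProj_eq_iff, torusProj_eq_zero_iff] at h
    obtain ⟨m, n, h⟩ := h
    have h1 : cylProj (Θ z) = cylProj (Θ w + m) :=
      cylProj_eq_iff.2 ⟨n, by rw [add_assoc, ← h, add_sub_cancel]⟩
    rw [← hlat, hinj] at h1
    rw [torusProj_eq_of_cylProj_eq h1, map_add, torusProj_intCast, add_zero]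
  · rw [torusProj_eq_iff, torusProj_eq_zero_iff] at h
    obtain ⟨m, n, h⟩ := h
    have h1 : cylProj z = cylProj (w + m) :=
      cylProj_eq_iff.2 ⟨n, by rw [add_assoc, ← h, add_sub_cancel]⟩
    rw [← hinj, hlat] at h1
    rw [torusProj_eq_of_cylProj_eq h1, map_add, torusProj_intCast, add_zero]
  · obtain ⟨w, hw, hwy⟩ := hΨb.surjOn (cylProj_ne_zero y)
    refine ⟨Complex.log w / (2 * Real.pi), torusProj_eq_of_cylProj_eq ?_⟩
    rw [hΘE, cylProj_log hw, hwy]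
  · rw [← hud]
    exact torusProj_eq_of_cylProj_eq (hstepn d z)

end Cylinder

/-! ### Descending to the torus -/

section Descent

lemma torusProj_add_intCast_div (z : ℂ) (d : ℤ) (p : ℕ) :
    torusProj (z + d / p) = torusTranslation d p (torusProj z) := by
  have h : (d / p : ℂ) = ((d / p : ℝ) : ℂ) := by push_cast; rfl
  rw [h, torusProj_apply, torusTranslation, torusProj_apply, Complex.add_re, Complex.add_im,
    Complex.ofReal_re, Complex.ofReal_im, add_zero, AddCircle.coe_add]

lemma exists_torus_homeomorph {H : ℂ → Torus2} (hH : Continuous H) (hs : Function.Surjective H)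
    (hi : ∀ z w, H z = H w ↔ torusProj z = torusProj w) :
    ∃ h : Torus2 ≃ₜ Torus2, ∀ z, h (torusProj z) = H z := by
  set h : Torus2 → Torus2 := fun t => H (Function.surjInv torusProj_surjective t)
  have hπ : ∀ z, h (torusProj z) = H z := fun z =>
    (hi _ _).2 (Function.surjInv_eq torusProj_surjective _)
  have hc : Continuous h := by
    refine (isOpenMap_torusProj.isQuotientMap continuous_torusProj
      torusProj_surjective).continuous_iff.2 ?_
    exact hH.congr fun z => (hπ z).symm
  have hb : Function.Bijective h := by
    refine ⟨fun t t' htt => ?_, fun t => ?_⟩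
    · obtain ⟨z, rfl⟩ := torusProj_surjective t
      obtain ⟨w, rfl⟩ := torusProj_surjective t'
      rwa [hπ, hπ, hi] at htt
    · obtain ⟨z, rfl⟩ := hs t
      exact ⟨torusProj z, hπ z⟩
  exact ⟨Continuous.homeoOfEquivCompactToT2 (f := Equiv.ofBijective h hb) hc, hπ⟩

lemma exists_normalized_lift {f : Torus2 ≃ₜ Torus2} {p : ℕ} (hp : 0 < p)
    (hfp : (f : Torus2 → Torus2)^[p] = id)
    (h : ContinuousMap.Homotopic ⟨f, f.continuous⟩ (ContinuousMap.id Torus2)) :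
    ∃ (A : ℂ ≃L[ℝ] ℂ) (G : ℂ ≃ₜ ℂ) (d : ℤ), (∀ z, torusProj (A z) = 0 ↔ torusProj z = 0) ∧
      G ∈ deckCentralizer ∧ G ^ p = Homeomorph.addRight (d : ℂ) ∧
      ∀ z, torusProj (A (G z)) = f (torusProj (A z)) := by
  obtain ⟨δ, hδ, hf⟩ := exists_torus_displacement h
  obtain ⟨F, v, hF, hFπ, hv, hFp⟩ := exists_lift (f := f) hδ hf hp hfp
  obtain ⟨A, d, hA, hAd⟩ := exists_lattice_basis hv
  set a : ℂ ≃ₜ ℂ := A.toHomeomorph with ha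
  have hG : ∀ z, (a⁻¹ * F * a⁻¹⁻¹) z = A.symm (F (A z)) := fun z => rfl
  refine ⟨A, a⁻¹ * F * a⁻¹⁻¹, d, hA, fun z w hw => ?_, Homeomorph.ext fun z => ?_, fun z => ?_⟩
  · rw [hG, hG, map_add, hF _ _ ((hA w).2 hw), map_add, A.symm_apply_apply]
  · have h1 : (a⁻¹ * F ^ p * a⁻¹⁻¹) z = A.symm ((F ^ p) (A z)) := rfl
    rw [conj_pow, h1, homeomorph_pow_apply, hFp, ← hAd, ← map_add, A.symm_apply_apply]
    rfl
  · rw [hG, A.apply_symm_apply, hFπ]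

lemma isCoprime_of_exact_order {f : Torus2 → Torus2} {p : ℕ} (hp : 0 < p)
    (hford : ∀ k : ℕ, 0 < k → k < p → f^[k] ≠ id) {P : ℂ → Torus2} (hP : Function.Surjective P)
    (hPd : ∀ (z : ℂ) (e : ℤ), P (z + e) = P z) {G : ℂ ≃ₜ ℂ} (hG : G ∈ deckCentralizer) {d : ℤ}
    (hGp : G ^ p = Homeomorph.addRight (d : ℂ)) (hGf : Function.Semiconj P G f) :
    IsCoprime d (p : ℤ) := by
  rw [Int.isCoprime_iff_gcd_eq_one]
  by_contra hne
  obtain ⟨l, hl, hdvd⟩ := Nat.exists_prime_and_dvd hne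
  obtain ⟨e, he⟩ : (l : ℤ) ∣ d := (Int.natCast_dvd_natCast.2 hdvd).trans (Int.gcd_dvd_left _ _)
  obtain ⟨k, rfl⟩ : l ∣ p := Int.natCast_dvd_natCast.1
    ((Int.natCast_dvd_natCast.2 hdvd).trans (Int.gcd_dvd_right _ _))
  have hk : 0 < k := Nat.pos_of_mul_pos_left hp
  have hroot : G ^ k * (Homeomorph.addRight (e : ℂ))⁻¹ = 1 := by
    refine eq_one_of_pow_prime (deckCentralizer.mul_mem (deckCentralizer.pow_mem hG k)
      (deckCentralizer.inv_mem (addRight_mem_deckCentralizer _))) hl ?_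
    rw [((commute_addRight hG (torusProj_intCast e)).pow_left k).inv_right.mul_pow, ← pow_mul,
      mul_comm k, hGp, inv_pow, mul_inv_eq_one]
    refine Homeomorph.ext fun z => ?_
    rw [← zpow_natCast, addRight_zpow_apply, he]
    push_cast
    rfl
  refine hford k hk (lt_mul_of_one_lt_left hk hl.one_lt) (funext fun x => ?_)
  obtain ⟨z, rfl⟩ := hP x
  rw [← (hGf.iterate_right k).eq, ← homeomorph_pow_apply, mul_inv_eq_one.1 hroot]
  exact hPd z e

end Descent

/-- A homeomorphism of the 2-torus of exact order `p ≥ 1` which is homotopic to the identity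
is topologically conjugate to the translation `(x, y) ↦ (x + q/p, y)` for some integer `q`
coprime to `p`. -/
theorem stmt2 (f : Torus2 ≃ₜ Torus2) (p : ℕ) (hp : 1 ≤ p)
    (hfp : (f : Torus2 → Torus2)^[p] = id)
    (hford : ∀ k : ℕ, 0 < k → k < p → (f : Torus2 → Torus2)^[k] ≠ id)
    (hhtpy : ContinuousMap.Homotopic ⟨f, f.continuous⟩ (ContinuousMap.id Torus2)) :
    ∃ (q : ℤ) (h : Torus2 ≃ₜ Torus2), IsCoprime q (p : ℤ) ∧
      ∀ x : Torus2, f x = h (torusTranslation q p (h.symm x)) := by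
  obtain ⟨A, G, d, hA, hG, hGp, hGf⟩ := exists_normalized_lift hp hfp hhtpy
  have hAs : Function.Surjective fun z => torusProj (A z) :=
    torusProj_surjective.comp A.surjective
  have hAeq : ∀ z w, torusProj (A z) = torusProj (A w) ↔ torusProj z = torusProj w :=
    fun z w => by rw [torusProj_eq_iff, ← map_sub, hA, ← torusProj_eq_iff]
  have hd : IsCoprime d (p : ℤ) := by
    refine isCoprime_of_exact_order hp hford hAs (fun z e => (hAeq _ _).2 ?_) hG hGp hGf
    rw [map_add, torusProj_intCast, add_zero]
  obtain ⟨Θ, hΘc, hΘi, hΘs, hΘ⟩ := exists_planar_conjugacy hG hp hd hGp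
  obtain ⟨h, hh⟩ := exists_torus_homeomorph (H := fun z => torusProj (A (Θ z)))
    (continuous_torusProj.comp (A.continuous.comp hΘc))
    (fun t => by
      obtain ⟨y, rfl⟩ := hAs t
      obtain ⟨z, hz⟩ := hΘs y
      exact ⟨z, (hAeq _ _).2 hz⟩)
    fun z w => (hAeq _ _).trans (hΘi z w)
  refine ⟨d, h, hd, fun x => ?_⟩
  obtain ⟨t, rfl⟩ := h.surjective x
  obtain ⟨z, rfl⟩ := torusProj_surjective t
  rw [h.symm_apply_apply, ← torusProj_add_intCast_div, hh, hh, ← hGf]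
  exact ((hAeq _ _).2 (hΘ z)).symm
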